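/- Let G be a finite group whose Sylow 2-subgroup P is isomorphic to a dihedral 2-group, i.e. P ≅ DihedralGroup(2^{n-1}) of order 2^n for some n ≥ 2 (including the Klein four-group for n = 2). Then for every irreducible complex character χ of G, the restriction χ_P is a sum of characters of the form λ^P induced from irreducible characters λ of subgroups Q ≤ P with χ(1)_2 = |P : Q|. -/

import Mathlib

open scoped Classical

/-- The induced character (as a class function formula): for `f` a function on a
subgroup `H` of a finite group `G`, `inducedChar H f g = (1/|H|) ∑_{x ∈ G, xgx⁻¹ ∈ H} f (xgx⁻¹)`. -/
noncomputable def inducedChar {G : Type*} [Group G] [Fintype G] (H : Subgroup G)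
    (f : H → ℂ) : G → ℂ :=
  fun g => (Fintype.card H : ℂ)⁻¹ *
    ∑ x : G, if h : x * g * x⁻¹ ∈ H then f ⟨x * g * x⁻¹, h⟩ else 0

/-- `χ` is the character of an irreducible complex representation of `G`. -/
def IsIrreducibleCharacter {G : Type} [Group G] (χ : G → ℂ) : Prop :=
  ∃ V : FDRep ℂ G, CategoryTheory.Simple V ∧ χ = FDRep.character V

/-- The restriction of `χ` (a character of degree `d` of the ambient group `G`) to the
subgroup `P` is a sum of characters `λ^P` induced from irreducible characters `λ` of
subgroups `Q ≤ P` satisfying `d_p = |P : Q|` (the `p`-part of the degree equals the index). -/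
def SumInducedProperty (p : ℕ) {G : Type} [Group G] [Fintype G] (P : Subgroup G)
    (χ : G → ℂ) (d : ℕ) : Prop :=
  ∃ (n : ℕ) (Q : Fin n → Subgroup ↥P) (lam : (i : Fin n) → ↥(Q i) → ℂ),
    (∀ i, IsIrreducibleCharacter (lam i)) ∧
    (∀ i, p ^ (d.factorization p) = (Q i).index) ∧
    (∀ x : ↥P, χ ↑x = ∑ i, inducedChar (Q i) (lam i) x)

set_option linter.unusedSectionVars false

section PartA

theorem idem_trace_nat {V : Type*} [AddCommGroup V] [Module ℂ V] [FiniteDimensional ℂ V]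
    (e : Module.End ℂ V) (he : e * e = e) :
    LinearMap.trace ℂ V e = (Module.finrank ℂ (LinearMap.range e) : ℂ) := by
  have h : LinearMap.IsProj (LinearMap.range e) e := by
    refine ⟨fun x => LinearMap.mem_range_self _ _, ?_⟩
    rintro x ⟨y, rfl⟩
    exact congrArg (fun f => f y) he
  exact h.trace

theorem irr_of_norm {G : Type} [Group G] [Fintype G] {V : Type} [AddCommGroup V] [Module ℂ V]
    [FiniteDimensional ℂ V] (ρ : Representation ℂ G V)
    (h : ∑ g : G, ρ.character g * ρ.character g⁻¹ = Nat.card G) :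
    IsIrreducibleCharacter ρ.character := by
  refine ⟨FDRep.of ρ, ?_, rfl⟩
  rw [FDRep.simple_iff_char_is_norm_one]
  exact h

theorem irr_of_linear {G : Type} [Group G] [Fintype G] (f : G →* ℂˣ) :
    IsIrreducibleCharacter (fun g => (f g : ℂ)) := by
  let ρ : Representation ℂ G ℂ :=
    { toFun := fun g => (f g : ℂ) • (1 : Module.End ℂ ℂ)
      map_one' := by simp
      map_mul' := by intro x y; ext; simp [mul_comm] }
  have hc : ρ.character = fun g => (f g : ℂ) := by
    ext g
    simp [Representation.character, ρ]
  rw [← hc]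
  apply irr_of_norm
  simp [hc]

theorem irr_of_irreducible {G : Type} [Group G] [Fintype G] {V : Type} [AddCommGroup V] [Module ℂ V]
    [FiniteDimensional ℂ V] (ρ : Representation ℂ G V) (h : ρ.IsIrreducible) :
    IsIrreducibleCharacter ρ.character := by
  have := invertibleOfNonzero (NeZero.ne (Nat.card G : ℂ))
  apply irr_of_norm
  have h1 := Representation.char_orthonormal ρ ρ
  rw [if_pos ⟨Representation.Equiv.refl _⟩] at h1
  rw [inv_mul_eq_iff_eq_mul₀ (NeZero.ne _)] at h1
  simpa using h1

theorem char_decomp {G : Type} [Group G] [Fintype G] (n : ℕ) : ∀ {V : Type} [AddCommGroup V]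
    [Module ℂ V] [FiniteDimensional ℂ V] (ρ : Representation ℂ G V), Module.finrank ℂ V ≤ n →
    ∃ s : Multiset (G → ℂ), (∀ f ∈ s, IsIrreducibleCharacter f) ∧ s.sum = ρ.character := by
  induction n with
  | zero =>
    intro V _ _ _ ρ h
    refine ⟨0, by simp, ?_⟩
    have : Subsingleton V := Module.finrank_zero_iff.mp (by omega : Module.finrank ℂ V = 0)
    ext g
    have : ρ g = 0 := Subsingleton.elim _ _
    simp [Representation.character, this]
  | succ n ih =>
    intro V _ _ _ ρ h
    by_cases hirr : ρ.IsIrreducible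
    · exact ⟨{ρ.character}, by simpa using irr_of_irreducible ρ hirr, by simp⟩
    by_cases hss : Subsingleton V
    · refine ⟨0, by simp, ?_⟩
      ext g
      have : ρ g = 0 := Subsingleton.elim _ _
      simp [Representation.character, this]
    have hnt : Nontrivial V := not_subsingleton_iff_nontrivial.mp hss
    have hnt2 : Nontrivial (Subrepresentation ρ) := by
      refine ⟨⊥, ⊤, fun h => ?_⟩
      have := congrArg Subrepresentation.toSubmodule h
      exact bot_ne_top (α := Submodule ℂ V) this
    obtain ⟨W, hW⟩ : ∃ W : Subrepresentation ρ, ¬ (W = ⊥ ∨ W = ⊤) := by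
      by_contra hcon
      push Not at hcon
      exact hirr ⟨fun W => by tauto⟩
    obtain ⟨W', hW'⟩ := exists_isCompl W
    have hc : IsCompl W.toSubmodule W'.toSubmodule := by
      rw [isCompl_iff, disjoint_iff, codisjoint_iff] at hW' ⊢
      exact ⟨congrArg Subrepresentation.toSubmodule hW'.1, congrArg Subrepresentation.toSubmodule hW'.2⟩
    push Not at hW
    have hWb : W.toSubmodule ≠ ⊥ := fun h => hW.1 (Subrepresentation.toSubmodule_injective h)
    have hWt : W.toSubmodule ≠ ⊤ := fun h => hW.2 (Subrepresentation.toSubmodule_injective h)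
    have hWpos : 0 < Module.finrank ℂ W.toSubmodule := by
      rw [Nat.pos_iff_ne_zero]; exact fun h => hWb (Submodule.finrank_eq_zero.mp h)
    have hWlt := Submodule.finrank_lt hWt
    have hsum := Submodule.finrank_add_eq_of_isCompl hc
    obtain ⟨s1, h1, h1'⟩ := ih W.toRepresentation (by omega)
    obtain ⟨s2, h2, h2'⟩ := ih W'.toRepresentation (by omega)
    refine ⟨s1 + s2, ?_, ?_⟩
    · intro f hf
      rcases Multiset.mem_add.mp hf with h | h
      · exact h1 _ h
      · exact h2 _ h
    · rw [Multiset.sum_add, h1', h2']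
      ext g
      have e := Submodule.prodEquivOfIsCompl _ _ hc
      have : ρ g = (Submodule.prodEquivOfIsCompl _ _ hc).conj
          ((W.toRepresentation g).prodMap (W'.toRepresentation g)) := by
        apply LinearMap.ext
        intro v
        obtain ⟨x, rfl⟩ := (Submodule.prodEquivOfIsCompl _ _ hc).surjective v
        rw [LinearEquiv.conj_apply_apply, LinearEquiv.symm_apply_apply]
        simp [Subrepresentation.toRepresentation]
      simp only [Representation.character, Pi.add_apply]
      rw [this, LinearMap.trace_conj', LinearMap.trace_prodMap']

theorem schur_fd {G : Type} [Group G] [Fintype G] (V : FDRep ℂ G) (hV : CategoryTheory.Simple V)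
    (T : Module.End ℂ V) (hT : ∀ g, T * V.ρ g = V.ρ g * T) : ∃ a : ℂ, T = a • 1 := by
  have := invertibleOfNonzero (NeZero.ne (Nat.card G : ℂ))
  have h1 := (FDRep.simple_iff_char_is_norm_one V).mp hV
  have h2 := Representation.card_inv_mul_sum_char_mul_char_eq_finrank V.ρ V.ρ
  have h3 : Module.finrank ℂ (Representation.IntertwiningMap V.ρ V.ρ) = 1 := by
    have : (Nat.card G : ℂ)⁻¹ * ∑ g : G, V.character g * V.character g⁻¹ = 1 := by
      rw [h1]; exact inv_mul_cancel₀ (NeZero.ne _)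
    have h4 := h2.symm.trans this
    exact_mod_cast h4
  let T' : Representation.IntertwiningMap V.ρ V.ρ := ⟨T, hT⟩
  let I' : Representation.IntertwiningMap V.ρ V.ρ := ⟨1, fun g => by rfl⟩
  by_cases hI : I' = 0
  · have hI2 : (1 : Module.End ℂ V) = 0 := congrArg (fun f => f.toLinearMap) hI
    refine ⟨0, ?_⟩
    rw [← mul_one T, hI2]; simp
  · obtain ⟨a, ha⟩ := (finrank_eq_one_iff_of_nonzero' I' hI).mp h3 T'
    exact ⟨a, (congrArg (fun f => f.toLinearMap) ha).symm⟩

theorem irr_orth {G : Type} [Group G] [Fintype G] {φ ψ : G → ℂ} (hφ : IsIrreducibleCharacter φ)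
    (hψ : IsIrreducibleCharacter ψ) :
    ∑ g : G, φ g * ψ g⁻¹ = if φ = ψ then (Nat.card G : ℂ) else 0 := by
  have := invertibleOfNonzero (NeZero.ne (Nat.card G : ℂ))
  obtain ⟨V, hV, rfl⟩ := hφ
  obtain ⟨W, hW, rfl⟩ := hψ
  have h1 := FDRep.char_orthonormal V W
  rw [inv_mul_eq_iff_eq_mul₀ (NeZero.ne _)] at h1
  rw [h1]
  by_cases h : Nonempty (V ≅ W)
  · rw [if_pos h, if_pos (FDRep.char_iso h.some)]; simp
  · rw [if_neg h]
    by_cases h' : V.character = W.character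
    · exfalso
      have h2 := (FDRep.simple_iff_char_is_norm_one V).mp hV
      rw [if_neg h, ← h', h2] at h1
      simp at h1
    · rw [if_neg h']; simp

end PartA

section PartB

def SchurRep {G : Type} [Group G] {V : Type} [AddCommGroup V] [Module ℂ V]
    (ρ : Representation ℂ G V) : Prop :=
  ∀ T : Module.End ℂ V, (∀ g, T * ρ g = ρ g * T) → ∃ a : ℂ, T = a • 1

theorem class_scalar {G : Type} [Group G] [Fintype G] {V : Type} [AddCommGroup V] [Module ℂ V]
    [FiniteDimensional ℂ V] [Nontrivial V] (ρ : Representation ℂ G V) (hS : SchurRep ρ)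
    (θ : G → ℂ) (hθ : ∀ g y, θ (g * y * g⁻¹) = θ y) :
    ∑ y, θ y • ρ y = ((∑ y, θ y * ρ.character y) / (Module.finrank ℂ V : ℂ)) • 1 := by
  obtain ⟨a, ha⟩ := hS (∑ y, θ y • ρ y) (by
    intro g
    rw [Finset.sum_mul, Finset.mul_sum]
    rw [← Equiv.sum_comp (MulAut.conj g).toEquiv]
    apply Finset.sum_congr rfl
    intro y _
    simp only [MulEquiv.toEquiv_eq_coe, EquivLike.coe_coe, MulAut.conj_apply]
    rw [hθ, smul_mul_assoc, mul_smul_comm, ← map_mul, ← map_mul]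
    simp)
  have hn : (Module.finrank ℂ V : ℂ) ≠ 0 := by
    have := Module.finrank_pos (R := ℂ) (M := V)
    exact_mod_cast this.ne'
  have ht := congrArg (LinearMap.trace ℂ V) ha
  simp only [map_sum, map_smul, smul_eq_mul, LinearMap.trace_one] at ht
  rw [ha]
  congr 1
  rw [eq_div_iff hn, ← ht]
  rfl

theorem class_integral {G : Type} [Group G] [Fintype G] {V : Type} [AddCommGroup V] [Module ℂ V]
    [FiniteDimensional ℂ V] [Nontrivial V] (ρ : Representation ℂ G V) (hS : SchurRep ρ)
    (θ : G → ℂ) (hθ : ∀ g y, θ (g * y * g⁻¹) = θ y) (hi : ∀ y, IsIntegral ℤ (θ y)) :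
    IsIntegral ℤ ((∑ y, θ y * ρ.character y) / (Module.finrank ℂ V : ℂ)) := by
  set a := (∑ y, θ y * ρ.character y) / (Module.finrank ℂ V : ℂ) with ha
  have h := class_scalar ρ hS θ hθ
  rw [← ha] at h
  let A := integralClosure ℤ ℂ
  let M : Submodule A (Module.End ℂ V) := Submodule.span A (Set.range ρ)
  have hI : IsIntegral A a := by
    refine isIntegral_of_smul_mem_submodule (R := A) (A := ℂ) (M := Module.End ℂ V) M ?_
      (Submodule.fg_span (Set.finite_range _)) a ?_
    · intro hM
      have : (1 : Module.End ℂ V) ∈ M := Submodule.subset_span ⟨1, map_one ρ⟩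
      rw [hM] at this
      exact one_ne_zero ((Submodule.mem_bot A).mp this)
    · intro n hn
      induction hn using Submodule.span_induction with
      | mem x hx =>
        obtain ⟨g, rfl⟩ := hx
        have : a • ρ g = ∑ y, (⟨θ y, hi y⟩ : A) • ρ (y * g) := by
          calc a • ρ g = (a • (1 : Module.End ℂ V)) * ρ g := by simp
            _ = _ := by
              rw [← h, Finset.sum_mul]
              apply Finset.sum_congr rfl
              intro y _
              rw [smul_mul_assoc, ← map_mul]
              rfl
        rw [this]
        exact Submodule.sum_mem _ fun y _ => Submodule.smul_mem _ _ (Submodule.subset_span ⟨_, rfl⟩)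
      | zero => simp
      | add x y _ _ hx hy => rw [smul_add]; exact Submodule.add_mem _ hx hy
      | smul c x _ hx => rw [smul_comm]; exact Submodule.smul_mem _ _ hx
  exact isIntegral_trans (R := ℤ) (A := A) _ hI

theorem sum_conj_integral {G : Type} [Group G] [Fintype G] {V : Type} [AddCommGroup V] [Module ℂ V]
    [FiniteDimensional ℂ V] [Nontrivial V] (ρ : Representation ℂ G V) (hS : SchurRep ρ)
    (ψ : G → ℂ) (S : Subgroup G) (hψ : ∀ s ∈ S, ∀ y, ψ (s⁻¹ * y * s) = ψ y)
    (hi : ∀ y, IsIntegral ℤ (ψ y)) :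
    IsIntegral ℤ ((Nat.card G : ℂ) / ((Module.finrank ℂ V : ℂ) * (Nat.card S : ℂ)) *
      ∑ y, ψ y * ρ.character y) := by
  have hn : (Module.finrank ℂ V : ℂ) ≠ 0 := by
    have := Module.finrank_pos (R := ℂ) (M := V)
    exact_mod_cast this.ne'
  have hs : (Nat.card S : ℂ) ≠ 0 := by exact_mod_cast Nat.card_pos.ne'
  let Θ : G → ℂ := fun y => ∑ t : G ⧸ S, ψ ((t.out)⁻¹ * y * t.out)
  have hΘ : ∀ y, (Nat.card S : ℂ) * Θ y = ∑ t : G, ψ (t⁻¹ * y * t) := by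
    intro y
    rw [← Finset.sum_fiberwise (s := Finset.univ) (g := fun t : G => (t : G ⧸ S)), Finset.mul_sum]
    apply Finset.sum_congr rfl
    intro q _
    have h1 : ∀ t ∈ Finset.univ.filter (fun t : G => (t : G ⧸ S) = q),
        ψ (t⁻¹ * y * t) = ψ ((q.out)⁻¹ * y * q.out) := by
      intro t ht
      simp only [Finset.mem_filter, Finset.mem_univ, true_and] at ht
      have h2 : (q.out)⁻¹ * t ∈ S := by
        rw [← QuotientGroup.eq, QuotientGroup.out_eq', ht]
      rw [← hψ _ h2 ((q.out)⁻¹ * y * q.out)]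
      congr 1
      group
    rw [Finset.sum_congr rfl h1, Finset.sum_const, nsmul_eq_mul]
    congr 1
    rw [Nat.card_eq_fintype_card, ← Fintype.card_coe]
    norm_cast
    refine Fintype.card_congr ⟨fun s => ⟨q.out * s.1, ?_⟩, fun t => ⟨(q.out)⁻¹ * t.1, ?_⟩, ?_, ?_⟩
    · simp
    · have := t.2
      simp only [Finset.mem_filter, Finset.mem_univ, true_and] at this
      rw [← QuotientGroup.eq, QuotientGroup.out_eq', this]
    · intro s; simp
    · intro s; simp
  have hcl : ∀ g y, Θ (g * y * g⁻¹) = Θ y := by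
    intro g y
    apply mul_left_cancel₀ hs
    rw [hΘ, hΘ, ← Equiv.sum_comp (Equiv.mulLeft g)]
    apply Finset.sum_congr rfl
    intro t _
    congr 1
    simp only [Equiv.coe_mulLeft]
    group
  have hint := class_integral ρ hS Θ hcl (fun y => IsIntegral.sum _ fun t _ => hi _)
  convert hint using 1
  have : (Nat.card S : ℂ) * ∑ y, Θ y * ρ.character y
      = (Nat.card G : ℂ) * ∑ y, ψ y * ρ.character y := by
    rw [Finset.mul_sum]
    simp_rw [← mul_assoc, hΘ, Finset.sum_mul]
    rw [Finset.sum_comm]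
    have : ∀ t ∈ (Finset.univ : Finset G), ∑ y, ψ (t⁻¹ * y * t) * ρ.character y
        = ∑ y, ψ y * ρ.character y := by
      intro t _
      rw [← Equiv.sum_comp (MulAut.conj t).toEquiv]
      apply Finset.sum_congr rfl
      intro y _
      simp only [MulEquiv.toEquiv_eq_coe, EquivLike.coe_coe, MulAut.conj_apply]
      rw [Representation.char_conj]
      congr 2
      group
    rw [Finset.sum_congr rfl this]
    simp
  field_simp
  rw [← this]

theorem dvd_of_integral_div {a b : ℤ} (hb : b ≠ 0) (h : IsIntegral ℤ ((a : ℂ) / (b : ℂ))) :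
    b ∣ a := by
  have h1 : IsIntegral ℤ ((a : ℚ) / (b : ℚ)) := by
    have : ((a : ℂ) / (b : ℂ)) = algebraMap ℚ ℂ ((a : ℚ) / (b : ℚ)) := by simp
    rw [this] at h
    exact (isIntegral_algebraMap_iff (algebraMap ℚ ℂ).injective).mp h
  obtain ⟨m, hm⟩ := (IsIntegrallyClosed.isIntegral_iff).mp h1
  refine ⟨m, ?_⟩
  have hb' : (b : ℚ) ≠ 0 := by exact_mod_cast hb
  rw [eq_div_iff hb'] at hm
  have : (m : ℚ) * b = a := by simpa using hm
  rw [mul_comm]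
  exact_mod_cast this.symm

theorem geom_root {N : ℕ} {ω : ℂ} (hω : IsPrimitiveRoot ω N) (hN : 0 < N) (t : ℤ) :
    ∑ i ∈ Finset.range N, ω ^ ((i : ℤ) * t) = if (N : ℤ) ∣ t then (N : ℂ) else 0 := by
  have h0 : ω ≠ 0 := hω.ne_zero hN.ne'
  have h1 : ∀ i ∈ Finset.range N, ω ^ ((i : ℤ) * t) = (ω ^ t) ^ i := by
    intro i _
    rw [mul_comm, zpow_mul, zpow_natCast]
  rw [Finset.sum_congr rfl h1]
  split_ifs with h
  · rw [(hω.zpow_eq_one_iff_dvd t).mpr h]; simp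
  · have h2 : ω ^ t ≠ 1 := fun h' => h ((hω.zpow_eq_one_iff_dvd t).mp h')
    rw [geom_sum_eq h2]
    have : (ω ^ t) ^ N = 1 := by
      rw [← zpow_natCast, ← zpow_mul, mul_comm, zpow_mul, zpow_natCast, hω.pow_eq_one, one_zpow]
    rw [this]; simp

theorem sum_range_zmod {N : ℕ} [NeZero N] {R : Type*} [AddCommMonoid R] (f : ℤ → R)
    (hf : ∀ i, f (i + N) = f i) : ∑ i ∈ Finset.range N, f i = ∑ x : ZMod N, f (x.cast : ℤ) := by
  obtain ⟨n, rfl⟩ : ∃ n, N = n + 1 := ⟨N - 1, by have := NeZero.pos N; omega⟩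
  rw [Finset.sum_range]
  rfl

theorem periodic_congr {N : ℕ} {R : Type*} (f : ℤ → R) (hf : ∀ i, f (i + N) = f i) {a b : ℤ}
    (h : (N : ℤ) ∣ a - b) : f a = f b := by
  obtain ⟨c, hc⟩ := h
  have h1 : Function.Periodic f (N : ℤ) := hf
  have := h1.int_mul c b
  rw [← this]
  congr 1
  simp; linarith [mul_comm (N : ℤ) c]

theorem sum_range_neg {N : ℕ} [NeZero N] {R : Type*} [AddCommMonoid R] (f : ℤ → R)
    (hf : ∀ i, f (i + N) = f i) : ∑ i ∈ Finset.range N, f (-i) = ∑ i ∈ Finset.range N, f i := by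
  rw [sum_range_zmod f hf, sum_range_zmod (fun i => f (-i))]
  · rw [← Equiv.sum_comp (Equiv.neg (ZMod N))]
    apply Finset.sum_congr rfl
    intro x _
    apply periodic_congr f hf
    rw [← ZMod.intCast_zmod_eq_zero_iff_dvd]
    simp
  · intro i
    have := hf (-(i + N))
    rw [← this]; congr 1; ring

theorem sum_range_shift {N : ℕ} [NeZero N] {R : Type*} [AddCommMonoid R] (f : ℤ → R)
    (hf : ∀ i, f (i + N) = f i) (a : ℤ) :
    ∑ i ∈ Finset.range N, f (i + a) = ∑ i ∈ Finset.range N, f i := by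
  rw [sum_range_zmod f hf, sum_range_zmod (fun i => f (i + a))]
  · conv_rhs => rw [← Equiv.sum_comp (Equiv.addRight (a : ZMod N))]
    apply Finset.sum_congr rfl
    intro x _
    apply periodic_congr f hf
    rw [← ZMod.intCast_zmod_eq_zero_iff_dvd]
    simp
  · intro i
    have := hf (i + a)
    rw [← this]; congr 1; ring

end PartB

section PartC

noncomputable def eigProj {G : Type} [Group G] {V : Type} [AddCommGroup V] [Module ℂ V]
    (ρ : Representation ℂ G V) (g : G) (N : ℕ) (ω : ℂ) (j : ℤ) : Module.End ℂ V :=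
  (N : ℂ)⁻¹ • ∑ i ∈ Finset.range N, ω ^ (-((i : ℤ) * j)) • ρ (g ^ (i : ℤ))

section cyc
variable {G : Type} [Group G] {V : Type} [AddCommGroup V] [Module ℂ V]
  [FiniteDimensional ℂ V] (ρ : Representation ℂ G V) {g : G} {N : ℕ} (hN : 0 < N) (hg : g ^ N = 1)
  {ω : ℂ} (hω : IsPrimitiveRoot ω N)
include hN hg hω

theorem zpow_per (j i : ℤ) : ω ^ (-((i + N) * j)) = ω ^ (-(i * j)) := by
  have h0 : ω ≠ 0 := hω.ne_zero hN.ne'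
  have : -((i + N) * j) = -(i * j) + (N : ℤ) * (-j) := by ring
  rw [this, zpow_add₀ h0, zpow_mul ω N, zpow_natCast, hω.pow_eq_one, one_zpow, mul_one]

omit hω hN in
theorem gpow_per (i : ℤ) : g ^ (i + N) = g ^ i := by
  rw [zpow_add, zpow_natCast, hg, mul_one]

theorem eig_mul (j : ℤ) : ρ g * eigProj ρ g N ω j = ω ^ j • eigProj ρ g N ω j := by
  have : NeZero N := ⟨hN.ne'⟩
  have h0 : ω ≠ 0 := hω.ne_zero hN.ne'
  unfold eigProj
  rw [mul_smul_comm, smul_comm (ω ^ j)]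
  congr 1
  rw [Finset.mul_sum, Finset.smul_sum]
  rw [← sum_range_shift (fun i : ℤ => ω ^ j • ω ^ (-(i * j)) • ρ (g ^ i)) _ 1]
  · apply Finset.sum_congr rfl
    intro i _
    rw [mul_smul_comm, smul_smul, ← zpow_add₀ h0, ← map_mul]
    congr 2
    · ring
    · rw [add_comm, zpow_one_add]
  · intro i
    rw [zpow_per hN hg hω, gpow_per hg]

theorem eig_pow_mul (j : ℤ) (i : ℕ) :
    ρ (g ^ (i : ℤ)) * eigProj ρ g N ω j = ω ^ ((i : ℤ) * j) • eigProj ρ g N ω j := by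
  have h0 : ω ≠ 0 := hω.ne_zero hN.ne'
  induction i with
  | zero => simp
  | succ i ih =>
    have : g ^ (((i + 1 : ℕ)) : ℤ) = g * g ^ (i : ℤ) := by
      rw [Nat.cast_succ, add_comm, zpow_one_add]
    rw [this, map_mul, mul_assoc, ih, mul_smul_comm, eig_mul ρ hN hg hω, smul_smul, ← zpow_add₀ h0]
    congr 2
    push_cast
    ring

theorem eig_mul_eig (j j' : ℤ) : eigProj ρ g N ω j' * eigProj ρ g N ω j =
    if (N : ℤ) ∣ j - j' then eigProj ρ g N ω j else 0 := by
  have hNC : (N : ℂ) ≠ 0 := by exact_mod_cast hN.ne'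
  have h0 : ω ≠ 0 := hω.ne_zero hN.ne'
  conv_lhs => rw [eigProj]
  rw [smul_mul_assoc, Finset.sum_mul]
  have : ∀ i ∈ Finset.range N, ω ^ (-((i : ℤ) * j')) • ρ (g ^ (i : ℤ)) * eigProj ρ g N ω j
      = ω ^ ((i : ℤ) * (j - j')) • eigProj ρ g N ω j := by
    intro i _
    rw [smul_mul_assoc, eig_pow_mul ρ hN hg hω, smul_smul, ← zpow_add₀ h0]
    congr 2; ring
  rw [Finset.sum_congr rfl this, ← Finset.sum_smul, geom_root hω hN]
  split_ifs
  · rw [smul_smul, inv_mul_cancel₀ hNC, one_smul]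
  · simp

theorem eig_idem (j : ℤ) : eigProj ρ g N ω j * eigProj ρ g N ω j = eigProj ρ g N ω j := by
  rw [eig_mul_eig ρ hN hg hω]; simp

omit hN hg hω [FiniteDimensional ℂ V] in
theorem eig_comm (q : Module.End ℂ V) (hq : Commute (ρ g) q) (j : ℤ) :
    Commute (eigProj ρ g N ω j) q := by
  unfold eigProj
  apply Commute.smul_left
  apply Commute.sum_left
  intro i _
  apply Commute.smul_left
  rw [zpow_natCast, map_pow]
  exact hq.pow_left _

omit hN hg hω [FiniteDimensional ℂ V] in
theorem eig_trace (q : Module.End ℂ V) (j : ℤ) :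
    LinearMap.trace ℂ V (eigProj ρ g N ω j * q) =
    (N : ℂ)⁻¹ * ∑ i ∈ Finset.range N, ω ^ (-((i : ℤ) * j)) *
      LinearMap.trace ℂ V (ρ (g ^ (i : ℤ)) * q) := by
  unfold eigProj
  rw [smul_mul_assoc, map_smul, Finset.sum_mul, map_sum]
  simp

theorem eig_per (j j' : ℤ) (h : (N : ℤ) ∣ j - j') : eigProj ρ g N ω j = eigProj ρ g N ω j' := by
  apply periodic_congr (N := N) (eigProj ρ g N ω) _ h
  intro i
  unfold eigProj
  congr 1
  apply Finset.sum_congr rfl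
  intro a _
  congr 1
  have := zpow_per hN hg hω (j := a) (i := i)
  rw [mul_comm, this, mul_comm]

theorem eig_sum (i : ℤ) :
    ∑ j ∈ Finset.range N, ω ^ (i * j) • eigProj ρ g N ω j = ρ (g ^ i) := by
  have hNC : (N : ℂ) ≠ 0 := by exact_mod_cast hN.ne'
  have h0 : ω ≠ 0 := hω.ne_zero hN.ne'
  unfold eigProj
  simp_rw [smul_comm _ (N : ℂ)⁻¹]
  rw [← Finset.smul_sum]
  have hc : ∑ j ∈ Finset.range N, ω ^ (i * j) • ∑ a ∈ Finset.range N,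
      ω ^ (-((a : ℤ) * j)) • ρ (g ^ (a : ℤ)) = ∑ a ∈ Finset.range N, ∑ j ∈ Finset.range N,
      (ω ^ (i * j) * ω ^ (-((a : ℤ) * j))) • ρ (g ^ (a : ℤ)) := by
    simp_rw [Finset.smul_sum, smul_smul]
    rw [Finset.sum_comm]
  rw [hc]
  have : ∀ a ∈ Finset.range N, ∑ j ∈ Finset.range N, (ω ^ (i * j) * ω ^ (-((a : ℤ) * j))) •
      ρ (g ^ (a : ℤ)) = (if (N : ℤ) ∣ i - a then (N : ℂ) else 0) • ρ (g ^ (a : ℤ)) := by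
    intro a _
    rw [← Finset.sum_smul, ← geom_root hω hN]
    congr 1
    apply Finset.sum_congr rfl
    intro j _
    rw [← zpow_add₀ h0]
    congr 1; ring
  rw [Finset.sum_congr rfl this, Finset.smul_sum]
  have hN' : (N : ℤ) ≠ 0 := by exact_mod_cast hN.ne'
  have hmod := Int.emod_nonneg i hN'
  have hmod2 := Int.emod_lt_of_pos i (by exact_mod_cast hN : (0 : ℤ) < N)
  rw [Finset.sum_eq_single (i % N).toNat]
  · have e1 : (((i % N).toNat : ℕ) : ℤ) = i % N := Int.toNat_of_nonneg hmod
    rw [e1, if_pos (by rw [Int.dvd_iff_emod_eq_zero]; simp), smul_smul, inv_mul_cancel₀ hNC,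
      one_smul]
    congr 1
    apply periodic_congr (N := N) (fun i : ℤ => g ^ i) (gpow_per hg)
    rw [← Int.dvd_neg]
    simpa using Int.dvd_self_sub_emod
  · intro b hb hne
    rw [if_neg, zero_smul, smul_zero]
    intro hd
    apply hne
    have hb' := Finset.mem_range.mp hb
    have h2 : ((b : ℤ)) % N = i % N := Int.modEq_iff_dvd.mpr hd
    rw [Int.emod_eq_of_lt (by positivity) (by exact_mod_cast hb')] at h2
    omega
  · intro h
    exfalso
    apply h
    rw [Finset.mem_range]
    omega

/-- natural multiplicities. -/
theorem eig_nat (q : Module.End ℂ V) (hq : Commute (ρ g) q) (hqq : q * q = q) (j : ℤ) :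
    LinearMap.trace ℂ V (eigProj ρ g N ω j * q) =
      (Module.finrank ℂ (LinearMap.range (eigProj ρ g N ω j * q)) : ℂ) := by
  apply idem_trace_nat
  have := eig_comm ρ (N := N) (ω := ω) q hq j
  calc eigProj ρ g N ω j * q * (eigProj ρ g N ω j * q)
      = eigProj ρ g N ω j * (q * eigProj ρ g N ω j) * q := by simp only [mul_assoc]
    _ = eigProj ρ g N ω j * (eigProj ρ g N ω j * q) * q := by rw [this.eq]
    _ = (eigProj ρ g N ω j * eigProj ρ g N ω j) * (q * q) := by simp only [mul_assoc]
    _ = _ := by rw [eig_idem ρ hN hg hω, hqq]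

theorem eig_trace_sum (q : Module.End ℂ V) (i : ℤ) : LinearMap.trace ℂ V (ρ (g ^ i) * q) =
    ∑ j ∈ Finset.range N, ω ^ (i * j) * LinearMap.trace ℂ V (eigProj ρ g N ω j * q) := by
  rw [← eig_sum ρ hN hg hω i, Finset.sum_mul, map_sum]
  simp

end cyc

section chars
variable {G : Type} [Group G] [Fintype G] {V : Type} [AddCommGroup V] [Module ℂ V]
  [FiniteDimensional ℂ V] (ρ : Representation ℂ G V)

theorem char_as_sum (g : G) : ∃ (N : ℕ) (ω : ℂ) (y : ℕ → ℕ), 0 < N ∧ IsPrimitiveRoot ω N ∧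
    ∀ i : ℤ, ρ.character (g ^ i) = ∑ j ∈ Finset.range N, ω ^ (i * j) * (y j : ℂ) := by
  have hN : 0 < orderOf g := orderOf_pos g
  have hω := Complex.isPrimitiveRoot_exp (orderOf g) hN.ne'
  refine ⟨orderOf g, _, fun j => Module.finrank ℂ (LinearMap.range
    (eigProj ρ g (orderOf g) (Complex.exp (2 * Real.pi * Complex.I / orderOf g)) j * 1)),
    hN, hω, fun i => ?_⟩
  have := eig_trace_sum ρ hN (pow_orderOf_eq_one g) hω 1 i
  rw [mul_one] at this
  rw [Representation.character, this]
  apply Finset.sum_congr rfl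
  intro j _
  rw [eig_nat ρ hN (pow_orderOf_eq_one g) hω 1 (Commute.one_right _) (by simp)]

theorem char_integral (g : G) : IsIntegral ℤ (ρ.character g) := by
  obtain ⟨N, ω, y, hN, hω, h⟩ := char_as_sum ρ g
  have := h 1
  rw [zpow_one] at this
  rw [this]
  apply IsIntegral.sum
  intro j _
  apply IsIntegral.mul
  · rw [one_mul, zpow_natCast]
    exact (hω.isIntegral hN).pow _
  · simpa using (isIntegral_algebraMap (R := ℤ) (A := ℂ) (x := (y j : ℤ)))

theorem char_inv_conj (g : G) : ρ.character g⁻¹ = (starRingEnd ℂ) (ρ.character g) := by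
  obtain ⟨N, ω, y, hN, hω, h⟩ := char_as_sum ρ g
  have h1 := h 1
  have h2 := h (-1)
  rw [zpow_one] at h1
  rw [zpow_neg_one] at h2
  rw [h1, h2, map_sum]
  apply Finset.sum_congr rfl
  intro j _
  have hn : ‖ω‖ = 1 := hω.norm'_eq_one hN.ne'
  rw [map_mul, map_zpow₀, ← Complex.inv_eq_conj hn, Complex.conj_natCast, inv_zpow, ← zpow_neg]
  congr 2

theorem char_mul_inv (g : G) : ρ.character g * ρ.character g⁻¹ = ((‖ρ.character g‖ ^ 2 : ℝ) : ℂ) := by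
  rw [char_inv_conj, Complex.mul_conj, Complex.normSq_eq_norm_sq]
end chars

end PartC

section PartD

/-! Irreducible characters of a finite group: basic facts. -/
section irr
variable {G : Type} [Group G] [Fintype G]

/-- Unpack an irreducible character. -/
theorem irr_unpack {φ : G → ℂ} (h : IsIrreducibleCharacter φ) :
    ∃ (V : Type) (_ : AddCommGroup V) (_ : Module ℂ V) (_ : FiniteDimensional ℂ V)
      (_ : Nontrivial V) (ρ : Representation ℂ G V), SchurRep ρ ∧ φ = ρ.character := by
  obtain ⟨V, hV, rfl⟩ := h
  refine ⟨V, inferInstance, inferInstance, inferInstance, ?_, V.ρ, schur_fd V hV, rfl⟩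
  by_contra hn
  rw [not_nontrivial_iff_subsingleton] at hn
  have h1 := (FDRep.simple_iff_char_is_norm_one V).mp hV
  have h2 : ∀ g, V.character g = 0 := by
    intro g
    have : V.ρ g = 0 := by ext x; exact Subsingleton.elim _ _
    simp [FDRep.character, this]
  simp only [h2, mul_zero, Finset.sum_const_zero] at h1
  exact NeZero.ne (Nat.card G : ℂ) h1.symm

theorem irr_conj {φ : G → ℂ} (h : IsIrreducibleCharacter φ) (g y : G) : φ (g * y * g⁻¹) = φ y := by
  obtain ⟨V, _, _, _, _, ρ, hS, rfl⟩ := irr_unpack h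
  exact Representation.char_conj ρ y g

theorem irr_inv {φ : G → ℂ} (h : IsIrreducibleCharacter φ) (g : G) :
    φ g⁻¹ = (starRingEnd ℂ) (φ g) := by
  obtain ⟨V, _, _, _, _, ρ, hS, rfl⟩ := irr_unpack h
  exact char_inv_conj ρ g

theorem irr_integral {φ : G → ℂ} (h : IsIrreducibleCharacter φ) (g : G) : IsIntegral ℤ (φ g) := by
  obtain ⟨V, _, _, _, _, ρ, hS, rfl⟩ := irr_unpack h
  exact char_integral ρ g

theorem irr_norm {φ : G → ℂ} (h : IsIrreducibleCharacter φ) :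
    ∑ g, φ g * φ g⁻¹ = (Nat.card G : ℂ) := by
  rw [irr_orth h h, if_pos rfl]

theorem schur_dvd {V : Type} [AddCommGroup V] [Module ℂ V]
    [FiniteDimensional ℂ V] [Nontrivial V] (ρ : Representation ℂ G V) (hS : SchurRep ρ)
    (hn : ∑ g, ρ.character g * ρ.character g⁻¹ = (Nat.card G : ℂ)) :
    Module.finrank ℂ V ∣ Nat.card G := by
  have h1 := class_integral ρ hS (fun y => ρ.character y⁻¹) (by
    intro g y
    have : (g * y * g⁻¹)⁻¹ = g * y⁻¹ * g⁻¹ := by group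
    simp only [this]
    exact Representation.char_conj ρ _ g) (fun y => char_integral ρ _)
  have h2 : ∑ y, ρ.character y⁻¹ * ρ.character y = (Nat.card G : ℂ) := by
    rw [← hn]; exact Finset.sum_congr rfl fun _ _ => mul_comm _ _
  rw [h2] at h1
  have hpos := Module.finrank_pos (R := ℂ) (M := V)
  have := dvd_of_integral_div (a := Nat.card G) (b := Module.finrank ℂ V)
    (by exact_mod_cast hpos.ne') (by simpa using h1)
  exact_mod_cast this

theorem irr_degree {φ : G → ℂ} (h : IsIrreducibleCharacter φ) :
    ∃ d : ℕ, 0 < d ∧ d ∣ Nat.card G ∧ φ 1 = d := by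
  have hn := irr_norm h
  obtain ⟨V, _, _, _, _, ρ, hS, rfl⟩ := irr_unpack h
  exact ⟨Module.finrank ℂ V, Module.finrank_pos, schur_dvd ρ hS hn, Representation.char_one ρ⟩

/-- Convolution. -/
theorem irr_conv_class {φ θ : G → ℂ} (h : IsIrreducibleCharacter φ)
    (hθ : ∀ g y, θ (g * y * g⁻¹) = θ y) (x : G) :
    ∑ y, θ y * φ (y * x) = (∑ y, θ y * φ y) / φ 1 * φ x := by
  obtain ⟨V, _, _, _, _, ρ, hS, rfl⟩ := irr_unpack h
  have h1 := class_scalar ρ hS θ hθ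
  have h2 := congrArg (fun T => LinearMap.trace ℂ V (T * ρ x)) h1
  simp only [Finset.sum_mul, map_sum, smul_mul_assoc, map_smul, smul_eq_mul, one_mul] at h2
  rw [Representation.char_one]
  rw [Representation.character, ← h2]
  apply Finset.sum_congr rfl
  intro y _
  rw [Representation.character, map_mul]

theorem irr_conv {φ ψ : G → ℂ} (h : IsIrreducibleCharacter φ) (h' : IsIrreducibleCharacter ψ)
    (x : G) : ∑ y, φ y⁻¹ * ψ (y * x) = if φ = ψ then (Nat.card G : ℂ) / φ 1 * φ x else 0 := by
  rw [irr_conv_class h' (θ := fun y => φ y⁻¹)]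
  · have : ∑ y, φ y⁻¹ * ψ y = ∑ y, ψ y * φ y⁻¹ := Finset.sum_congr rfl fun _ _ => mul_comm _ _
    rw [this, irr_orth h' h]
    by_cases hh : φ = ψ
    · subst hh; simp
    · rw [if_neg hh, if_neg (fun h => hh h.symm)]; simp
  · intro g y
    have : (g * y * g⁻¹)⁻¹ = g * y⁻¹ * g⁻¹ := by group
    rw [this, irr_conj h]

noncomputable def regRep (G : Type) [Group G] : Representation ℂ G (G → ℂ) where
  toFun g := { toFun := fun f x => f (x * g), map_add' := fun _ _ => rfl, map_smul' := fun _ _ => rfl }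
  map_one' := by ext f x; simp
  map_mul' a b := by ext f x; simp [mul_assoc]

theorem regRep_char (g : G) : (regRep G).character g = if g = 1 then (Nat.card G : ℂ) else 0 := by
  rw [Representation.character, LinearMap.trace_eq_matrix_trace ℂ (Pi.basisFun ℂ G)]
  rw [Matrix.trace]
  simp only [Matrix.diag_apply, LinearMap.toMatrix_apply]
  have : ∀ x : G, ((Pi.basisFun ℂ G).repr ((regRep G) g ((Pi.basisFun ℂ G) x))) x =
      if g = 1 then 1 else 0 := by
    intro x
    simp [regRep, Pi.single_apply]
  simp_rw [this]
  split_ifs <;> simp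

theorem irr_complete {θ : G → ℂ} (hθ : ∀ g y, θ (g * y * g⁻¹) = θ y)
    (h : ∀ φ, IsIrreducibleCharacter φ → ∑ y, θ y * φ y⁻¹ = 0) : θ = 0 := by
  obtain ⟨s, hs, hsum⟩ := char_decomp _ (regRep G) le_rfl
  have h1 : ∀ φ, IsIrreducibleCharacter φ → ∀ x, ∑ y, θ y * φ (y⁻¹ * x) = 0 := by
    intro φ hφ x
    have := irr_conv_class hφ (θ := fun y => θ y⁻¹) (by
      intro g y
      have : (g * y * g⁻¹)⁻¹ = g * y⁻¹ * g⁻¹ := by group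
      rw [this, hθ]) x
    rw [← Equiv.sum_comp (Equiv.inv G)] at this
    simp only [Equiv.inv_apply, inv_inv] at this
    rw [this, ← Equiv.sum_comp (Equiv.inv G)]
    simp only [Equiv.inv_apply, inv_inv]
    rw [h φ hφ]; simp
  funext x
  have h2 : ∀ s : Multiset (G → ℂ), (∀ f ∈ s, IsIrreducibleCharacter f) →
      ∑ y, θ y * s.sum (y⁻¹ * x) = 0 := by
    intro s
    induction s using Multiset.induction with
    | empty => simp
    | cons a s ih =>
      intro hs
      simp only [Multiset.sum_cons, Pi.add_apply, mul_add, Finset.sum_add_distrib]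
      rw [ih (fun f hf => hs f (Multiset.mem_cons_of_mem hf)), h1 a (hs a (Multiset.mem_cons_self _ _)),
        add_zero]
  have h3 := h2 s hs
  rw [hsum] at h3
  simp only [regRep_char, inv_mul_eq_one] at h3
  simpa using h3

theorem irr_finite (G : Type) [Group G] [Fintype G] : {φ : G → ℂ | IsIrreducibleCharacter φ}.Finite := by
  have : LinearIndependent ℂ (fun φ : {φ : G → ℂ | IsIrreducibleCharacter φ} => φ.1) := by
    rw [linearIndependent_iff']
    intro s c hc i hi
    have h1 : ∑ g, (∑ j ∈ s, c j • j.1) g * i.1 g⁻¹ = 0 := by rw [hc]; simp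
    simp only [Finset.sum_apply, Finset.sum_mul] at h1
    rw [Finset.sum_comm, Finset.sum_eq_single i] at h1
    · simp only [Pi.smul_apply, smul_eq_mul, mul_assoc] at h1
      rw [← Finset.mul_sum, irr_norm i.2] at h1
      simpa using h1
    · intro b _ hne
      simp only [Pi.smul_apply, smul_eq_mul, mul_assoc]
      rw [← Finset.mul_sum, irr_orth b.2 i.2, if_neg, mul_zero]
      exact fun h => hne (Subtype.ext h)
    · intro h; exact absurd hi h
  have h2 := this.finite
  exact Set.toFinite _

noncomputable def IrrF (G : Type) [Group G] [Fintype G] : Finset (G → ℂ) := (irr_finite G).toFinset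

theorem mem_IrrF {φ : G → ℂ} : φ ∈ IrrF G ↔ IsIrreducibleCharacter φ := by
  simp [IrrF]

theorem irr_col (x : G) : ∑ φ ∈ IrrF G, φ 1 * φ x = if x = 1 then (Nat.card G : ℂ) else 0 := by
  have := irr_complete (θ := fun x => (∑ φ ∈ IrrF G, φ 1 * φ x) - if x = 1 then (Nat.card G : ℂ) else 0)
    (by
      intro g y
      congr 1
      · apply Finset.sum_congr rfl
        intro φ hφ
        rw [irr_conj (mem_IrrF.mp hφ)]
      · simp [conj_eq_one_iff])
    (by
      intro φ hφ
      simp only [sub_mul, Finset.sum_sub_distrib, Finset.sum_mul]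
      rw [Finset.sum_comm, Finset.sum_eq_single φ]
      · simp only [mul_assoc]
        rw [← Finset.mul_sum, irr_norm hφ]
        simp [mul_comm]
      · intro b hb hne
        simp only [mul_assoc]
        rw [← Finset.mul_sum, irr_orth (mem_IrrF.mp hb) hφ, if_neg hne, mul_zero]
      · intro h; exact absurd (mem_IrrF.mpr hφ) h)
  exact sub_eq_zero.mp (congrFun this x)
end irr

end PartD

section PartE

/-- generators. -/
def GenSet {P : Type} [Group P] [Fintype P] (d : ℕ) : Set (P → ℂ) :=
  {f | ∃ (Q : Subgroup P) (lam : Q → ℂ), IsIrreducibleCharacter lam ∧ d = Q.index ∧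
    f = inducedChar Q lam}

theorem genSet_closure {P : Type} [Group P] [Fintype P] {d : ℕ} {X : P → ℂ}
    (h : X ∈ AddSubmonoid.closure (GenSet (P := P) d)) :
    ∃ (n : ℕ) (Q : Fin n → Subgroup P) (lam : (i : Fin n) → ↥(Q i) → ℂ),
      (∀ i, IsIrreducibleCharacter (lam i)) ∧ (∀ i, d = (Q i).index) ∧
      (∀ x : P, X x = ∑ i, inducedChar (Q i) (lam i) x) := by
  obtain ⟨l, hl, rfl⟩ := AddSubmonoid.exists_list_of_mem_closure h
  choose Q lam h1 h2 h3 using hl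
  refine ⟨l.length, fun i => Q (l.get i) (List.get_mem _ _), fun i => lam (l.get i) (List.get_mem _ _),
    fun i => h1 _ _, fun i => h2 _ _, fun x => ?_⟩
  have : ∀ i : Fin l.length, inducedChar (Q (l.get i) (List.get_mem _ _))
    (lam (l.get i) (List.get_mem _ _)) x = l.get i x := fun i => by rw [← h3]
  simp only [this]
  rw [← Finset.sum_apply]
  rw [← List.sum_ofFn]
  rw [List.ofFn_get]

theorem irr_comp {G H : Type} [Group G] [Fintype G] [Group H] [Fintype H] (e : G ≃* H) {φ : H → ℂ}
    (h : IsIrreducibleCharacter φ) : IsIrreducibleCharacter (fun g => φ (e g)) := by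
  have hn := irr_norm h
  obtain ⟨V, _, _, _, _, ρ, hS, rfl⟩ := irr_unpack h
  have := irr_of_norm (ρ.comp e.toMonoidHom) (by
    rw [Nat.card_congr e.toEquiv, ← hn, ← Equiv.sum_comp e.toEquiv]
    apply Finset.sum_congr rfl
    intro x _
    simp [Representation.character])
  exact this

theorem ind_comp {G H : Type} [Group G] [Fintype G] [Group H] [Fintype H] (e : G ≃* H)
    (Q : Subgroup H) (lam : Q → ℂ) (g : G) :
    inducedChar Q lam (e g) = inducedChar (Q.comap e.toMonoidHom)
      (fun x => lam ⟨e x.1, x.2⟩) g := by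
  unfold inducedChar
  have hc : Fintype.card (Q.comap e.toMonoidHom) = Fintype.card Q := by
    refine Fintype.card_congr ⟨fun x => ⟨e x.1, x.2⟩, fun y => ⟨e.symm y.1, ?_⟩, ?_, ?_⟩
    · rw [Subgroup.mem_comap]; simp
    · intro x; apply Subtype.ext; simp
    · intro x; simp
  rw [hc]
  congr 1
  rw [← Equiv.sum_comp e.toEquiv]
  apply Finset.sum_congr rfl
  intro x _
  simp only [MulEquiv.toEquiv_eq_coe, EquivLike.coe_coe, Subgroup.mem_comap, MulEquiv.coe_toMonoidHom, map_mul, map_inv]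

theorem genSet_comp {G H : Type} [Group G] [Fintype G] [Group H] [Fintype H] (e : G ≃* H) {d : ℕ}
    {X : H → ℂ} (h : X ∈ AddSubmonoid.closure (GenSet (P := H) d)) :
    (fun g => X (e g)) ∈ AddSubmonoid.closure (GenSet (P := G) d) := by
  induction h using AddSubmonoid.closure_induction with
  | mem x hx =>
    obtain ⟨Q, lam, h1, h2, rfl⟩ := hx
    apply AddSubmonoid.subset_closure
    refine ⟨Q.comap e.toMonoidHom, fun x => lam ⟨e x.1, x.2⟩, ?_, ?_, ?_⟩
    · let e' : Q.comap e.toMonoidHom ≃* Q :=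
        { toFun := fun x => ⟨e x.1, x.2⟩
          invFun := fun y => ⟨e.symm y.1, by rw [Subgroup.mem_comap]; simp⟩
          left_inv := fun x => by apply Subtype.ext; simp
          right_inv := fun x => by simp
          map_mul' := fun x y => Subtype.ext (map_mul e x.1 y.1) }
      exact irr_comp e' h1
    · rw [h2, Subgroup.index_comap_of_surjective _ e.surjective]
    · funext g; exact ind_comp e Q lam g
  | zero => exact AddSubmonoid.zero_mem _
  | add x y _ _ hx hy => exact AddSubmonoid.add_mem _ hx hy

theorem irr_of_hom {G : Type} [Group G] [Fintype G] (f : G →* ℂ) :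
    IsIrreducibleCharacter (fun g => f g) := by
  have := irr_of_linear f.toHomUnits
  simpa using this

open DihedralGroup in
theorem sum_dihedral {m : ℕ} [NeZero m] {R : Type*} [AddCommMonoid R] (F : DihedralGroup m → R) :
    ∑ x, F x = ∑ i : ZMod m, F (r i) + ∑ i : ZMod m, F (sr i) := by
  rw [← Equiv.sum_comp DihedralGroup.equivSum.symm, Fintype.sum_sum_type]
  rfl

open DihedralGroup in
/-- Reduction of dihedral groups. -/
def dihMap {m b : ℕ} (h : b ∣ m) : DihedralGroup m →* DihedralGroup b where
  toFun x := match x with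
    | r i => r (ZMod.castHom h (ZMod b) i)
    | sr i => sr (ZMod.castHom h (ZMod b) i)
  map_one' := by
    rw [one_def]
    simp
  map_mul' x y := by
    rcases x with i | i <;> rcases y with j | j <;>
      simp only [r_mul_r, r_mul_sr, sr_mul_r, sr_mul_sr, map_add, map_sub]

theorem dihMap_surj {m b : ℕ} (h : b ∣ m) : Function.Surjective (dihMap h) := by
  rintro (i | i)
  · obtain ⟨j, hj⟩ := ZMod.castHom_surjective h i
    exact ⟨.r j, by simp only [dihMap, MonoidHom.coe_mk, OneHom.coe_mk]; rw [hj]⟩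
  · obtain ⟨j, hj⟩ := ZMod.castHom_surjective h i
    exact ⟨.sr j, by simp only [dihMap, MonoidHom.coe_mk, OneHom.coe_mk]; rw [hj]⟩

theorem card_ker_cast {m b : ℕ} [NeZero m] (h : b ∣ m) :
    (Finset.univ.filter (fun i : ZMod m => ZMod.castHom h (ZMod b) i = 0)).card * b = m := by
  have hb : b ≠ 0 := fun hb => by subst hb; exact NeZero.ne m (zero_dvd_iff.mp h)
  have : NeZero b := ⟨hb⟩
  have h1 := Finset.card_eq_sum_card_fiberwise (s := Finset.univ) (t := Finset.univ)
    (f := fun i : ZMod m => ZMod.castHom h (ZMod b) i) (by simp)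
  have h2 : ∀ c ∈ (Finset.univ : Finset (ZMod b)), (Finset.univ.filter
      (fun i : ZMod m => ZMod.castHom h (ZMod b) i = c)).card =
      (Finset.univ.filter (fun i : ZMod m => ZMod.castHom h (ZMod b) i = 0)).card := by
    intro c _
    obtain ⟨j, hj⟩ := ZMod.castHom_surjective h c
    apply Finset.card_bij' (fun i _ => i - j) (fun i _ => i + j)
    · intro i hi; simp only [Finset.mem_filter, Finset.mem_univ, true_and] at hi ⊢
      rw [map_sub, hi, hj, sub_self]
    · intro i hi; simp only [Finset.mem_filter, Finset.mem_univ, true_and] at hi ⊢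
      rw [map_add, hi, hj, zero_add]
    · intro i _; ring
    · intro i _; ring
  rw [Finset.sum_congr rfl h2] at h1
  simp only [Finset.card_univ, ZMod.card, Finset.sum_const, smul_eq_mul] at h1
  rw [mul_comm]; exact h1.symm

end PartE

section PartF

section gens
open DihedralGroup
variable {b k : ℕ}

local instance instNZpow (n : ℕ) : NeZero (2 ^ n) := ⟨by positivity⟩

theorem dvd1 (b k : ℕ) : 2 ^ b ∣ 2 ^ (b + k) := ⟨2 ^ k, by rw [pow_add]⟩
theorem dvd2 (b k : ℕ) : 2 ^ (b + 1) ∣ 2 ^ (b + (k + 1)) := ⟨2 ^ k, by rw [← pow_add]; ring_nf⟩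
theorem dvd3 (b k : ℕ) : 2 ∣ 2 ^ (b + (k + 1)) := ⟨2 ^ (b + k), by rw [← pow_succ']; ring_nf⟩

theorem ind_restrict {P : Type} [Group P] [Fintype P] (Q : Subgroup P) (F : P → ℂ) (g : P) :
    inducedChar Q (fun q => F q) g =
      (Nat.card Q : ℂ)⁻¹ * ∑ x, if x * g * x⁻¹ ∈ Q then F (x * g * x⁻¹) else 0 := by
  unfold inducedChar
  rw [Nat.card_eq_fintype_card]
  simp only [dite_eq_ite]

/-- rotation subgroup -/
def Qrot (b k : ℕ) : Subgroup (DihedralGroup (2 ^ (b + (k + 1)))) := (dihMap (dvd1 b (k + 1))).ker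

theorem mem_Qrot_r (i) : (r i : DihedralGroup (2 ^ (b + (k + 1)))) ∈ Qrot b k ↔
    ZMod.castHom (dvd1 b (k + 1)) (ZMod (2 ^ b)) i = 0 := by
  rw [Qrot, MonoidHom.mem_ker, one_def]
  simp only [dihMap, MonoidHom.coe_mk, OneHom.coe_mk, r.injEq]

theorem mem_Qrot_sr (i) : ¬ (sr i : DihedralGroup (2 ^ (b + (k + 1)))) ∈ Qrot b k := by
  rw [Qrot, MonoidHom.mem_ker, one_def]
  simp only [dihMap, MonoidHom.coe_mk, OneHom.coe_mk, reduceCtorEq, not_false_iff]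

theorem Qrot_index : (Qrot b k).index = 2 ^ (b + 1) := by
  rw [Qrot, ← MonoidHom.comap_bot, Subgroup.index_comap_of_surjective _ (dihMap_surj _),
    Subgroup.index_bot, DihedralGroup.nat_card]
  ring

/-- dihedral subgroup -/
def Qdih (b k : ℕ) (i0 : ℤ) : Subgroup (DihedralGroup (2 ^ (b + (k + 1)))) :=
  (Subgroup.zpowers (sr (i0 : ZMod (2 ^ (b + 1))))).comap (dihMap (dvd2 b k))

theorem mem_zp {n : ℕ} (c : ZMod n) (x : DihedralGroup n) :
    x ∈ Subgroup.zpowers (sr c) ↔ x = 1 ∨ x = sr c := by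
  constructor
  · rintro ⟨z, rfl⟩
    rcases Int.even_or_odd z with ⟨t, rfl⟩ | ⟨t, rfl⟩
    · left
      simp only [zpow_add, ← Commute.mul_zpow (Commute.refl (sr c)), sr_mul_self, one_zpow]
    · right
      simp only
      rw [zpow_add, two_mul, zpow_add, ← Commute.mul_zpow (Commute.refl (sr c)), sr_mul_self, one_zpow]
      simp
  · rintro (rfl | rfl)
    · exact one_mem _
    · exact Subgroup.mem_zpowers _

theorem mem_Qdih_r (i0 : ℤ) (i) : (r i : DihedralGroup (2 ^ (b + (k + 1)))) ∈ Qdih b k i0 ↔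
    ZMod.castHom (dvd2 b k) (ZMod (2 ^ (b + 1))) i = 0 := by
  rw [Qdih, Subgroup.mem_comap, mem_zp, one_def]
  simp only [dihMap, MonoidHom.coe_mk, OneHom.coe_mk, r.injEq, reduceCtorEq, or_false]

theorem mem_Qdih_sr (i0 : ℤ) (i) : (sr i : DihedralGroup (2 ^ (b + (k + 1)))) ∈ Qdih b k i0 ↔
    ZMod.castHom (dvd2 b k) (ZMod (2 ^ (b + 1))) (i - i0) = 0 := by
  rw [Qdih, Subgroup.mem_comap, mem_zp, one_def, map_sub, sub_eq_zero, map_intCast]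
  simp only [dihMap, MonoidHom.coe_mk, OneHom.coe_mk, sr.injEq, reduceCtorEq, false_or]

theorem Qdih_index (i0 : ℤ) : (Qdih b k i0).index = 2 ^ (b + 1) := by
  rw [Qdih, Subgroup.index_comap_of_surjective _ (dihMap_surj _)]
  have h1 := (Subgroup.zpowers (sr (i0 : ZMod (2 ^ (b + 1))))).card_mul_index
  rw [DihedralGroup.nat_card, Nat.card_zpowers, orderOf_sr] at h1
  omega

theorem card_of_index {Q : Subgroup (DihedralGroup (2 ^ (b + (k + 1))))}
    (h : Q.index = 2 ^ (b + 1)) : (Nat.card Q : ℂ)⁻¹ * 2 ^ (b + (k + 1)) = 2 ^ b := by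
  have h1 := Q.card_mul_index
  rw [DihedralGroup.nat_card, h] at h1
  have h0 : (Nat.card Q : ℂ) ≠ 0 := by exact_mod_cast Nat.card_pos.ne'
  have h2 : (Nat.card Q : ℂ) * 2 ^ (b + 1) = 2 * 2 ^ (b + (k + 1)) := by exact_mod_cast h1
  rw [inv_mul_eq_iff_eq_mul₀ h0]
  have : (2 : ℂ) ≠ 0 := two_ne_zero
  apply mul_left_cancel₀ this
  rw [← h2]; ring

/-- the character `r i ↦ ψ (c i)`. -/
noncomputable def rotF (b k : ℕ) (c : ZMod (2 ^ (b + (k + 1)))) :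
    DihedralGroup (2 ^ (b + (k + 1))) → ℂ
  | r i => ZMod.stdAddChar (c * i)
  | sr _ => 0

theorem I_mem (c : ZMod (2 ^ (b + (k + 1)))) :
    inducedChar (Qrot b k) (fun q => rotF b k c q) ∈
      GenSet (P := DihedralGroup (2 ^ (b + (k + 1)))) (2 ^ (b + 1)) := by
  refine ⟨Qrot b k, _, ?_, Qrot_index.symm, rfl⟩
  let f : Qrot b k →* ℂ :=
    { toFun := fun q => rotF b k c q
      map_one' := by
        simp only [OneMemClass.coe_one, one_def, rotF]; simp
      map_mul' := by
        rintro ⟨x | x, hx⟩ ⟨y | y, hy⟩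
        · simp only [MulMemClass.mk_mul_mk, r_mul_r, rotF, mul_add]
          rw [AddChar.map_add_eq_mul]
        · exact absurd hy (mem_Qrot_sr _)
        · exact absurd hx (mem_Qrot_sr _)
        · exact absurd hy (mem_Qrot_sr _) }
  exact irr_of_hom f

theorem I_r (c i : ZMod (2 ^ (b + (k + 1)))) :
    inducedChar (Qrot b k) (fun q => rotF b k c q) (r i) =
      if ZMod.castHom (dvd1 b (k + 1)) (ZMod (2 ^ b)) i = 0 then
        2 ^ b * (ZMod.stdAddChar (c * i) + ZMod.stdAddChar (-(c * i)) : ℂ) else 0 := by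
  rw [ind_restrict, sum_dihedral]
  have h1 : ∀ j : ZMod (2 ^ (b + (k + 1))), r j * r i * (r j)⁻¹ = r i := by
    intro j; simp
  have h2 : ∀ j : ZMod (2 ^ (b + (k + 1))), sr j * r i * (sr j)⁻¹ = r (-i) := by
    intro j; simp
  simp only [h1, h2, mem_Qrot_r, map_neg, neg_eq_zero, Finset.sum_const, Finset.card_univ, ZMod.card, rotF]
  split_ifs
  · rw [← card_of_index (Qrot_index (b := b) (k := k))]
    simp only [nsmul_eq_mul]; push_cast; rw [mul_neg]; ring
  · simp

theorem I_sr (c i : ZMod (2 ^ (b + (k + 1)))) :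
    inducedChar (Qrot b k) (fun q => rotF b k c q) (sr i) = 0 := by
  rw [ind_restrict, sum_dihedral]
  have h1 : ∀ j : ZMod (2 ^ (b + (k + 1))), r j * sr i * (r j)⁻¹ = sr (i - j - j) := by
    intro j; simp; ring
  have h2 : ∀ j : ZMod (2 ^ (b + (k + 1))), sr j * sr i * (sr j)⁻¹ = sr (j - (i - j)) := by
    intro j; simp
  simp only [h1, h2, mem_Qrot_sr]
  simp

noncomputable def dihF (n : ℕ) (δ : ℤˣ) : DihedralGroup n →* ℂ where
  toFun x := match x with
    | r _ => 1
    | sr _ => ((δ : ℤ) : ℂ)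
  map_one' := by rw [one_def]
  map_mul' x y := by
    have : (((δ : ℤ) : ℂ)) * ((δ : ℤ) : ℂ) = 1 := by
      norm_cast
      simp
    rcases x with i | i <;> rcases y with j | j <;> simp [this]

theorem J_mem (i0 : ℤ) (δ : ℤˣ) :
    inducedChar (Qdih b k i0) (fun q => dihF (2 ^ (b + (k + 1))) δ (q : DihedralGroup _)) ∈
      GenSet (P := DihedralGroup (2 ^ (b + (k + 1)))) (2 ^ (b + 1)) :=
  ⟨Qdih b k i0, _, irr_of_hom ((dihF _ δ).comp (Qdih b k i0).subtype), (Qdih_index _).symm, rfl⟩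

theorem J_r (i0 : ℤ) (δ : ℤˣ) (i : ZMod (2 ^ (b + (k + 1)))) :
    inducedChar (Qdih b k i0) (fun q => dihF (2 ^ (b + (k + 1))) δ (q : DihedralGroup _)) (r i) =
      if ZMod.castHom (dvd2 b k) (ZMod (2 ^ (b + 1))) i = 0 then 2 ^ (b + 1) else 0 := by
  rw [ind_restrict, sum_dihedral]
  have h1 : ∀ j : ZMod (2 ^ (b + (k + 1))), r j * r i * (r j)⁻¹ = r i := by
    intro j; simp
  have h2 : ∀ j : ZMod (2 ^ (b + (k + 1))), sr j * r i * (sr j)⁻¹ = r (-i) := by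
    intro j; simp
  simp only [h1, h2, mem_Qdih_r, map_neg, neg_eq_zero, Finset.sum_const, Finset.card_univ, ZMod.card]
  split_ifs
  · rw [pow_succ, ← card_of_index (Qdih_index (b := b) (k := k) i0)]
    simp only [nsmul_eq_mul, dihF, MonoidHom.coe_mk, OneHom.coe_mk]; push_cast; ring
  · simp

theorem cast_two_mul (j : ZMod (2 ^ (b + (k + 1)))) :
    ZMod.castHom (dvd2 b k) (ZMod (2 ^ (b + 1))) (2 * j) = 0 ↔
    ZMod.castHom (dvd1 b (k + 1)) (ZMod (2 ^ b)) j = 0 := by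
  obtain ⟨v, rfl⟩ : ∃ v : ℕ, (v : ZMod (2 ^ (b + (k + 1)))) = j := ⟨j.val, by simp⟩
  have h2 : (2 * (v : ZMod (2 ^ (b + (k + 1))))) = ((2 * v : ℕ) : ZMod (2 ^ (b + (k + 1)))) := by
    push_cast; rfl
  rw [h2, map_natCast, map_natCast, ZMod.natCast_eq_zero_iff,
    ZMod.natCast_eq_zero_iff, pow_succ', Nat.mul_dvd_mul_iff_left (by norm_num)]

theorem even_iff (t : ZMod (2 ^ (b + (k + 1)))) :
    ZMod.castHom (dvd3 b k) (ZMod 2) t = 0 ↔ ∃ j, t = 2 * j := by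
  constructor
  · intro h
    obtain ⟨v, rfl⟩ : ∃ v : ℕ, (v : ZMod (2 ^ (b + (k + 1)))) = t := ⟨t.val, by simp⟩
    rw [map_natCast, ZMod.natCast_eq_zero_iff] at h
    obtain ⟨w, rfl⟩ := h
    exact ⟨w, by push_cast; rfl⟩
  · rintro ⟨j, rfl⟩
    rw [map_mul]
    have : ZMod.castHom (dvd3 b k) (ZMod 2) 2 = 0 := by
      rw [map_ofNat]; rfl
    rw [this, zero_mul]

theorem cnt (t : ZMod (2 ^ (b + (k + 1)))) :
    ((Finset.univ.filter (fun j => ZMod.castHom (dvd2 b k) (ZMod (2 ^ (b + 1))) (t - 2 * j) = 0)).card : ℂ)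
      * 2 ^ b = if ZMod.castHom (dvd3 b k) (ZMod 2) t = 0 then 2 ^ (b + (k + 1)) else 0 := by
  split_ifs with h
  · obtain ⟨j0, rfl⟩ := (even_iff t).mp h
    have h1 := card_ker_cast (dvd1 b (k + 1))
    have h2 : (Finset.univ.filter (fun j => ZMod.castHom (dvd2 b k) (ZMod (2 ^ (b + 1)))
        (2 * j0 - 2 * j) = 0)).card = (Finset.univ.filter
        (fun i => ZMod.castHom (dvd1 b (k + 1)) (ZMod (2 ^ b)) i = 0)).card := by
      apply Finset.card_bij' (fun i _ => j0 - i) (fun i _ => j0 - i)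
      · intro i hi; simp only [Finset.mem_filter, Finset.mem_univ, true_and] at hi ⊢
        rw [← mul_sub, cast_two_mul] at hi; exact hi
      · intro i hi; simp only [Finset.mem_filter, Finset.mem_univ, true_and] at hi ⊢
        rw [← mul_sub, cast_two_mul]; simpa using hi
      · intro i _; ring
      · intro i _; ring
    rw [h2]
    exact_mod_cast h1
  · rw [Finset.filter_false_of_mem, Finset.card_empty]
    · simp
    · intro j _ hj
      apply h
      have h3 : ZMod.castHom (dvd_pow_self 2 (Nat.succ_ne_zero b)) (ZMod 2)
        (ZMod.castHom (dvd2 b k) (ZMod (2 ^ (b + 1))) (t - 2 * j)) = 0 := by rw [hj, map_zero]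
      rw [← RingHom.comp_apply, ZMod.castHom_comp, map_sub] at h3
      have h4 := (even_iff (2 * j)).mpr ⟨j, rfl⟩
      rw [h4, sub_zero] at h3
      exact h3

theorem J_sr (i0 : ℤ) (δ : ℤˣ) (i : ZMod (2 ^ (b + (k + 1)))) :
    inducedChar (Qdih b k i0) (fun q => dihF (2 ^ (b + (k + 1))) δ (q : DihedralGroup _)) (sr i) =
      if ZMod.castHom (dvd3 b k) (ZMod 2) (i - i0) = 0 then 2 * ((δ : ℤ) : ℂ) else 0 := by
  rw [ind_restrict, sum_dihedral]
  have h1 : ∀ j : ZMod (2 ^ (b + (k + 1))), r j * sr i * (r j)⁻¹ = sr (i - 2 * j) := by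
    intro j; simp; ring
  have h2 : ∀ j : ZMod (2 ^ (b + (k + 1))), sr j * sr i * (sr j)⁻¹ = sr (2 * j - i) := by
    intro j; simp; ring
  simp only [h1, h2, mem_Qdih_sr]
  rw [← Equiv.sum_comp (Equiv.neg (ZMod (2 ^ (b + (k + 1)))))
    (fun j => if ZMod.castHom (dvd2 b k) (ZMod (2 ^ (b + 1))) (2 * j - i - i0) = 0
      then (dihF _ δ) (sr (2 * j - i)) else 0)]
  simp only [Equiv.neg_apply]
  have e1 : ∀ j : ZMod (2 ^ (b + (k + 1))), i - 2 * j - i0 = (i - i0) - 2 * j := fun j => by ring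
  have e2 : ∀ j : ZMod (2 ^ (b + (k + 1))), 2 * -j - i - i0 = (-i - i0) - 2 * j := fun j => by ring
  have hpar : ZMod.castHom (dvd3 b k) (ZMod 2) (-i - i0) = ZMod.castHom (dvd3 b k) (ZMod 2) (i - i0) := by
    rw [map_sub, map_sub, map_neg]
    generalize (ZMod.castHom (dvd3 b k) (ZMod 2)) i = a
    congr 1
    revert a; decide
  simp only [e1, e2, dihF, MonoidHom.coe_mk, OneHom.coe_mk, ← Finset.sum_filter, Finset.sum_const, nsmul_eq_mul]
  have c1 := cnt (i - (i0 : ZMod (2 ^ (b + (k + 1)))))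
  have c2 := cnt (-i - (i0 : ZMod (2 ^ (b + (k + 1)))))
  rw [hpar] at c2
  have h2b : (2 : ℂ) ^ b ≠ 0 := pow_ne_zero _ two_ne_zero
  have hcard := card_of_index (Qdih_index (b := b) (k := k) i0)
  apply mul_right_cancel₀ h2b
  rw [mul_assoc, add_mul, mul_right_comm, c1, mul_right_comm, c2]
  split_ifs
  · rw [← hcard]; ring
  · simp
end gens

end PartF

section PartH

theorem nats_aux (u v : ℕ) (A B : ℤ) (h1 : |A| ≤ u) (h2 : |A| ≤ v) (h3 : |B| ≤ u) (h4 : |B| ≤ v)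
    (h5 : (2 : ℤ) ∣ A - u) (h6 : (2 : ℤ) ∣ B - u) (h7 : (2 : ℤ) ∣ u - v) :
    ∃ U V a b c d : ℕ, u = 2 * U + (a + b + c + d) ∧ v = 2 * V + (a + b + c + d) ∧
      A + B = 2 * ((a : ℤ) - b) ∧ A - B = 2 * ((c : ℤ) - d) := by
  rw [abs_le] at h1 h2 h3 h4
  obtain ⟨p, hp⟩ : ∃ p, A + B = 2 * p := ⟨(A + B) / 2, by omega⟩
  obtain ⟨q, hq⟩ : ∃ q, A - B = 2 * q := ⟨(A - B) / 2, by omega⟩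
  have hmin : min u v = u ∨ min u v = v := by omega
  refine ⟨(u - min u v) / 2, (v - min u v) / 2, p.toNat + (min u v - p.natAbs - q.natAbs) / 2,
    (-p).toNat + (min u v - p.natAbs - q.natAbs) / 2, q.toNat, (-q).toNat, ?_, ?_, ?_, ?_⟩ <;> omega

theorem sum_range_block {R : Type*} [AddCommMonoid R] (f : ℤ → R) (N q : ℕ) :
    ∑ j ∈ Finset.range (N * q), f j = ∑ i ∈ Finset.range q, ∑ c ∈ Finset.range N, f (c + N * i) := by
  induction q with
  | zero => simp
  | succ q ih =>
    rw [Nat.mul_succ, Finset.sum_range_add, ih, Finset.sum_range_succ]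
    congr 1
    apply Finset.sum_congr rfl
    intro c _
    congr 1
    push_cast; ring

theorem sum_range_pair {R : Type*} [AddCommMonoid R] (f : ℤ → R) (e : ℕ) (he : 0 < e)
    (hf : ∀ i, f (i + (2 * e : ℕ)) = f i) :
    ∑ j ∈ Finset.range (2 * e), f j = f 0 + f e +
      ∑ c ∈ Finset.range (e - 1), (f ((c : ℤ) + 1) + f (-((c : ℤ) + 1))) := by
  obtain ⟨n, rfl⟩ : ∃ n, e = n + 1 := ⟨e - 1, by omega⟩
  rw [two_mul, Finset.sum_range_add, Finset.sum_range_succ', Finset.sum_range_succ',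
    ← Finset.sum_range_reflect (fun k => f ((n + 1 + (k + 1) : ℕ) : ℤ)), Finset.sum_add_distrib]
  have : ∀ j ∈ Finset.range n, f ((n + 1 + ((n - 1 - j) + 1) : ℕ) : ℤ) = f (-((j : ℤ) + 1)) := by
    intro j hj
    rw [← hf (-((j : ℤ) + 1))]
    congr 1
    have := Finset.mem_range.mp hj
    push_cast
    omega
  rw [Finset.sum_congr rfl this]
  simp only [Nat.add_sub_cancel, Nat.cast_zero, add_zero]
  push_cast
  abel

section asm
open DihedralGroup
variable {b k : ℕ}

theorem psi_zpow {m : ℕ} [NeZero m] (i j : ℤ) :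
    (ZMod.stdAddChar ((i : ZMod m) * (j : ZMod m)) : ℂ) = (ZMod.stdAddChar (1 : ZMod m) : ℂ) ^ (i * j) := by
  rw [← AddChar.map_zsmul_eq_zpow]
  congr 1
  simp

theorem psi_prim {m : ℕ} [NeZero m] : IsPrimitiveRoot (ZMod.stdAddChar (1 : ZMod m) : ℂ) m := by
  have := ZMod.isPrimitive_stdAddChar m
  have h1 := ZMod.stdAddChar_coe (N := m) 1
  have := Complex.isPrimitiveRoot_exp m (NeZero.ne m)
  rw [Int.cast_one] at h1
  rw [h1]
  convert this using 2
  simp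

set_option maxHeartbeats 1000000 in
theorem assembly (X : DihedralGroup (2 ^ (b + (k + 1))) → ℂ) (ω : ℂ)
    (hω : IsPrimitiveRoot ω (2 ^ (b + (k + 1))))  (y : ℤ → ℕ)
    (hy : ∀ j, y (j + (2 ^ (k + 1) : ℕ)) = y j) (hneg : ∀ j, y (-j) = y j)
    (hω1 : ω = ZMod.stdAddChar (1 : ZMod (2 ^ (b + (k + 1)))))
    (hX : ∀ i : ℤ, X (r i) = ∑ j ∈ Finset.range (2 ^ (b + (k + 1))), ω ^ (i * j) * y j)
    (A B : ℤ) (hs : ∀ i : ℤ, X (sr (i : ZMod _)) = ((if 2 ∣ i then A + B else A - B : ℤ) : ℂ))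
    (h1 : |A| ≤ y 0) (h2 : |A| ≤ y (2 ^ k : ℕ)) (h3 : |B| ≤ y 0) (h4 : |B| ≤ y (2 ^ k : ℕ))
    (h5 : (2 : ℤ) ∣ A - y 0) (h6 : (2 : ℤ) ∣ B - y 0) (h7 : (2 : ℤ) ∣ y 0 - y (2 ^ k : ℕ)) :
    X ∈ AddSubmonoid.closure (GenSet (P := DihedralGroup (2 ^ (b + (k + 1)))) (2 ^ (b + 1))) := by
  obtain ⟨U, W, a0, a1, c0, c1, hu, hv, hAB, hAB'⟩ := nats_aux _ _ _ _ h1 h2 h3 h4 h5 h6 h7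
  have hω0 : ω ≠ 0 := hω.ne_zero (by positivity)
  obtain ⟨I, hId⟩ : ∃ I : ℤ → DihedralGroup (2 ^ (b + (k + 1))) → ℂ, I = (fun c : ℤ => inducedChar (Qrot b k) (fun q : Qrot b k => rotF b k (c : ZMod (2 ^ (b + (k + 1)))) (q : DihedralGroup (2 ^ (b + (k + 1)))))) := ⟨_, rfl⟩
  obtain ⟨J, hJd⟩ : ∃ J : ℤ → ℤˣ → DihedralGroup (2 ^ (b + (k + 1))) → ℂ, J = fun i0 δ =>
    inducedChar (Qdih b k i0) (fun q => dihF (2 ^ (b + (k + 1))) δ (q : DihedralGroup _)) := ⟨_, rfl⟩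
  have key : X = ∑ c ∈ Finset.range (2 ^ k - 1), y ((c : ℤ) + 1) • I ((c : ℤ) + 1) + U • I 0 + W • I (2 ^ k : ℕ)
      + a0 • J 0 1 + a1 • J 0 (-1) + c0 • J 1 1 + c1 • J 1 (-1) := by
    funext x
    simp only [Pi.add_apply, Finset.sum_apply, Pi.smul_apply]
    rcases x with i | i
    · obtain ⟨i, rfl⟩ := ZMod.intCast_surjective i
      have hI : ∀ c : ℤ, I c (r (i : ZMod _)) = if ((2 ^ b : ℕ) : ℤ) ∣ i then
          2 ^ b * (ω ^ (c * i) + ω ^ (-(c * i))) else 0 := by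
        intro c
        simp only [hId]
        rw [I_r, map_intCast, hω1, ← psi_zpow, ← neg_mul, ← neg_mul, ← Int.cast_neg, psi_zpow (-c)]
        simp only [ZMod.intCast_zmod_eq_zero_iff_dvd]
      have hmid : ((2 ^ b : ℕ) : ℤ) ∣ i → (ω ^ (-(((2 ^ k : ℕ) : ℤ) * i)) = ω ^ (((2 ^ k : ℕ) : ℤ) * i)) ∧
          ω ^ (((2 ^ k : ℕ) : ℤ) * i) = if ((2 ^ (b + 1) : ℕ) : ℤ) ∣ i then 1 else -1 := by
        rintro ⟨t, rfl⟩
        have hs1 : (ω ^ (((2 ^ k : ℕ) : ℤ) * (((2 ^ b : ℕ) : ℤ) * t))) =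
          (ω ^ (2 ^ (b + k) : ℕ)) ^ t := by
          rw [← mul_assoc, zpow_mul, ← zpow_natCast]
          congr 2
          push_cast; ring
        have hs2 : ω ^ (2 ^ (b + k) : ℕ) = -1 := by
          have := (IsPrimitiveRoot.pow (b := 2) (a := 2 ^ (b + k)) (by positivity) hω (by ring))
          exact this.eq_neg_one_of_two_right
        rw [zpow_neg, hs1, hs2, pow_succ, Nat.cast_mul]
        simp only [mul_dvd_mul_iff_left (show ((2 ^ b : ℕ) : ℤ) ≠ 0 by positivity)]
        rcases Int.even_or_odd t with ht | ht
        · rw [ht.neg_one_zpow, if_pos (by exact_mod_cast ht.two_dvd)]; simp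
        · rw [ht.neg_one_zpow, if_neg (by
            rw [← even_iff_two_dvd.trans (by norm_num : (2 : ℤ) ∣ t ↔ ((2 : ℕ) : ℤ) ∣ t), Int.not_even_iff_odd]; exact ht)]; norm_num
      have hJ : ∀ i0 δ, J i0 δ (r (i : ZMod _)) = if ((2 ^ b : ℕ) : ℤ) ∣ i then
          2 ^ b * (1 + ω ^ (((2 ^ k : ℕ) : ℤ) * i)) else 0 := by
        intro i0 δ
        simp only [hJd]
        rw [J_r, map_intCast]
        simp only [ZMod.intCast_zmod_eq_zero_iff_dvd]
        by_cases hb : ((2 ^ b : ℕ) : ℤ) ∣ i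
        · rw [if_pos hb, (hmid hb).2]
          split_ifs
          · ring
          · ring
        · rw [if_neg hb, if_neg]
          intro h; apply hb
          refine dvd_trans ?_ h
          exact_mod_cast pow_dvd_pow 2 (Nat.le_succ b)
      simp only [hI, hJ]
      have hper : ∀ j : ℤ, (y (j + (2 ^ (k + 1) : ℕ)) : ℂ) = y j := fun j => by rw [hy]
      have hXr : X (r (i : ZMod _)) = if ((2 ^ b : ℕ) : ℤ) ∣ i then 2 ^ b *
          ∑ c ∈ Finset.range (2 ^ (k + 1)), ω ^ (i * (c : ℤ)) * y c else 0 := by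
        rw [hX]
        have hb : 2 ^ (b + (k + 1)) = 2 ^ (k + 1) * 2 ^ b := by ring
        have := sum_range_block (fun j : ℤ => ω ^ (i * j) * (y j : ℂ)) (2 ^ (k + 1)) (2 ^ b)
        rw [hb, this, Finset.sum_comm]
        have hprim : IsPrimitiveRoot (ω ^ (2 ^ (k + 1))) (2 ^ b) :=
          IsPrimitiveRoot.pow (by positivity) hω hb
        have hg := geom_root hprim (by positivity) i
        have : ∀ c ∈ Finset.range (2 ^ (k + 1)), ∑ t ∈ Finset.range (2 ^ b),
            ω ^ (i * ((c : ℤ) + (2 ^ (k + 1) : ℕ) * (t : ℤ))) * (y ((c : ℤ) + (2 ^ (k + 1) : ℕ) * t) : ℂ) =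
            ω ^ (i * (c : ℤ)) * y c * (if ((2 ^ b : ℕ) : ℤ) ∣ i then ((2 ^ b : ℕ) : ℂ) else 0) := by
          intro c _
          rw [← hg, Finset.mul_sum]
          apply Finset.sum_congr rfl
          intro t _
          rw [periodic_congr (fun j => y j) hy (a := (c : ℤ) + (2 ^ (k + 1) : ℕ) * t) (b := c) (by simp),
            mul_add, zpow_add₀ hω0, ← zpow_natCast ω, ← zpow_mul]
          have : i * (((2 ^ (k + 1) : ℕ) : ℤ) * (t : ℤ)) = ((2 ^ (k + 1) : ℕ) : ℤ) * (t * i) := by ring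
          rw [this]
          ring
        rw [Finset.sum_congr rfl this, ← Finset.sum_mul]
        split_ifs
        · push_cast; ring
        · simp
      rw [hXr]
      by_cases hb : ((2 ^ b : ℕ) : ℤ) ∣ i
      · simp only [if_pos hb]
        have h22 : 2 ^ (k + 1) = 2 * 2 ^ k := by ring
        rw [h22, sum_range_pair (fun j : ℤ => ω ^ (i * j) * (y j : ℂ)) (2 ^ k) (by positivity), (hmid hb).1, hu, hv]
        · simp only [hneg]
          have : ∀ c ∈ Finset.range (2 ^ k - 1), y ((c : ℤ) + 1) • (2 ^ b * (ω ^ (((c : ℤ) + 1) * i) +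
             ω ^ (-(((c : ℤ) + 1) * i)))) = 2 ^ b * (ω ^ (i * ((c : ℤ) + 1)) * (y ((c : ℤ) + 1) : ℂ) +
               ω ^ (i * -((c : ℤ) + 1)) * (y ((c : ℤ) + 1) : ℂ)) := by
            intro c _
            rw [nsmul_eq_mul, mul_comm i, mul_comm i, neg_mul]; ring
          rw [Finset.sum_congr rfl this, ← Finset.mul_sum]
          simp only [nsmul_eq_mul, mul_zero, zero_mul, neg_zero, zpow_zero]
          rw [mul_comm i]
          push_cast
          ring
        · intro j
          rw [← h22, hy, mul_add, zpow_add₀ hω0]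
          obtain ⟨t, rfl⟩ := hb
          have : ω ^ ((2 ^ b : ℕ) * t * ((2 ^ (k + 1) : ℕ) : ℤ)) = 1 := by
            rw [hω.zpow_eq_one_iff_dvd]
            exact ⟨t, by push_cast; ring⟩
          rw [this, mul_one]
      · simp only [if_neg hb, smul_zero, Finset.sum_const_zero, add_zero]
    · obtain ⟨i, rfl⟩ := ZMod.intCast_surjective i
      have hI : ∀ c : ℤ, I c (sr (i : ZMod _)) = 0 := fun c => by rw [hId]; exact I_sr _ _
      have hJ : ∀ i0 δ, J i0 δ (sr (i : ZMod _)) = if 2 ∣ i - i0 then 2 * ((δ : ℤ) : ℂ) else 0 := by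
        intro i0 δ
        simp only [hJd]
        rw [J_sr, ← Int.cast_sub, map_intCast]
        simp only [ZMod.intCast_zmod_eq_zero_iff_dvd, Nat.cast_ofNat]
      simp only [hI, hJ, hs]
      by_cases h : 2 ∣ i
      · rw [if_pos h, if_pos (by simpa using h), if_pos (by simpa using h), if_neg (by omega), if_neg (by omega)]
        have : (A : ℂ) + B = 2 * ((a0 : ℂ) - a1) := by exact_mod_cast hAB
        push_cast
        rw [this]
        simp; ring
      · rw [if_neg h, if_neg (by simpa using h), if_neg (by simpa using h), if_pos (by omega), if_pos (by omega)]
        have : (A : ℂ) - B = 2 * ((c0 : ℂ) - c1) := by exact_mod_cast hAB'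
        push_cast
        rw [this]
        simp; ring
  rw [key]
  have hI : ∀ c, I c ∈ AddSubmonoid.closure (GenSet (P := DihedralGroup (2 ^ (b + (k + 1)))) (2 ^ (b + 1))) :=
    fun c => by rw [hId]; exact AddSubmonoid.subset_closure (I_mem _)
  have hJ : ∀ c d, J c d ∈ AddSubmonoid.closure (GenSet (P := DihedralGroup (2 ^ (b + (k + 1)))) (2 ^ (b + 1))) :=
    fun c d => by rw [hJd]; exact AddSubmonoid.subset_closure (J_mem _ _)
  refine add_mem (add_mem (add_mem (add_mem (add_mem (add_mem (sum_mem ?_) ?_) ?_) ?_) ?_) ?_) ?_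
  · intro c _; exact nsmul_mem (hI _) _
  all_goals first | exact nsmul_mem (hI _) _ | exact nsmul_mem (hJ _ _) _
end asm

end PartH

section PartL1

theorem exists_val2 : ∃ O : ValuationSubring ℂ, O.valuation (2 : ℂ) < 1 ∧ ∀ n : ℤ, (n : ℂ) ∈ O := by
  let A : Subring ℂ := (Int.castRingHom ℂ).range
  let I : Ideal A := Ideal.span {(2 : A)}
  have hI : I ≠ ⊤ := by
    intro h
    rw [Ideal.span_singleton_eq_top] at h
    obtain ⟨⟨y, n, hn⟩, hy⟩ := h.exists_right_inv
    have h2 : (2 : ℂ) * y = 1 := by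
      have := congrArg Subtype.val hy
      exact this
    rw [← hn] at h2
    have : (2 : ℤ) * n = 1 := by
      have h3 : ((2 * n : ℤ) : ℂ) = 1 := by push_cast; simpa using h2
      exact_mod_cast h3
    omega
  obtain ⟨B, hB1, hB2⟩ := Ideal.image_subset_nonunits_valuationSubring I hI
  refine ⟨B, ?_, ?_⟩
  · have := hB2 ⟨2, Ideal.subset_span rfl, rfl⟩
    rw [SetLike.mem_coe, ValuationSubring.mem_nonunits_iff] at this
    exact this
  · intro n
    exact hB1 ⟨n, rfl⟩

theorem odd_unit {O : ValuationSubring ℂ} (h2 : O.valuation (2 : ℂ) < 1) (hz : ∀ n : ℤ, (n : ℂ) ∈ O)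
    (n : ℤ) (hn : ¬ (2 : ℤ) ∣ n) : ((n : ℂ))⁻¹ ∈ O := by
  obtain ⟨t, rfl⟩ : ∃ t, n = 2 * t + 1 := ⟨n / 2, by omega⟩
  rw [← O.valuation_le_one_iff, map_inv₀]
  have h1 : O.valuation (2 * (t : ℂ)) < 1 := by
    rw [map_mul]
    exact mul_lt_one_of_lt_of_le h2 ((O.valuation_le_one_iff _).mpr (hz t))
  have h3 : O.valuation (((2 * t + 1 : ℤ) : ℂ)) = 1 := by
    push_cast
    rw [Valuation.map_add_eq_of_lt_right]
    · exact map_one O.valuation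
    · rw [map_one]; exact h1
  rw [h3]; simp

theorem val_normalize {O : ValuationSubring ℂ} {ι : Type*} [Fintype ι] (a : ι → ℂ) (ha : a ≠ 0) :
    ∃ c : ℂ, c ≠ 0 ∧ (∀ i, c * a i ∈ O) ∧ ∃ i, c * a i = 1 := by
  obtain ⟨j, hj⟩ := Function.ne_iff.mp ha
  obtain ⟨i, _, hi⟩ := Finset.exists_max_image Finset.univ (fun i => O.valuation (a i)) ⟨j, Finset.mem_univ _⟩
  have hi0 : a i ≠ 0 := by
    intro h
    have := hi j (Finset.mem_univ _)
    rw [h, map_zero, le_zero_iff, map_eq_zero] at this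
    exact hj this
  refine ⟨(a i)⁻¹, inv_ne_zero hi0, fun t => ?_, i, inv_mul_cancel₀ hi0⟩
  rw [← O.valuation_le_one_iff, map_mul, map_inv₀]
  apply inv_mul_le_one_of_le₀ (hi t (Finset.mem_univ _)) (zero_le)

def InLat {V : Type} [AddCommGroup V] [Module ℂ V] {ι : Type*} (O : ValuationSubring ℂ)
    (b : Module.Basis ι ℂ V) (v : V) : Prop := ∀ i, b.repr v i ∈ O

section lat
variable {V : Type} [AddCommGroup V] [Module ℂ V] {ι : Type} {O : ValuationSubring ℂ}
    {b : Module.Basis ι ℂ V}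

theorem lat_add {v w : V} (hv : InLat O b v) (hw : InLat O b w) : InLat O b (v + w) := by
  intro i; rw [map_add]; exact O.add_mem _ _ (hv i) (hw i)
theorem lat_neg {v : V} (hv : InLat O b v) : InLat O b (-v) := by
  intro i; rw [map_neg]; exact O.neg_mem _ (hv i)
theorem lat_sub {v w : V} (hv : InLat O b v) (hw : InLat O b w) : InLat O b (v - w) := by
  rw [sub_eq_add_neg]; exact lat_add hv (lat_neg hw)
theorem lat_zero : InLat O b (0 : V) := by
  intro i; rw [map_zero]; exact O.zero_mem
theorem lat_smul {v : V} {a : ℂ} (ha : a ∈ O) (hv : InLat O b v) : InLat O b (a • v) := by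
  intro i; rw [map_smul]; exact O.mul_mem _ _ ha (hv i)
theorem lat_sum {α : Type*} {s : Finset α} {f : α → V} (h : ∀ i ∈ s, InLat O b (f i)) :
    InLat O b (∑ i ∈ s, f i) := by
  induction s using Finset.induction_on with
  | empty => exact lat_zero
  | insert a s ha ih =>
    rw [Finset.sum_insert ha]
    exact lat_add (h _ (Finset.mem_insert_self _ _)) (ih fun i hi => h _ (Finset.mem_insert_of_mem hi))

theorem exists_lat {G : Type} [Group G] [Fintype G] [FiniteDimensional ℂ V] (O : ValuationSubring ℂ)
    (ρ : Representation ℂ G V) : ∃ b : Module.Basis (Fin (Module.finrank ℂ V)) ℂ V,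
      ∀ g v, InLat O b v → InLat O b (ρ g v) := by
  let b0 := Module.finBasis ℂ V
  let f : G × Fin (Module.finrank ℂ V) → V := fun x => ρ x.1 (b0 x.2)
  obtain ⟨t, _, ht⟩ := Finset.exists_max_image Finset.univ
    (fun t : Fin (Module.finrank ℂ V) → G × Fin (Module.finrank ℂ V) => O.valuation (b0.det (f ∘ t)))
    ⟨fun i => (1, i), Finset.mem_univ _⟩
  have hdet : b0.det (f ∘ t) ≠ 0 := by
    intro h
    have := ht (fun i => (1, i)) (Finset.mem_univ _)
    have h1 : f ∘ (fun i => ((1 : G), i)) = b0 := by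
      funext i; simp [f]
    rw [h, map_zero, le_zero_iff, map_eq_zero, h1, Module.Basis.det_self] at this
    exact one_ne_zero this
  obtain ⟨hli, hsp⟩ := (Module.Basis.is_basis_iff_det b0).mpr (Ne.isUnit hdet)
  let b := Module.Basis.mk hli hsp.ge
  have hf : ∀ x, InLat O b (f x) := by
    intro x i
    have h1 := Module.Basis.det_smul_mk_coord_eq_det_update b0 hli hsp.ge i
    have h2 := congrArg (fun l => l (f x)) h1
    simp only [LinearMap.smul_apply, smul_eq_mul, Module.Basis.coord_apply, MultilinearMap.toLinearMap_apply] at h2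
    have h3 : Function.update (f ∘ t) i (f x) = f ∘ (Function.update t i x) := by
      rw [Function.comp_update]
    rw [← O.valuation_le_one_iff]
    have h4 := ht (Function.update t i x) (Finset.mem_univ _)
    rw [← h3] at h4
    have h5 : b0.det (Function.update (f ∘ t) i (f x)) = b0.det (f ∘ t) * b.repr (f x) i := h2.symm
    rw [h5, map_mul] at h4
    have h6 : 0 < O.valuation (b0.det (f ∘ t)) := zero_lt_iff.mpr ((map_ne_zero _).mpr hdet)
    exact (mul_le_iff_le_one_right h6).mp h4
  refine ⟨b, fun g v hv => ?_⟩
  rw [← b.sum_repr v, map_sum]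
  apply lat_sum
  intro i _
  rw [map_smul]
  apply lat_smul (hv i)
  have : ρ g (b i) = f (g * (t i).1, (t i).2) := by
    simp [b, f]
  rw [this]
  exact hf _

theorem pure_basis [Fintype ι] [FiniteDimensional ℂ V] (O : ValuationSubring ℂ) (b : Module.Basis ι ℂ V) (n : ℕ) :
    ∀ W : Submodule ℂ V, Module.finrank ℂ W ≤ n → ∃ (D : ℕ) (w : Fin D → V), LinearIndependent ℂ w ∧
      Submodule.span ℂ (Set.range w) = W ∧ (∀ i, InLat O b (w i)) ∧
      ∀ v ∈ W, InLat O b v → ∃ a : Fin D → ℂ, (∀ i, a i ∈ O) ∧ v = ∑ i, a i • w i := by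
  have hbot : ∃ (D : ℕ) (w : Fin D → V), LinearIndependent ℂ w ∧
      Submodule.span ℂ (Set.range w) = ⊥ ∧ (∀ i, InLat O b (w i)) ∧
      ∀ v ∈ (⊥ : Submodule ℂ V), InLat O b v → ∃ a : Fin D → ℂ, (∀ i, a i ∈ O) ∧ v = ∑ i, a i • w i := by
    refine ⟨0, Fin.elim0, linearIndependent_empty_type, by simp, fun i => i.elim0, ?_⟩
    intro v hv _
    exact ⟨Fin.elim0, fun i => i.elim0, by simpa using hv⟩
  induction n with
  | zero =>
    intro W hW
    have : W = ⊥ := Submodule.finrank_eq_zero.mp (by omega)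
    rw [this]; exact hbot
  | succ n ih =>
    intro W hW
    by_cases hW0 : W = ⊥
    · rw [hW0]; exact hbot
    obtain ⟨u, hu, hu0⟩ := Submodule.exists_mem_ne_zero_of_ne_bot hW0
    obtain ⟨c, hc0, hc1, j, hj⟩ := val_normalize (O := O) (fun i => b.repr u i) (by
      intro h; apply hu0
      apply b.repr.injective
      rw [map_zero]
      ext i
      exact congrFun h i)
    have hw0 : InLat O b (c • u) := by intro i; rw [map_smul]; exact hc1 i
    have hwj : b.repr (c • u) j = 1 := by rw [map_smul]; exact hj
    obtain ⟨w0, hw0e⟩ : ∃ w0, w0 = c • u := ⟨_, rfl⟩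
    rw [← hw0e] at hw0 hwj
    have hw0W : w0 ∈ W := by rw [hw0e]; exact W.smul_mem _ hu
    let W' := W ⊓ LinearMap.ker (b.coord j)
    have hlt : W' < W := by
      refine lt_of_le_of_ne inf_le_left ?_
      intro h
      have : w0 ∈ W' := by rw [h]; exact hw0W
      have := LinearMap.mem_ker.mp this.2
      rw [Module.Basis.coord_apply, hwj] at this
      exact one_ne_zero this
    obtain ⟨D, w, hli, hsp, hwl, hwg⟩ := ih W' (by
      have := Submodule.finrank_lt_finrank_of_lt hlt
      omega)
    refine ⟨D + 1, Fin.cons w0 w, ?_, ?_, ?_, ?_⟩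
    · rw [linearIndependent_finCons]
      refine ⟨hli, ?_⟩
      rw [hsp]
      intro h
      have := LinearMap.mem_ker.mp h.2
      rw [Module.Basis.coord_apply, hwj] at this
      exact one_ne_zero this
    · rw [Fin.range_cons, Submodule.span_insert, hsp]
      apply le_antisymm
      · apply sup_le
        · rw [Submodule.span_singleton_le_iff_mem]; exact hw0W
        · exact inf_le_left
      · intro v hv
        have : v = b.repr v j • w0 + (v - b.repr v j • w0) := by abel
        rw [this]
        apply Submodule.add_mem_sup
        · exact Submodule.smul_mem _ _ (Submodule.mem_span_singleton_self _)
        · refine ⟨W.sub_mem hv (W.smul_mem _ hw0W), ?_⟩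
          rw [SetLike.mem_coe, LinearMap.mem_ker]
          simp [hwj]
    · intro i
      refine Fin.cases ?_ (fun i => ?_) i
      · exact hw0
      · exact hwl i
    · intro v hv hvl
      obtain ⟨a, ha, hav⟩ := hwg (v - b.repr v j • w0) (by
        refine ⟨W.sub_mem hv (W.smul_mem _ hw0W), ?_⟩
        rw [SetLike.mem_coe, LinearMap.mem_ker]
        simp [hwj]) (lat_sub hvl (lat_smul (hvl j) hw0))
      refine ⟨Fin.cons (b.repr v j) a, ?_, ?_⟩
      · intro i
        refine Fin.cases ?_ (fun i => ?_) i
        · exact hvl j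
        · exact ha i
      · rw [Fin.sum_univ_succ]
        simp only [Fin.cons_zero, Fin.cons_succ]
        rw [← hav]; abel

end lat

end PartL1

section PartL2

section lat2
variable {V : Type} [AddCommGroup V] [Module ℂ V] [FiniteDimensional ℂ V] {ι : Type} [Fintype ι]
    {O : ValuationSubring ℂ} {b : Module.Basis ι ℂ V}

theorem li_of_lat {κ : Type} [Fintype κ] (v : κ → V)
    (h : ∀ a : κ → ℂ, (∀ i, a i ∈ O) → ∑ i, a i • v i = 0 → ∀ i, a i ≠ 1) : LinearIndependent ℂ v := by
  rw [Fintype.linearIndependent_iff]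
  intro a ha
  by_contra hne
  push Not at hne
  obtain ⟨i0, hi0⟩ := hne
  obtain ⟨c, hc, hc1, i, hi⟩ := val_normalize (O := O) a (fun h => hi0 (congrFun h i0))
  refine h (fun i => c * a i) hc1 ?_ i hi
  simp only [mul_smul, ← Finset.smul_sum, ha, smul_zero]

theorem card_le_of_li {κ : Type} [Fintype κ] {v : κ → V} (h : LinearIndependent ℂ v) (W : Submodule ℂ V)
    (hW : ∀ i, v i ∈ W) : Fintype.card κ ≤ Module.finrank ℂ W := by
  rw [← finrank_span_eq_card h]
  apply Submodule.finrank_mono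
  rw [Submodule.span_le]
  rintro _ ⟨i, rfl⟩
  exact hW i

theorem li_unique {D : ℕ} {w : Fin D → V} (h : LinearIndependent ℂ w) {a c : Fin D → ℂ}
    (he : ∑ i, a i • w i = ∑ i, c i • w i) (i : Fin D) : a i = c i := by
  have := Fintype.linearIndependent_iff.mp h (fun i => a i - c i) (by
    simp only [sub_smul, Finset.sum_sub_distrib, he, sub_self]) i
  exact sub_eq_zero.mp this

theorem two_ne (h2 : O.valuation (2 : ℂ) < 1) {x : ℂ} (hx : x ∈ O) : (1 : ℂ) ≠ 2 * x := by
  intro h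
  have h1 : O.valuation (2 * x) < 1 := by
    rw [map_mul]
    exact mul_lt_one_of_lt_of_le h2 ((O.valuation_le_one_iff _).mpr hx)
  rw [← h, map_one] at h1
  exact lt_irrefl _ h1

theorem inv_half (h2 : O.valuation (2 : ℂ) < 1) (T : Module.End ℂ V) (hTT : T * T = 1)
    (h : ∀ v, InLat O b v → T v = v → ∃ y, InLat O b y ∧ y + T y = v) :
    Module.finrank ℂ (LinearMap.ker (T - 1)) ≤ Module.finrank ℂ (LinearMap.ker (T + 1)) := by
  obtain ⟨D, w, hli, hsp, hwl, hwg⟩ := pure_basis O b _ (LinearMap.ker (T - 1)) le_rfl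
  have hTT' : ∀ v, T (T v) = v := fun v => by
    have := congrArg (fun f => f v) hTT
    exact this
  have hmem : ∀ v, v ∈ LinearMap.ker (T - 1) ↔ T v = v := by
    intro v; rw [LinearMap.mem_ker]; simp [sub_eq_zero]
  have hw : ∀ i, T (w i) = w i := fun i => by
    rw [← hmem, ← hsp]; exact Submodule.subset_span ⟨i, rfl⟩
  choose y hy1 hy2 using fun i => h (w i) (hwl i) (hw i)
  have hD : Module.finrank ℂ (LinearMap.ker (T - 1)) = D := by
    rw [← hsp, finrank_span_eq_card hli, Fintype.card_fin]
  rw [hD]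
  have := card_le_of_li (κ := Fin D) (v := fun i => y i - T (y i)) (li_of_lat (O := O) _ ?_) (LinearMap.ker (T + 1)) ?_
  · simpa using this
  · intro a ha hs i0 hi0
    set x := ∑ i, a i • y i with hx
    have hxl : InLat O b x := lat_sum fun i _ => lat_smul (ha i) (hy1 i)
    have hTx : T x = x := by
      rw [hx, map_sum]
      simp only [map_smul, smul_sub, Finset.sum_sub_distrib] at hs ⊢
      exact (sub_eq_zero.mp hs).symm
    obtain ⟨β, hβ, hxβ⟩ := hwg x ((hmem x).mpr hTx) hxl
    have h3 : ∑ i, a i • w i = ∑ i, (2 * β i) • w i := by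
      have : ∑ i, a i • w i = x + T x := by
        rw [hx, map_sum, ← Finset.sum_add_distrib]
        simp only [← hy2, smul_add, map_smul]
      rw [this, hTx, ← two_smul ℂ x, hxβ, Finset.smul_sum]
      simp only [mul_smul]
    have := li_unique hli h3 i0
    rw [hi0] at this
    exact two_ne h2 (hβ i0) this
  · intro i
    rw [LinearMap.mem_ker]
    simp [hTT']

open Polynomial in
theorem rot_bound (h2 : O.valuation (2 : ℂ) < 1) (R : Module.End ℂ V) (q : ℕ) (hR : R ^ (2 * 2 ^ q) = 1)
    (hRl : ∀ v, InLat O b v → InLat O b (R v)) (K : Submodule ℂ V) (hK : ∀ v ∈ K, R v = v)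
    (h : ∀ v ∈ K, InLat O b v → ∃ y, InLat O b y ∧ (∑ i ∈ Finset.range (2 * 2 ^ q), R ^ i) y = v) :
    2 ^ q * Module.finrank ℂ K ≤ Module.finrank ℂ (LinearMap.ker (R ^ (2 ^ q) + 1)) := by
  obtain ⟨D, w, hli, hsp, hwl, hwg⟩ := pure_basis O b _ K le_rfl
  have hwK : ∀ i, w i ∈ K := fun i => by rw [← hsp]; exact Submodule.subset_span ⟨i, rfl⟩
  have hD : Module.finrank ℂ K = D := by
    rw [← hsp, finrank_span_eq_card hli, Fintype.card_fin]
  choose y hy1 hy2 using fun i => h (w i) (hwK i) (hwl i)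
  set m := 2 ^ q with hm
  have hR' : ∀ k v, InLat O b v → InLat O b ((R ^ k) v) := by
    intro k
    induction k with
    | zero => intro v hv; simpa using hv
    | succ k ih => intro v hv; rw [pow_succ]; exact ih _ (hRl v hv)
  let n : Fin D → V := fun i => (∑ j ∈ Finset.range m, R ^ j) (y i)
  have hn : ∀ i, InLat O b (n i) := by
    intro i
    simp only [n, LinearMap.sum_apply]
    exact lat_sum fun j _ => hR' j _ (hy1 i)
  have hn1 : ∀ i, (1 + R ^ m) (n i) = w i := by
    intro i
    rw [← hy2 i]
    simp only [n]
    rw [← Module.End.mul_apply]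
    congr 1
    rw [two_mul, Finset.sum_range_add, add_mul, one_mul, Finset.mul_sum]
    simp only [pow_add]
  have hn2 : ∀ i, (R ^ m + 1) ((R - 1) (n i)) = 0 := by
    intro i
    simp only [n]
    rw [← Module.End.mul_apply, ← Module.End.mul_apply, mul_assoc, mul_geom_sum,
      show (R ^ m + 1) * (R ^ m - 1) = R ^ (2 * m) - 1 by rw [two_mul, pow_add]; noncomm_ring, hR, sub_self]
    rfl
  let ev : O[X] →+* Module.End ℂ V := (aeval R).toRingHom.comp (mapRingHom O.subtype)
  have evX : ev X = R := by simp [ev]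
  have evC : ∀ c, ev (C c) = (c : ℂ) • 1 := by
    intro c
    simp [ev, Algebra.algebraMap_eq_smul_one]
  have evl : ∀ p v, InLat O b v → InLat O b (ev p v) := by
    intro p v hv
    rw [p.as_sum_range_C_mul_X_pow, map_sum, LinearMap.sum_apply]
    apply lat_sum
    intro i _
    rw [map_mul, map_pow, evX, evC, smul_mul_assoc, one_mul]
    exact lat_smul (p.coeff i).2 (hR' i v hv)
  have evfix : ∀ (p : O[X]) v, R v = v → ev p v = ((p.eval 1 : O) : ℂ) • v := by
    intro p v hv
    have hk : ∀ k, (R ^ k) v = v := by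
      intro k; induction k with
      | zero => simp
      | succ k ih => rw [pow_succ, Module.End.mul_apply, hv, ih]
    conv_lhs => rw [p.as_sum_range_C_mul_X_pow]
    rw [map_sum, LinearMap.sum_apply, eval_eq_sum_range]
    push_cast
    rw [Finset.sum_smul]
    apply Finset.sum_congr rfl
    intro i _
    rw [map_mul, map_pow, evX, evC, smul_mul_assoc, one_mul, LinearMap.smul_apply, hk]
    simp
  have evcomm : ∀ (p q : O[X]) v, ev p (ev q v) = ev q (ev p v) := by
    intro p q v
    rw [← Module.End.mul_apply, ← Module.End.mul_apply, ← map_mul, ← map_mul, mul_comm]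
  have evR1 : ev (X - 1) = R - 1 := by rw [map_sub, evX, map_one]
  have evz : ev (X ^ m + 1) = R ^ m + 1 := by rw [map_add, map_pow, evX, map_one]
  have evz' : ev (1 + X ^ m) = 1 + R ^ m := by rw [map_add, map_pow, evX, map_one]
  let L : (Fin D → O[X]) → Prop := fun α => ∑ i, ev (α i) ((R - 1) (n i)) = 0
  have step : ∀ α, L α → ∃ β δ : Fin D → O[X], L β ∧ ∀ i, α i = (X - 1) * β i + (X ^ m + 1) * δ i := by
    intro α hα
    set x := ∑ i, ev (α i) (n i) with hx
    have hRx : (R - 1) x = 0 := by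
      rw [hx, map_sum, ← evR1]
      simp only [L, ← evR1] at hα
      rw [← hα]
      exact Finset.sum_congr rfl fun i _ => evcomm _ _ _
    have hRx' : R x = x := by simpa [sub_eq_zero] using hRx
    have hzx : (R ^ m) x = x := by
      generalize m = k
      induction k with
      | zero => simp
      | succ k ih => rw [pow_succ, Module.End.mul_apply, hRx', ih]
    have h2x : (2 : ℂ) • x = ∑ i, (((α i).eval 1 : O) : ℂ) • w i := by
      have : (1 + R ^ m) x = (2 : ℂ) • x := by
        rw [LinearMap.add_apply, hzx, two_smul]; rfl
      rw [← this, hx, map_sum]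
      apply Finset.sum_congr rfl
      intro i _
      rw [← evz', evcomm, evz', hn1, evfix _ _ (hK _ (hwK i))]
    have hxK : x ∈ K := by
      have : x = (2 : ℂ)⁻¹ • ((2 : ℂ) • x) := by rw [smul_smul]; simp
      rw [this, h2x]
      exact K.smul_mem _ (K.sum_mem fun i _ => K.smul_mem _ (hwK i))
    obtain ⟨β, hβ, hxβ⟩ := hwg x hxK (lat_sum fun i _ => evl _ _ (hn i))
    have hα1 : ∀ i, (α i).eval 1 = 2 * (⟨β i, hβ i⟩ : O) := by
      intro i
      have := li_unique hli (a := fun i => (((α i).eval 1 : O) : ℂ)) (c := fun i => 2 * β i) (by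
        rw [← h2x, hxβ, Finset.smul_sum]
        simp only [mul_smul]) i
      apply Subtype.ext
      exact this
    let B : Fin D → O := fun i => ⟨β i, hβ i⟩
    let β' : Fin D → O[X] := fun i => (α i /ₘ (X - C 1)) - C (B i) * ∑ j ∈ Finset.range m, X ^ j
    have hαβ : ∀ i, α i = (X - 1) * β' i + (X ^ m + 1) * C (B i) := by
      intro i
      have h1 := modByMonic_add_div (α i) (X - C (1 : O))
      rw [modByMonic_X_sub_C_eq_C_eval, hα1 i] at h1
      have h3 := mul_geom_sum (X : O[X]) m
      simp only [β']
      rw [mul_sub, mul_left_comm, h3]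
      conv_lhs => rw [← h1]
      rw [C_mul, C_1]
      have : (C (2 : O)) = (2 : O[X]) := rfl
      rw [this]
      simp only [B]
      ring
    refine ⟨β', fun i => C (B i), ?_, hαβ⟩
    show ∑ i, ev (β' i) ((R - 1) (n i)) = 0
    set u := ∑ i, ev (β' i) ((R - 1) (n i)) with hu
    have hu1 : (R - 1) u = 0 := by
      have h5 : ∀ i, (R - 1) (ev (β' i) ((R - 1) (n i))) = ev (α i) ((R - 1) (n i)) := by
        intro i
        conv_rhs => rw [hαβ i, map_add, LinearMap.add_apply, map_mul, map_mul, evR1, Module.End.mul_apply, Module.End.mul_apply]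
        rw [evcomm (X ^ m + 1), evz, hn2]
        simp
      rw [hu, map_sum]
      simp only [h5]
      exact hα
    have hu2 : (R ^ m + 1) u = 0 := by
      rw [hu, map_sum]
      apply Finset.sum_eq_zero
      intro i _
      rw [← evz, evcomm, evz, hn2, map_zero]
    have hRu : R u = u := by simpa [sub_eq_zero] using hu1
    have hzu : (R ^ m) u = u := by
      generalize m = k
      induction k with
      | zero => simp
      | succ k ih => rw [pow_succ, Module.End.mul_apply, hRu, ih]
    rw [LinearMap.add_apply, hzu, Module.End.one_apply, ← two_smul ℂ u] at hu2
    exact (smul_eq_zero.mp hu2).resolve_left two_ne_zero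
  have steps : ∀ N α, L α → ∃ β δ : Fin D → O[X], L β ∧ ∀ i, α i = (X - 1) ^ N * β i + (X ^ m + 1) * δ i := by
    intro N
    induction N with
    | zero => intro α hα; exact ⟨α, fun _ => 0, hα, fun i => by simp⟩
    | succ N ih =>
      intro α hα
      obtain ⟨β, δ, hβ, h1⟩ := step α hα
      obtain ⟨β', δ', hβ', h3⟩ := ih β hβ
      refine ⟨β', fun i => δ i + (X - 1) * δ' i, hβ', fun i => ?_⟩
      rw [h1, h3]; ring
  rw [hD]
  let v : Fin m × Fin D → V := fun x => (R ^ (x.1 : ℕ)) ((R - 1) (n x.2))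
  have hv := card_le_of_li (κ := Fin m × Fin D) (v := v) (li_of_lat (O := O) _ ?_) (LinearMap.ker (R ^ m + 1)) ?_
  · simpa using hv
  · intro a ha hs x0 hx0
    let α : Fin D → O[X] := fun i => ∑ l : Fin m, C (⟨a (l, i), ha _⟩ : O) * X ^ (l : ℕ)
    have hα : L α := by
      show ∑ i, ev (α i) ((R - 1) (n i)) = 0
      rw [← hs, Fintype.sum_prod_type_right]
      apply Finset.sum_congr rfl
      intro i _
      simp only [α, v]
      rw [map_sum, LinearMap.sum_apply]
      apply Finset.sum_congr rfl
      intro l _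
      rw [map_mul, map_pow, evX, evC, smul_mul_assoc, one_mul, LinearMap.smul_apply]
    obtain ⟨β, δ, _, h1⟩ := steps m α hα
    let res : O →+* IsLocalRing.ResidueField O := IsLocalRing.residue O
    have hres2 : (2 : IsLocalRing.ResidueField O) = 0 := by
      have h3 : res 2 = 0 := by
        rw [IsLocalRing.residue_eq_zero_iff, ← ValuationSubring.coe_mem_nonunits_iff, ValuationSubring.mem_nonunits_iff]
        exact h2
      rw [← h3, map_ofNat]
    have hch : CharP (IsLocalRing.ResidueField O) 2 := CharTwo.of_one_ne_zero_of_two_eq_zero one_ne_zero hres2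
    have hdiv : (X ^ m + 1 : (IsLocalRing.ResidueField O)[X]) ∣ (α x0.2).map res := by
      rw [h1]
      simp only [Polynomial.map_add, Polynomial.map_mul, Polynomial.map_pow, Polynomial.map_sub, Polynomial.map_X, Polynomial.map_one]
      have hsub : (X - 1 : (IsLocalRing.ResidueField O)[X]) ^ m = X ^ m + 1 := by
        rw [hm, sub_pow_char_pow, one_pow, CharTwo.sub_eq_add]
      rw [hsub]
      exact ⟨_, (mul_add _ _ _).symm⟩
    have hdeg : ((α x0.2).map res).degree < (X ^ m + 1 : (IsLocalRing.ResidueField O)[X]).degree := by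
      rw [← C_1, degree_X_pow_add_C (by positivity)]
      refine lt_of_le_of_lt degree_map_le ?_
      have := degree_sum_fin_lt (fun l : Fin m => (⟨a (l, x0.2), ha _⟩ : O))
      exact this
    have h0 := eq_zero_of_dvd_of_degree_lt hdiv hdeg
    have hc : (α x0.2).coeff (x0.1 : ℕ) = 1 := by
      simp only [α, finset_sum_coeff, coeff_C_mul, coeff_X_pow]
      rw [Finset.sum_eq_single x0.1]
      · apply Subtype.ext; simpa using hx0
      · intro l _ hl
        rw [if_neg, mul_zero]
        intro h; exact hl (Fin.ext h.symm)
      · simp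
    have := congrArg (fun p => p.coeff (x0.1 : ℕ)) h0
    simp only [coeff_map, hc, map_one, coeff_zero] at this
    exact one_ne_zero this
  · intro x
    rw [LinearMap.mem_ker]
    simp only [v]
    rw [← Module.End.mul_apply, show (R ^ m + 1) * R ^ (x.1 : ℕ) = R ^ (x.1 : ℕ) * (R ^ m + 1) by
      rw [add_mul, mul_add, ← pow_add, ← pow_add, add_comm m]; simp, Module.End.mul_apply, hn2, map_zero]

theorem dih_bound (h2 : O.valuation (2 : ℂ) < 1) (R S : Module.End ℂ V) (q : ℕ) (hR : R ^ (2 * 2 ^ q) = 1)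
    (hS : S * S = 1) (hRS : R * S * R = S)
    (hRl : ∀ v, InLat O b v → InLat O b (R v))
    (h : ∀ v, InLat O b v → R v = v → S v = v → ∃ y, InLat O b y ∧
      ((1 + S) * ∑ i ∈ Finset.range (2 * 2 ^ q), R ^ i) y = (2 : ℂ) • v) :
    2 ^ q * Module.finrank ℂ (LinearMap.ker (R - 1) ⊓ LinearMap.ker (S - 1) : Submodule ℂ V) ≤
      2 ^ q * Module.finrank ℂ (LinearMap.ker (R - 1) ⊓ LinearMap.ker (S + 1) : Submodule ℂ V) +
      Module.finrank ℂ (LinearMap.ker (R ^ (2 ^ q) + 1)) := by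
  have hm1 : ∀ v, v ∈ LinearMap.ker (R - 1) ↔ R v = v := by
    intro v; rw [LinearMap.mem_ker]; simp [sub_eq_zero]
  have hm2 : ∀ v, v ∈ LinearMap.ker (S - 1) ↔ S v = v := by
    intro v; rw [LinearMap.mem_ker]; simp [sub_eq_zero]
  set W : Submodule ℂ V := LinearMap.ker (R - 1) ⊓ LinearMap.ker (S - 1) with hW
  set U : Submodule ℂ V := LinearMap.ker (R - 1) ⊓ LinearMap.ker (S + 1) with hU
  obtain ⟨D, w, hli, hsp, hwl, hwg⟩ := pure_basis O b _ W le_rfl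
  have hwW : ∀ i, w i ∈ W := fun i => by rw [← hsp]; exact Submodule.subset_span ⟨i, rfl⟩
  have hD : Module.finrank ℂ W = D := by
    rw [← hsp, finrank_span_eq_card hli, Fintype.card_fin]
  choose y hy1 hy2 using fun i => h (w i) (hwl i) ((hm1 _).mp (hwW i).1) ((hm2 _).mp (hwW i).2)
  set T := ∑ i ∈ Finset.range (2 * 2 ^ q), R ^ i with hT
  have hRT : R * T = T := by
    have := mul_geom_sum R (2 * 2 ^ q)
    rw [hR, sub_self, sub_mul, one_mul, sub_eq_zero] at this
    exact this
  let Φ : (Fin D → ℂ) →ₗ[ℂ] V := Fintype.linearCombination ℂ (fun i => ((1 - S) * T) (y i))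
  let Ψ : (Fin D → ℂ) →ₗ[ℂ] V := Fintype.linearCombination ℂ w
  have hΨ : Function.Injective Ψ := linearIndependent_iff_injective_fintypeLinearCombination.mp hli
  have hΦ : LinearMap.range Φ ≤ U := by
    rintro _ ⟨a, rfl⟩
    simp only [Φ, Fintype.linearCombination_apply]
    refine U.sum_mem fun i _ => U.smul_mem _ ⟨?_, ?_⟩
    · rw [SetLike.mem_coe, hm1, ← Module.End.mul_apply]
      congr 1
      have : R * S * T = S * T := by
        conv_lhs => rw [← hRT, ← mul_assoc, hRS]
      rw [sub_mul, mul_sub, one_mul, hRT, ← mul_assoc, this]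
    · rw [SetLike.mem_coe, LinearMap.mem_ker, ← Module.End.mul_apply, ← mul_assoc,
        show (S + 1) * (1 - S) = 1 - S * S by noncomm_ring, hS, sub_self, zero_mul]
      rfl
  let K := (LinearMap.ker Φ).map Ψ
  have hKW : K ≤ W := by
    rintro _ ⟨a, _, rfl⟩
    simp only [Ψ, Fintype.linearCombination_apply]
    exact W.sum_mem fun i _ => W.smul_mem _ (hwW i)
  have hK1 := rot_bound h2 R q hR hRl K (fun v hv => (hm1 _).mp (hKW hv).1) (by
    rintro v hvK hv
    obtain ⟨a, ha, hav⟩ := hwg v (hKW hvK) hv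
    obtain ⟨a', ha', hav'⟩ := hvK
    have : a' = a := hΨ (by rw [hav', hav]; simp only [Ψ, Fintype.linearCombination_apply])
    subst this
    refine ⟨∑ i, a' i • y i, lat_sum fun i _ => lat_smul (ha i) (hy1 i), ?_⟩
    have e1 : ((1 - S) * T) (∑ i, a' i • y i) = 0 := by
      rw [SetLike.mem_coe, LinearMap.mem_ker] at ha'
      rw [← ha', map_sum]
      simp only [Φ, Fintype.linearCombination_apply, map_smul]
    have e2 : ((1 + S) * T) (∑ i, a' i • y i) = (2 : ℂ) • v := by
      rw [map_sum, hav, Finset.smul_sum]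
      apply Finset.sum_congr rfl
      intro i _
      rw [map_smul, hy2, smul_comm]
    have e3 : (2 : ℂ) • T (∑ i, a' i • y i) = (2 : ℂ) • v := by
      rw [← e2, ← add_zero (((1 + S) * T) _), ← e1, ← LinearMap.add_apply, ← LinearMap.smul_apply]
      congr 1
      rw [← add_mul, two_smul, show (1 + S) + (1 - S) = 1 + 1 by abel, add_mul, one_mul]
    exact smul_right_injective V (two_ne_zero (α := ℂ)) e3)
  have hK2 : Module.finrank ℂ K = Module.finrank ℂ (LinearMap.ker Φ) :=
    ((Submodule.equivMapOfInjective Ψ hΨ _).finrank_eq).symm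
  have hK3 := LinearMap.finrank_range_add_finrank_ker Φ
  rw [Module.finrank_fin_fun] at hK3
  have hK4 := Submodule.finrank_mono hΦ
  rw [hD]
  rw [hK2] at hK1
  calc 2 ^ q * D ≤ 2 ^ q * (Module.finrank ℂ U + Module.finrank ℂ (LinearMap.ker Φ)) :=
        Nat.mul_le_mul_left _ (by omega)
    _ ≤ _ := by rw [mul_add]; omega
end lat2

end PartL2

section PartL3

theorem out_mul_bij {G : Type} [Group G] (H : Subgroup G) :
    Function.Bijective (fun p : (G ⧸ H) × H => p.1.out * (p.2 : G)) := by
  constructor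
  · rintro ⟨q, h⟩ ⟨q', h'⟩ he
    simp only at he
    have h1 : q = q' := by
      have := congrArg (QuotientGroup.mk (s := H)) he
      rw [QuotientGroup.mk_mul_of_mem _ h.2, QuotientGroup.mk_mul_of_mem _ h'.2] at this
      simpa using this
    subst h1
    simpa using he
  · intro g
    have : ((g : G ⧸ H).out)⁻¹ * g ∈ H := by
      rw [← QuotientGroup.eq]; simp
    exact ⟨((g : G ⧸ H), ⟨_, this⟩), by simp⟩

theorem lat_avg {G : Type} [Group G] [Fintype G] {V : Type} [AddCommGroup V] [Module ℂ V]
    [FiniteDimensional ℂ V] [Nontrivial V] (O : ValuationSubring ℂ) (ρ : Representation ℂ G V)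
    (hS : SchurRep ρ) :
    ∃ b : Module.Basis (Fin (Module.finrank ℂ V)) ℂ V, (∀ g v, InLat O b v → InLat O b (ρ g v)) ∧
      ∀ (H : Subgroup G) (lam : H → ℂ) (v : V), InLat O b v → (∀ h : H, ρ h v = lam h • v) →
        ∃ y, InLat O b y ∧ ∑ h : H, lam h • ρ (h : G)⁻¹ y =
          ((Nat.card G : ℂ) / (Module.finrank ℂ V : ℂ)) • v := by
  obtain ⟨b, hb⟩ := exists_lat O ρ
  refine ⟨b, hb, ?_⟩
  intro H lam v hv hlam
  have hpos : 0 < Module.finrank ℂ V := Module.finrank_pos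
  set i0 : Fin (Module.finrank ℂ V) := ⟨0, hpos⟩
  obtain ⟨f, hf⟩ : ∃ f : Module.End ℂ V, ∀ v, f v = b.repr v i0 • b i0 :=
    ⟨(b.coord i0).smulRight (b i0), fun v => rfl⟩
  have hfl : ∀ v, InLat O b v → InLat O b (f v) := by
    intro v hv i
    rw [hf, map_smul, Finsupp.smul_apply, smul_eq_mul, b.repr_self, Finsupp.single_apply]
    split_ifs
    · rw [mul_one]; exact hv i0
    · rw [mul_zero]; exact O.zero_mem
  have hftr : LinearMap.trace ℂ V f = 1 := by
    rw [LinearMap.trace_eq_matrix_trace ℂ b, Matrix.trace]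
    simp only [Matrix.diag_apply, LinearMap.toMatrix_apply, hf, map_smul, Finsupp.smul_apply, b.repr_self,
      smul_eq_mul, Finsupp.single_apply]
    rw [Finset.sum_eq_single i0] <;> simp
    intro j hj h; exact absurd h.symm hj
  obtain ⟨a, ha⟩ := hS (∑ g, ρ g⁻¹ * f * ρ g) (by
    intro x
    rw [Finset.sum_mul, Finset.mul_sum, ← Equiv.sum_comp (Equiv.mulRight x⁻¹)]
    apply Finset.sum_congr rfl
    intro g _
    simp only [Equiv.coe_mulRight, mul_inv_rev, inv_inv, map_mul]
    have : ρ x⁻¹ * ρ x = 1 := by rw [← map_mul]; simp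
    rw [mul_assoc _ _ (ρ x), mul_assoc _ _ (ρ x), this, mul_one]
    simp only [mul_assoc])
  have hac : a = (Nat.card G : ℂ) / (Module.finrank ℂ V : ℂ) := by
    have h1 := congrArg (LinearMap.trace ℂ V) ha
    rw [map_sum, map_smul, LinearMap.trace_one, smul_eq_mul] at h1
    have h2 : ∀ g, LinearMap.trace ℂ V (ρ g⁻¹ * f * ρ g) = 1 := by
      intro g
      rw [LinearMap.trace_mul_comm, ← mul_assoc, ← map_mul]
      simpa using hftr
    simp only [h2] at h1
    rw [eq_div_iff (by exact_mod_cast hpos.ne'), ← h1]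
    simp
  refine ⟨∑ q : G ⧸ H, ρ q.out⁻¹ (f (ρ q.out v)), ?_, ?_⟩
  · apply lat_sum
    intro q _
    exact hb _ _ (hfl _ (hb _ _ hv))
  · rw [← hac]
    have h1 := congrArg (fun T => T v) ha
    simp only [LinearMap.sum_apply, LinearMap.smul_apply, Module.End.one_apply] at h1
    rw [← h1, ← Equiv.sum_comp (Equiv.ofBijective _ (out_mul_bij H)), Fintype.sum_prod_type,
      Finset.sum_comm]
    apply Finset.sum_congr rfl
    intro h _
    rw [map_sum, Finset.smul_sum]
    apply Finset.sum_congr rfl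
    intro q _
    simp only [Equiv.ofBijective_apply, mul_inv_rev, map_mul, Module.End.mul_apply, hlam, map_smul]

end PartL3

section PartL4

section
variable {V : Type} [AddCommGroup V] [Module ℂ V] [FiniteDimensional ℂ V]

theorem fin_of_idem (e : Module.End ℂ V) (he : e * e = e) (W : Submodule ℂ V)
    (h : ∀ v, v ∈ W ↔ e v = v) : LinearMap.trace ℂ V e = (Module.finrank ℂ W : ℂ) := by
  rw [idem_trace_nat e he]
  have : LinearMap.range e = W := by
    ext v
    rw [h]
    constructor
    · rintro ⟨y, rfl⟩
      exact congrArg (fun f => f y) he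
    · intro h; exact ⟨v, h⟩
  rw [this]

theorem half_idem (T : Module.End ℂ V) (hT : T * T = 1) :
    ((2:ℂ)⁻¹ • (1 + T)) * ((2:ℂ)⁻¹ • (1 + T)) = (2:ℂ)⁻¹ • (1 + T) := by
  rw [smul_mul_smul_comm, mul_add, add_mul, add_mul, hT, mul_one, one_mul, mul_one]
  have : (1 + T + (T + 1)) = (2:ℂ) • (1 + T) := by rw [two_smul]; abel
  rw [this, smul_smul]; norm_num

theorem trace_half (T : Module.End ℂ V) (hT : T * T = 1) :
    (2:ℂ)⁻¹ * (Module.finrank ℂ V + LinearMap.trace ℂ V T) = Module.finrank ℂ (LinearMap.ker (T - 1)) := by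
  rw [← fin_of_idem _ (half_idem T hT)]
  · simp [mul_add]
  · intro v
    rw [LinearMap.mem_ker]
    simp only [LinearMap.sub_apply, Module.End.one_apply, LinearMap.smul_apply, LinearMap.add_apply]
    constructor
    · intro h
      rw [sub_eq_zero.mp h, ← two_smul ℂ v, smul_smul]; norm_num
    · intro h
      have : T v = T ((2:ℂ)⁻¹ • (v + T v)) := by rw [h]
      rw [map_smul, map_add] at this
      have h3 : T (T v) = v := congrArg (fun f => f v) hT
      rw [h3, add_comm, h] at this
      rw [this, sub_self]

theorem trace_inv (T : Module.End ℂ V) (hT : T * T = 1) :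
    LinearMap.trace ℂ V T = (Module.finrank ℂ (LinearMap.ker (T - 1)) : ℂ) - Module.finrank ℂ (LinearMap.ker (T + 1)) := by
  have h1 := trace_half T hT
  have h2 := trace_half (-T) (by rw [neg_mul_neg]; exact hT)
  have : LinearMap.ker (-T - 1) = LinearMap.ker (T + 1) := by
    rw [← LinearMap.ker_neg]; congr 1; abel
  rw [this, map_neg] at h2
  rw [← h1, ← h2]; ring

theorem dih_trace (R S : Module.End ℂ V) (m : ℕ) (hm : 0 < m) (hR : R ^ m = 1) (hS : S * S = 1)
    (hRS : R * S * R = S) :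
    (m:ℂ)⁻¹ * LinearMap.trace ℂ V ((∑ i ∈ Finset.range m, R ^ i) * S) =
      (Module.finrank ℂ (LinearMap.ker (R - 1) ⊓ LinearMap.ker (S - 1) : Submodule ℂ V) : ℂ) -
      Module.finrank ℂ (LinearMap.ker (R - 1) ⊓ LinearMap.ker (S + 1) : Submodule ℂ V) := by
  have hm0 : (m:ℂ) ≠ 0 := by exact_mod_cast hm.ne'
  obtain ⟨E, hE⟩ : ∃ E, E = (m:ℂ)⁻¹ • ∑ i ∈ Finset.range m, R ^ i := ⟨_, rfl⟩
  have hRE : R * E = E := by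
    rw [hE, mul_smul_comm, Finset.mul_sum]
    congr 1
    have := Finset.sum_range_succ' (fun i => R ^ i) m
    rw [Finset.sum_range_succ, hR, pow_zero] at this
    simp only [← pow_succ']
    exact (add_right_cancel this).symm
  have hRiE : ∀ i, R ^ i * E = E := by
    intro i
    induction i with
    | zero => simp
    | succ i ih => rw [pow_succ, mul_assoc, hRE, ih]
  have hEE : E * E = E := by
    conv_lhs => enter [1]; rw [hE]
    rw [smul_mul_assoc, Finset.sum_mul]
    simp only [hRiE]
    rw [Finset.sum_const, Finset.card_range, ← Nat.cast_smul_eq_nsmul ℂ, smul_smul, inv_mul_cancel₀ hm0, one_smul]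
  have hfix : ∀ v, R v = v → E v = v := by
    intro v hv
    have : ∀ i, (R ^ i) v = v := by
      intro i
      induction i with
      | zero => simp
      | succ i ih => rw [pow_succ, Module.End.mul_apply, hv, ih]
    rw [hE]
    simp only [LinearMap.smul_apply, LinearMap.sum_apply, this]
    rw [Finset.sum_const, Finset.card_range, ← Nat.cast_smul_eq_nsmul ℂ, smul_smul, inv_mul_cancel₀ hm0, one_smul]
  have hESE : E * (S * E) = S * E := by
    have h1 : R * (S * E) = S * E := by
      calc R * (S * E) = R * (S * (R * E)) := by rw [hRE]
        _ = (R * S * R) * E := by simp only [mul_assoc]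
        _ = _ := by rw [hRS]
    ext v
    exact hfix _ (congrArg (fun f => f v) h1)
  have hER : E * R = E := by
    rw [← hRE]
    conv_rhs => rw [hRE]
    rw [hE, mul_smul_comm, smul_mul_assoc, Finset.mul_sum, Finset.sum_mul]
    rw [hE, mul_smul_comm, Finset.mul_sum] at hRE
    simp only [← pow_succ', ← pow_succ] at hRE ⊢
    rw [← hRE, smul_right_inj (inv_ne_zero hm0)]
    have h1 := Finset.sum_range_succ' (fun i => R ^ (i + 1)) m
    rw [Finset.sum_range_succ, pow_succ R m, hR, one_mul, zero_add, pow_one] at h1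
    exact (add_right_cancel h1).symm
  have hESE' : E * S * E = E * S := by
    have h1 : E * S * R = E * S := by
      calc E * S * R = E * R * S * R := by rw [hER]
        _ = E * (R * S * R) := by simp only [mul_assoc]
        _ = _ := by rw [hRS]
    have h2 : ∀ i, E * S * R ^ i = E * S := by
      intro i
      induction i with
      | zero => simp
      | succ i ih => rw [pow_succ, ← mul_assoc, ih, h1]
    conv_lhs => enter [2]; rw [hE]
    rw [mul_smul_comm, Finset.mul_sum]
    simp only [h2]
    rw [Finset.sum_const, Finset.card_range, ← Nat.cast_smul_eq_nsmul ℂ, smul_smul, inv_mul_cancel₀ hm0, one_smul]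
  have hSE : S * E = E * S := by rw [← hESE, ← mul_assoc, hESE']
  have key : ∀ T : Module.End ℂ V, T * T = 1 → T * E = E * T →
      (2:ℂ)⁻¹ * LinearMap.trace ℂ V (E + E * T) =
      Module.finrank ℂ (LinearMap.ker (R - 1) ⊓ LinearMap.ker (T - 1) : Submodule ℂ V) := by
    intro T hT hTE
    have h1 : (2:ℂ)⁻¹ • (E + E * T) = E * ((2:ℂ)⁻¹ • (1 + T)) := by
      rw [mul_smul_comm, mul_add, mul_one]
    have h2 : E * ((2:ℂ)⁻¹ • (1 + T)) = ((2:ℂ)⁻¹ • (1 + T)) * E := by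
      rw [mul_smul_comm, smul_mul_assoc, mul_add, add_mul, hTE, mul_one, one_mul]
    rw [← smul_eq_mul, ← map_smul, h1]
    apply fin_of_idem
    · nth_rw 1 [h2]
      rw [mul_assoc, ← mul_assoc E, hEE, h2, ← mul_assoc, half_idem T hT]
    · intro v
      rw [Submodule.mem_inf, LinearMap.mem_ker, LinearMap.mem_ker]
      simp only [LinearMap.sub_apply, Module.End.one_apply, sub_eq_zero]
      constructor
      · rintro ⟨ha, hb⟩
        simp only [Module.End.mul_apply, LinearMap.smul_apply, LinearMap.add_apply, Module.End.one_apply, hb]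
        rw [← two_smul ℂ v, smul_smul, inv_mul_cancel₀ two_ne_zero, one_smul, hfix v ha]
      · intro h
        constructor
        · have := congrArg (fun f => f ((2:ℂ)⁻¹ • (v + T v))) hRE
          have h3 : E ((2:ℂ)⁻¹ • (v + T v)) = v := h
          simp only [Module.End.mul_apply, h3] at this
          exact this
        · rw [h2] at h
          have h3 : (2:ℂ)⁻¹ • (E v + T (E v)) = v := h
          have hT' : ∀ w, T (T w) = w := fun w => congrArg (fun f => f w) hT
          rw [← h3, map_smul, map_add, hT', add_comm]
  have k1 := key S hS hSE
  have k2 := key (-S) (by rw [neg_mul_neg]; exact hS) (by rw [neg_mul, mul_neg, hSE])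
  have : LinearMap.ker (-S - 1) = LinearMap.ker (S + 1) := by
    rw [← LinearMap.ker_neg]; congr 1; abel
  rw [this, mul_neg] at k2
  rw [← k1, ← k2, ← smul_eq_mul, ← map_smul, ← smul_mul_assoc, ← hE]
  simp only [map_add, map_neg]
  ring
end

/-- `k = 1` bound. -/
theorem k1_bound {G : Type} [Group G] [Fintype G] {V : Type} [AddCommGroup V] [Module ℂ V]
    [FiniteDimensional ℂ V] [Nontrivial V] (ρ : Representation ℂ G V) (hS : SchurRep ρ)
    (c : ℕ) (hc : Nat.card G = 2 * c * Module.finrank ℂ V) (hodd : ¬ 2 ∣ c)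
    (q m : ℕ) (hm : m = 2 * 2 ^ q) (H : Subgroup G) (e : DihedralGroup m ≃* H) (η : ℂ) (hη : η * η = 1) :
    ∃ a : ℤ, (m : ℂ)⁻¹ * ∑ i ∈ Finset.range m, η ^ i *
        ρ.character ((e (DihedralGroup.r 1) : G) ^ i * (e (DihedralGroup.sr 0) : G)) = a ∧
      ∃ D : ℕ, (2:ℂ)⁻¹ * (Module.finrank ℂ V - η ^ (2 ^ q) * ρ.character ((e (DihedralGroup.r 1) : G) ^ (2^q))) = D ∧
        2 ^ q * |a| ≤ D := by
  obtain ⟨O, h2, hz⟩ := exists_val2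
  obtain ⟨b, hb, havg⟩ := lat_avg O ρ hS
  have hm0 : 0 < m := by rw [hm]; positivity
  have : NeZero m := ⟨hm0.ne'⟩
  have hd : (Module.finrank ℂ V : ℂ) ≠ 0 := by exact_mod_cast (Module.finrank_pos (R := ℂ) (M := V)).ne'
  obtain ⟨r, hr⟩ : ∃ r : G, r = e (DihedralGroup.r 1) := ⟨_, rfl⟩
  obtain ⟨s, hs⟩ : ∃ s : G, s = e (DihedralGroup.sr 0) := ⟨_, rfl⟩
  rw [← hr, ← hs]
  have hri : ∀ i : ℕ, r ^ i = e (DihedralGroup.r i) := by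
    intro i; rw [hr, ← Subgroup.coe_pow, ← map_pow, DihedralGroup.r_one_pow]
  have hrm : r ^ m = 1 := by rw [hri]; simp
  have hss : s * s = 1 := by
    rw [hs, ← Subgroup.coe_mul, ← map_mul]; simp
  have hrsr : r * s * r = s := by
    rw [hr, hs, ← Subgroup.coe_mul, ← map_mul, ← Subgroup.coe_mul, ← map_mul]; simp
  have hm1 : η ^ m = 1 := by rw [hm, pow_mul, pow_two, hη, one_pow]
  obtain ⟨R, hR⟩ : ∃ R, R = η • ρ r := ⟨_, rfl⟩
  have hηO : η ∈ O := by
    have : (η - 1) * (η + 1) = 0 := by linear_combination hη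
    rcases mul_eq_zero.mp this with h | h
    · rw [sub_eq_zero.mp h]; exact O.one_mem
    · rw [eq_neg_of_add_eq_zero_left h]; exact O.neg_mem _ O.one_mem
  have hRi : ∀ i, R ^ i = η ^ i • ρ (r ^ i) := by intro i; rw [hR, smul_pow, map_pow]
  have hRm : R ^ m = 1 := by rw [hRi, hm1, hrm]; simp
  have key : ∀ ε : ℂ, ε * ε = 1 →
      2 ^ q * Module.finrank ℂ (LinearMap.ker (R - 1) ⊓ LinearMap.ker (ε • ρ s - 1) : Submodule ℂ V) ≤
      2 ^ q * Module.finrank ℂ (LinearMap.ker (R - 1) ⊓ LinearMap.ker (ε • ρ s + 1) : Submodule ℂ V) +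
      Module.finrank ℂ (LinearMap.ker (R ^ (2 ^ q) + 1)) := by
    intro ε hε
    apply dih_bound (b := b) h2 R (ε • ρ s) q (hm ▸ hRm)
    · rw [smul_mul_smul_comm, hε, ← map_mul, hss]; simp
    · rw [hR, smul_mul_smul_comm, smul_mul_smul_comm, ← map_mul, ← map_mul, hrsr]
      congr 1; linear_combination ε * hη
    · intro v hv
      rw [hR]; exact lat_smul hηO (hb _ _ hv)
    · intro v hv hRv hSv
      rw [← hm]
      obtain ⟨l, hl1, hl2⟩ : ∃ l : DihedralGroup m → ℂ, (∀ i, l (DihedralGroup.r i) = η ^ i.val) ∧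
        (∀ i, l (DihedralGroup.sr i) = ε * η ^ i.val) :=
        ⟨fun x => match x with
          | .r i => η ^ i.val
          | .sr i => ε * η ^ i.val, fun _ => rfl, fun _ => rfl⟩
      have hl : ∀ x, l x * l x = 1 := by
        rintro (i | i)
        · rw [hl1, ← mul_pow, hη, one_pow]
        · rw [hl2, mul_mul_mul_comm, ← mul_pow, hη, hε, one_pow, one_mul]
      have he1 : ∀ i : ZMod m, (e (DihedralGroup.r i) : G) = r ^ i.val := by
        intro i; rw [hri, ZMod.natCast_zmod_val]
      have he2 : ∀ i : ZMod m, (e (DihedralGroup.sr i) : G) = s * r ^ i.val := by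
        intro i; rw [hri, ZMod.natCast_zmod_val, hs, ← Subgroup.coe_mul, ← map_mul]; simp
      have ho1 : ∀ i : ZMod m, l (DihedralGroup.r i) • ρ (e (DihedralGroup.r i)) = R ^ i.val := by
        intro i; rw [hl1, he1, hRi]
      have ho2 : ∀ i : ZMod m, l (DihedralGroup.sr i) • ρ (e (DihedralGroup.sr i)) = (ε • ρ s) * R ^ i.val := by
        intro i; rw [hl2, he2, hRi, smul_mul_smul_comm, map_mul]
      have hRiv : ∀ i, (R ^ i) v = v := by
        intro i
        induction i with
        | zero => simp
        | succ i ih => rw [pow_succ, Module.End.mul_apply, hRv, ih]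
      have hlv : ∀ x, ρ (e x) v = l x • v := by
        intro x
        have h3 : (l x • ρ (e x)) v = v := by
          cases x with
          | r i => rw [ho1, hRiv]
          | sr i => rw [ho2, Module.End.mul_apply, hRiv, hSv]
        conv_rhs => rw [← h3]
        rw [LinearMap.smul_apply, smul_smul, hl, one_smul]
      obtain ⟨y, hy, hy2⟩ := havg H (fun h => l (e.symm h)) v hv (by
        intro h
        have := hlv (e.symm h)
        rwa [MulEquiv.apply_symm_apply] at this)
      refine ⟨(((c : ℤ) : ℂ))⁻¹ • y, lat_smul (odd_unit h2 hz c (by exact_mod_cast hodd)) hy, ?_⟩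
      have hc0 : (c : ℂ) ≠ 0 := by
        intro h; apply hodd; have : c = 0 := by exact_mod_cast h
        simp [this]
      rw [map_smul]
      have : ((1 + ε • ρ s) * ∑ i ∈ Finset.range m, R ^ i) y = ((2 * c : ℂ)) • v := by
        have h4 : (2 * c : ℂ) = (Nat.card G : ℂ) / (Module.finrank ℂ V : ℂ) := by
          rw [hc]; push_cast; field_simp
        rw [h4, ← hy2]
        rw [← Equiv.sum_comp (e.toEquiv.trans (Equiv.inv H))]
        have h5 : ∀ x, l (e.symm ((e.toEquiv.trans (Equiv.inv H)) x)) • ρ (((e.toEquiv.trans (Equiv.inv H)) x : H) : G)⁻¹ y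
            = (l x • ρ (e x)) y := by
          intro x
          have h6 : l x⁻¹ = l x := by
            cases x with
            | r i =>
              rw [DihedralGroup.inv_r, hl1, hl1]
              have : η ^ (i.val) * η ^ ((-i).val) = 1 := by
                rw [← pow_add]
                have : m ∣ i.val + (-i).val := by
                  rw [← ZMod.natCast_eq_zero_iff]; simp
                obtain ⟨t, ht⟩ := this
                rw [ht, pow_mul, hm1, one_pow]
              have h7 := hl (DihedralGroup.r i)
              rw [hl1] at h7
              have h8 : η ^ i.val ≠ 0 := fun h => by simp [h] at h7
              exact mul_left_cancel₀ h8 (this.trans h7.symm)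
            | sr i => rw [DihedralGroup.inv_sr]
          simp [h6]
        simp only [h5]
        rw [sum_dihedral]
        simp only [ho1, ho2]
        have h9 : ∑ i ∈ Finset.range m, R ^ i = ∑ i : ZMod m, R ^ i.val := by
          obtain ⟨n, hn⟩ : ∃ n, m = n + 1 := ⟨m - 1, by omega⟩
          clear * - hn
          subst hn
          rw [Finset.sum_range]; rfl
        rw [h9, add_mul, one_mul, Finset.mul_sum]
        simp [LinearMap.add_apply]
      rw [this, smul_smul]
      congr 1
      push_cast; field_simp
  have k1 := key 1 (by norm_num)
  have k2 := key (-1) (by norm_num)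
  rw [one_smul] at k1
  rw [neg_one_smul] at k2
  have e1 : LinearMap.ker (-ρ s - 1) = LinearMap.ker (ρ s + 1) := by
    rw [← LinearMap.ker_neg]; congr 1; abel
  have e2 : LinearMap.ker (-ρ s + 1) = LinearMap.ker (ρ s - 1) := by
    rw [← LinearMap.ker_neg]; congr 1; abel
  rw [e1, e2] at k2
  have htr := dih_trace R (ρ s) m hm0 hRm (by rw [← map_mul, hss, map_one]) (by
    rw [hR, smul_mul_assoc, smul_mul_smul_comm, ← map_mul, ← map_mul, hrsr, hη, one_smul])
  refine ⟨(Module.finrank ℂ (LinearMap.ker (R - 1) ⊓ LinearMap.ker (ρ s - 1) : Submodule ℂ V) : ℤ) -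
      Module.finrank ℂ (LinearMap.ker (R - 1) ⊓ LinearMap.ker (ρ s + 1) : Submodule ℂ V), ?_,
      Module.finrank ℂ (LinearMap.ker (R ^ (2 ^ q) + 1)), ?_, ?_⟩
  · push_cast
    rw [← htr, Finset.sum_mul, map_sum]
    congr 1
    apply Finset.sum_congr rfl
    intro i _
    rw [hRi, smul_mul_assoc, map_smul, ← map_mul]; rfl
  · have := trace_half (-R ^ (2 ^ q)) (by rw [neg_mul_neg, ← pow_add, ← two_mul, ← hm]; exact hRm)
    have e3 : LinearMap.ker (-R ^ (2 ^ q) - 1) = LinearMap.ker (R ^ (2 ^ q) + 1) := by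
      rw [← LinearMap.ker_neg]; congr 1; abel
    rw [e3] at this
    rw [← this, map_neg, hRi, map_smul]
    rfl
  · set x := Module.finrank ℂ (LinearMap.ker (R - 1) ⊓ LinearMap.ker (ρ s - 1) : Submodule ℂ V)
    set x' := Module.finrank ℂ (LinearMap.ker (R - 1) ⊓ LinearMap.ker (ρ s + 1) : Submodule ℂ V)
    zify at k1 k2
    rcases abs_cases ((x:ℤ) - x') with h | h <;> rw [h.1] <;> linarith

theorem k0_zero {G : Type} [Group G] [Fintype G] {V : Type} [AddCommGroup V] [Module ℂ V]
    [FiniteDimensional ℂ V] [Nontrivial V] (ρ : Representation ℂ G V) (hS : SchurRep ρ)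
    (c : ℕ) (hc : Nat.card G = c * Module.finrank ℂ V) (hodd : ¬ 2 ∣ c)
    (t : G) (ht : orderOf t = 2) : ρ.character t = 0 := by
  obtain ⟨O, h2, hz⟩ := exists_val2
  obtain ⟨b, hb, havg⟩ := lat_avg O ρ hS
  have hd : (Module.finrank ℂ V : ℂ) ≠ 0 := by exact_mod_cast (Module.finrank_pos (R := ℂ) (M := V)).ne'
  have htt : t * t = 1 := by rw [← pow_two, ← ht, pow_orderOf_eq_one]
  have hti : t⁻¹ = t := inv_eq_of_mul_eq_one_left htt
  have ht1 : t ≠ 1 := by intro h; rw [h, orderOf_one] at ht; omega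
  have hor : ∀ x ∈ Subgroup.zpowers t, x = 1 ∨ x = t := by
    intro x hx
    obtain ⟨i, hi⟩ := Subgroup.mem_zpowers_iff.mp hx
    have h2 : t ^ (2:ℤ) = 1 := by rw [zpow_two, htt]
    rcases Int.even_or_odd' i with ⟨j, rfl | rfl⟩
    · left; rw [← hi, zpow_mul, h2, one_zpow]
    · right; rw [← hi, zpow_add, zpow_mul, h2, one_zpow, zpow_one, one_mul]
  have hsum : ∀ F : Subgroup.zpowers t → V, ∑ h, F h = F 1 + F ⟨t, Subgroup.mem_zpowers t⟩ := by
    intro F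
    have h1 : (Finset.univ : Finset (Subgroup.zpowers t)) = {1, ⟨t, Subgroup.mem_zpowers t⟩} := by
      ext ⟨x, hx⟩
      simp only [Finset.mem_univ, Finset.mem_insert, Finset.mem_singleton, true_iff]
      rcases hor x hx with h | h
      · left; exact Subtype.ext h
      · right; exact Subtype.ext h
    rw [h1, Finset.sum_pair]
    intro h
    exact ht1 (congrArg Subtype.val h).symm
  have key : ∀ ε : ℂ, ε * ε = 1 → Module.finrank ℂ (LinearMap.ker (ε • ρ t - 1)) ≤
      Module.finrank ℂ (LinearMap.ker (ε • ρ t + 1)) := by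
    intro ε hε
    apply inv_half (b := b) h2
    · rw [smul_mul_smul_comm, hε, ← map_mul, htt]; simp
    · intro v hv hTv
      have hc0 : (c : ℂ) ≠ 0 := by
        intro h; apply hodd; have : c = 0 := by exact_mod_cast h
        simp [this]
      obtain ⟨y, hy, hy2⟩ := havg (Subgroup.zpowers t) (fun h => if (h : G) = 1 then 1 else ε) v hv (by
        rintro ⟨h, hh⟩
        simp only
        rcases hor h hh with rfl | rfl
        · simp
        · rw [if_neg ht1]
          conv_rhs => rw [← hTv]
          rw [LinearMap.smul_apply, smul_smul, hε, one_smul])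
      refine ⟨((c : ℤ) : ℂ)⁻¹ • y, lat_smul (odd_unit h2 hz c (by exact_mod_cast hodd)) hy, ?_⟩
      rw [hsum] at hy2
      simp only [if_neg ht1, hti] at hy2
      rw [map_smul, ← smul_add]
      have h4 : (Nat.card G : ℂ) / (Module.finrank ℂ V : ℂ) = c := by
        rw [hc]; push_cast; field_simp
      rw [h4] at hy2
      simp only [Subgroup.coe_one, if_true, one_smul, inv_one, map_one, Module.End.one_apply] at hy2
      rw [LinearMap.smul_apply, hy2, smul_smul]
      push_cast
      rw [inv_mul_cancel₀ hc0, one_smul]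
  have k1 := key 1 (by norm_num)
  have k2 := key (-1) (by norm_num)
  rw [one_smul] at k1
  rw [neg_one_smul] at k2
  have e1 : LinearMap.ker (-ρ t - 1) = LinearMap.ker (ρ t + 1) := by
    rw [← LinearMap.ker_neg]; congr 1; abel
  have e2 : LinearMap.ker (-ρ t + 1) = LinearMap.ker (ρ t - 1) := by
    rw [← LinearMap.ker_neg]; congr 1; abel
  rw [e1, e2] at k2
  rw [Representation.character, trace_inv _ (by rw [← map_mul, htt, map_one]), le_antisymm k1 k2, sub_self]

end PartL4

section PartM1

theorem cyc_compl {K : Type} [Group K] [Finite K] (x : K) (v : ℕ) (hv : 1 ≤ v) (hx : orderOf x = 2 ^ v)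
    (hK : ¬ 2 ^ (v + 1) ∣ Nat.card K) :
    ∃ N : Subgroup K, ¬ 2 ∣ Nat.card N ∧ Nat.card K = Nat.card N * 2 ^ v ∧
      ∀ y, ¬ 2 ∣ orderOf y → y ∈ N := by
  have hf : Fact (Nat.Prime 2) := ⟨Nat.prime_two⟩
  have hdvd : 2 ^ v ∣ Nat.card K := hx ▸ orderOf_dvd_natCard x
  have hfac : (Nat.card K).factorization 2 = v := by
    have h1 := (Nat.Prime.pow_dvd_iff_le_factorization Nat.prime_two Nat.card_pos.ne').mp hdvd
    have h2 := mt (Nat.Prime.pow_dvd_iff_le_factorization Nat.prime_two Nat.card_pos.ne').mpr hK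
    omega
  let P : Sylow 2 K := Sylow.ofCard (Subgroup.zpowers x) (by rw [hfac, Nat.card_zpowers, hx])
  have hPc : Nat.card P = 2 ^ v := by
    change Nat.card (Subgroup.zpowers x) = _
    rw [Nat.card_zpowers, hx]
  have hP : IsCyclic P := by
    change IsCyclic (Subgroup.zpowers x)
    infer_instance
  have hmin : (Nat.card K).minFac = 2 := by
    rw [Nat.minFac_eq_two_iff]; exact (dvd_pow_self 2 (by omega)).trans hdvd
  have hc := IsCyclic.isComplement' hmin hP
  set N := (MonoidHom.transferSylow P (hP.normalizer_le_centralizer hmin)).ker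
  have hcard : Nat.card N * 2 ^ v = Nat.card K := by rw [← hPc]; exact hc.card_mul_card
  refine ⟨N, ?_, hcard.symm, ?_⟩
  · intro h
    apply hK
    rw [← hcard, pow_succ, mul_comm]
    exact mul_dvd_mul_right h _
  · intro y hy
    have hidx : N.index = 2 ^ v := by
      have := N.card_mul_index
      rw [← hcard] at this
      exact Nat.eq_of_mul_eq_mul_left Nat.card_pos this
    have h1 := N.pow_index_mem y
    have h2 : (N.index).Coprime (orderOf y) := by
      rw [hidx]
      exact Nat.Coprime.pow_left _ ((Nat.Prime.coprime_iff_not_dvd Nat.prime_two).mpr hy)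
    obtain ⟨m, hm⟩ := exists_pow_eq_self_of_coprime h2
    rw [← hm]
    exact N.pow_mem h1 m

theorem cent_setup {G : Type} [Group G] [Fintype G] (r s : G) (v l : ℕ) (hr : orderOf r = 2 ^ v)
    (hsr : s * r * s⁻¹ = r⁻¹) (hG : ¬ 2 ^ (v + 2) ∣ Nat.card G) (hl : 2 ≤ l) (hlv : l ≤ v) (g : G)
    (hg : g = r ^ (2 ^ (v - l))) :
    orderOf g = 2 ^ l ∧ s * g * s⁻¹ = g⁻¹ ∧
    ∃ C N Ch : Subgroup G, (∀ x, x ∈ C ↔ x * g = g * x) ∧ N ≤ C ∧ C ≤ Ch ∧ r ∈ C ∧ s ∈ Ch ∧ ¬ 2 ∣ Nat.card N ∧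
      Nat.card C = Nat.card N * 2 ^ v ∧ Nat.card Ch = 2 * Nat.card C ∧ (∀ t ∈ Ch, t ∉ C → t * g * t⁻¹ = g⁻¹) ∧
      (∀ x, (∃ i : ℤ, ¬ 2 ∣ i ∧ x * g ^ i * x⁻¹ ∈ Subgroup.zpowers g) → x ∈ Ch) ∧
      (∀ x ∈ C, ¬ 2 ∣ orderOf x → x ∈ N) ∧ (∀ t ∈ Ch, ∀ x ∈ N, t * x * t⁻¹ ∈ N) := by
  have hord : orderOf g = 2 ^ l := by
    rw [hg, orderOf_pow, hr, Nat.gcd_eq_right (pow_dvd_pow _ (by omega)), Nat.pow_div (by omega) (by norm_num)]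
    congr 1; omega
  have hsg : s * g * s⁻¹ = g⁻¹ := by
    rw [hg, ← conj_pow, hsr, inv_pow]
  have hrg : r * g = g * r := by rw [hg, ← pow_succ, ← pow_succ']
  refine ⟨hord, hsg, ?_⟩
  let H := Subgroup.zpowers g
  let C := Subgroup.centralizer (H : Set G)
  let Ch := Subgroup.normalizer (H : Set G)
  have hC : ∀ x, x ∈ C ↔ x * g = g * x := by
    intro x
    rw [Subgroup.mem_centralizer_iff]
    constructor
    · intro h; exact (h g (Subgroup.mem_zpowers g)).symm
    · intro h y hy
      obtain ⟨i, rfl⟩ := Subgroup.mem_zpowers_iff.mp hy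
      have h' : Commute x g := h
      exact (h'.zpow_right i).eq.symm
  have hCCh : C ≤ Ch := Subgroup.centralizer_le_normalizer _
  have hrC : r ∈ C := (hC r).mpr hrg
  have hgen : ∀ x, x * g * x⁻¹ ∈ H → x ∈ Ch := by
    intro x hx
    apply Subgroup.mem_normalizer_fintype
    intro y hy
    obtain ⟨i, rfl⟩ := Subgroup.mem_zpowers_iff.mp hy
    rw [← conj_zpow]
    exact H.zpow_mem hx i
  have hsCh : s ∈ Ch := by
    apply hgen; rw [hsg]; exact H.inv_mem (Subgroup.mem_zpowers g)
  have hsC : s ∉ C := by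
    intro h
    rw [hC] at h
    rw [h, mul_assoc, mul_inv_cancel, mul_one] at hsg
    have : g ^ 2 = 1 := by rw [pow_two]; nth_rw 1 [hsg]; simp
    have := orderOf_dvd_of_pow_eq_one this
    rw [hord] at this
    have := Nat.le_of_dvd (by norm_num) this
    have : 2 ^ 2 ≤ 2 ^ l := Nat.pow_le_pow_right (by norm_num) hl
    omega
  -- index
  obtain ⟨i, hi⟩ : ∃ i, C.relIndex Ch = 2 ^ i := by
    have key := Subgroup.card_dvd_of_injective _ (QuotientGroup.kerLift_injective H.normalizerMonoidHom)
    rw [Subgroup.normalizerMonoidHom_ker, ← Subgroup.index, ← Subgroup.relIndex] at key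
    have hcyc : IsCyclic H := by infer_instance
    rw [hcyc.card_mulAut, Nat.card_zpowers, hord, Nat.totient_prime_pow Nat.prime_two (by omega)] at key
    simp only [Nat.add_one_sub_one, mul_one] at key
    obtain ⟨i, _, hi⟩ := (Nat.dvd_prime_pow Nat.prime_two).mp key
    exact ⟨i, hi⟩
  have hcard : Nat.card Ch = Nat.card C * 2 ^ i := by
    rw [← hi, ← (C.subgroupOf Ch).card_mul_index, Nat.card_congr (Subgroup.subgroupOfEquivOfLe hCCh).toEquiv]
    rfl
  have hvC : 2 ^ v ∣ Nat.card C := by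
    rw [← hr, ← Nat.card_zpowers]
    exact Subgroup.card_dvd_of_le (by rw [Subgroup.zpowers_le]; exact hrC)
  have hi0 : i ≠ 0 := by
    rintro rfl
    rw [pow_zero, Subgroup.relIndex_eq_one] at hi
    exact hsC (hi hsCh)
  have hi1 : i = 1 := by
    by_contra h
    apply hG
    refine dvd_trans ?_ (Subgroup.card_subgroup_dvd_card Ch)
    rw [hcard, pow_add]
    exact mul_dvd_mul hvC (pow_dvd_pow _ (by omega))
  rw [hi1, pow_one] at hcard hi
  have hCv : ¬ 2 ^ (v + 1) ∣ Nat.card C := by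
    intro h
    apply hG
    refine dvd_trans ?_ (Subgroup.card_subgroup_dvd_card Ch)
    rw [hcard, pow_succ]
    exact mul_dvd_mul_right h 2
  obtain ⟨N', hN1, hN2, hN3⟩ := cyc_compl (⟨r, hrC⟩ : C) v (by omega) (by rw [Subgroup.orderOf_mk, hr]) hCv
  let N := N'.map C.subtype
  have hNc : Nat.card N = Nat.card N' := Subgroup.card_map_of_injective (Subgroup.subtype_injective C)
  have hNC : N ≤ C := Subgroup.map_subtype_le N'
  have hodd : ∀ x ∈ C, ¬ 2 ∣ orderOf x → x ∈ N := by
    intro x hx h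
    exact ⟨⟨x, hx⟩, hN3 _ (by rwa [Subgroup.orderOf_mk]), rfl⟩
  refine ⟨C, N, Ch, hC, hNC, hCCh, hrC, hsCh, by rwa [hNc], by rw [hNc, hN2], by rw [hcard, mul_comm], ?_, ?_, hodd, ?_⟩
  · intro t ht htC
    have h1 := Subgroup.mul_mem_iff_of_index_two (H := C.subgroupOf Ch) hi (a := ⟨s, hsCh⟩⁻¹) (b := ⟨t, ht⟩)
    simp only [inv_mem_iff, Subgroup.mem_subgroupOf, Subgroup.coe_mul, Subgroup.coe_inv] at h1
    have h2 := (hC _).mp (h1.mpr (by simp [hsC, htC]))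
    calc t * g * t⁻¹ = s * (s⁻¹ * t * g) * t⁻¹ := by group
      _ = s * g * s⁻¹ := by rw [h2]; group
      _ = _ := hsg
  · rintro x ⟨i, hi2, hi3⟩
    apply hgen
    have hcop : IsCoprime i ((orderOf g : ℕ) : ℤ) := by
      rw [hord]
      push_cast
      apply IsCoprime.pow_right
      exact ((Int.prime_two.coprime_iff_not_dvd).mpr hi2).symm
    obtain ⟨a, b, hab⟩ := hcop
    have h1 : g = (g ^ i) ^ a := by
      rw [← zpow_mul]
      have : i * a = 1 - (orderOf g : ℤ) * b := by linarith
      rw [this, zpow_sub, zpow_mul, zpow_natCast, pow_orderOf_eq_one]; simp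
    have h2 : x * g * x⁻¹ = (x * g ^ i * x⁻¹) ^ a := by
      rw [conj_zpow, ← h1]
    rw [h2]
    exact H.zpow_mem hi3 a
  · intro t ht x hx
    have hxo : ¬ 2 ∣ orderOf x := by
      intro h
      apply hN1
      rw [← hNc]
      have := orderOf_dvd_natCard (⟨x, hx⟩ : N)
      rw [Subgroup.orderOf_mk] at this
      exact h.trans this
    apply hodd
    · have hn : (C.subgroupOf Ch).Normal := Subgroup.normal_of_index_eq_two hi
      exact hn.conj_mem ⟨x, hCCh (hNC hx)⟩ (hNC hx) ⟨t, ht⟩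
    · rw [← MulAut.conj_apply, MulEquiv.orderOf_eq]; exact hxo

end PartM1

section PartM2

structure CSetup {G : Type} [Group G] (r s g : G) (v l : ℕ) (C N Ch : Subgroup G) : Prop where
  hr : orderOf r = 2 ^ v
  hg : g = r ^ (2 ^ (v - l))
  hsr : s * r * s⁻¹ = r⁻¹
  hl : 2 ≤ l
  hlv : l ≤ v
  ord : orderOf g = 2 ^ l
  hsg : s * g * s⁻¹ = g⁻¹
  hC : ∀ x, x ∈ C ↔ x * g = g * x
  hNC : N ≤ C
  hCCh : C ≤ Ch
  hrC : r ∈ C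
  hsCh : s ∈ Ch
  hN2 : ¬ 2 ∣ Nat.card N
  hCN : Nat.card C = Nat.card N * 2 ^ v
  hChC : Nat.card Ch = 2 * Nat.card C
  hinv : ∀ t ∈ Ch, t ∉ C → t * g * t⁻¹ = g⁻¹
  hgen : ∀ x, (∃ i : ℤ, ¬ 2 ∣ i ∧ x * g ^ i * x⁻¹ ∈ Subgroup.zpowers g) → x ∈ Ch
  hodd : ∀ x ∈ C, ¬ 2 ∣ orderOf x → x ∈ N
  hconj : ∀ t ∈ Ch, ∀ x ∈ N, t * x * t⁻¹ ∈ N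

theorem csetup {G : Type} [Group G] [Fintype G] (r s : G) (v l : ℕ) (hr : orderOf r = 2 ^ v)
    (hsr : s * r * s⁻¹ = r⁻¹) (hG : ¬ 2 ^ (v + 2) ∣ Nat.card G) (hl : 2 ≤ l) (hlv : l ≤ v) :
    ∃ C N Ch : Subgroup G, CSetup r s (r ^ (2 ^ (v - l))) v l C N Ch := by
  obtain ⟨h1, h2, C, N, Ch, h3, h4, h5, h6, h7, h8, h9, h10, h11, h12, h13, h14⟩ :=
    cent_setup r s v l hr hsr hG hl hlv _ rfl
  exact ⟨C, N, Ch, ⟨hr, rfl, hsr, hl, hlv, h1, h2, h3, h4, h5, h6, h7, h8, h9, h10, h11, h12, h13, h14⟩⟩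

section
variable {G : Type} [Group G] [Fintype G] {r s g : G} {v l : ℕ} {C N Ch : Subgroup G}

theorem CSetup.comm (h : CSetup r s g v l C N Ch) (x : N) : Commute g (x : G) :=
  ((h.hC x).mp (h.hNC x.2)).symm

/-- exponent extracting the 2-part -/
theorem CSetup.ex (h : CSetup r s g v l C N Ch) : ∃ M : ℕ, ∀ (x : N) (i : ℤ), (g ^ i * (x : G)) ^ M = g ^ i := by
  have hcop : (2 ^ l).Coprime (Nat.card N) :=
    Nat.Coprime.pow_left _ ((Nat.Prime.coprime_iff_not_dvd Nat.prime_two).mpr h.hN2)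
  obtain ⟨M, hM1, hM2⟩ := Nat.chineseRemainder hcop 1 0
  refine ⟨M, fun x i => ?_⟩
  have h1 : (x : G) ^ M = 1 := by
    obtain ⟨c, hc⟩ := (Nat.modEq_zero_iff_dvd).mp hM2
    rw [hc, pow_mul, ← Subgroup.coe_pow, pow_card_eq_one']; simp
  have h2 : (g ^ i) ^ M = g ^ i := by
    rw [← zpow_natCast, ← zpow_mul, mul_comm, zpow_mul]
    congr 1
    rw [zpow_natCast]
    conv_rhs => rw [← pow_one g]
    rw [pow_eq_pow_iff_modEq, h.ord]; exact hM1
  rw [((h.comm x).zpow_left i).mul_pow, h1, h2, mul_one]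

theorem CSetup.norm_bound (h : CSetup r s g v l C N Ch) (f : G → ℝ) (hf0 : ∀ y, 0 ≤ f y)
    (hf : ∀ t y, f (t * y * t⁻¹) = f y) (hf1 : 0 < f 1) (hsum : ∑ y, f y = Nat.card G) :
    ∑ i ∈ (Finset.range (2 ^ l)).filter (fun i => ¬ 2 ∣ i), ∑ x : N, f (g ^ i * x) < 2 * (Nat.card C : ℝ) := by
  obtain ⟨M, hM⟩ := h.ex
  set I := (Finset.range (2 ^ l)).filter (fun i => ¬ 2 ∣ i) with hI
  set T : Finset (G × ℕ × N) := Finset.univ ×ˢ I ×ˢ Finset.univ with hT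
  set F : G × ℕ × N → G := fun p => p.1 * (g ^ p.2.1 * p.2.2) * p.1⁻¹ with hF
  have h1 : ∑ p ∈ T, f (F p) = (Nat.card G : ℝ) * ∑ i ∈ I, ∑ x : N, f (g ^ i * x) := by
    rw [hT, Finset.sum_product]
    simp only [hF, hf, Finset.sum_product]
    simp
  have hM' : ∀ (x : N) (i : ℕ), (g ^ i * (x : G)) ^ M = g ^ i := by
    intro x i
    have := hM x i
    rwa [zpow_natCast] at this
  have hfib : ∀ y, (T.filter (fun p => F p = y)).card ≤ Nat.card Ch := by
    intro y
    rcases Finset.eq_empty_or_nonempty (T.filter (fun p => F p = y)) with he | ⟨p0, hp0⟩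
    · rw [he]; simp
    · have hc : Nat.card Ch = (Finset.univ.filter (fun u => u ∈ Ch)).card := by
        rw [Nat.card_eq_fintype_card, Fintype.card_subtype]
      rw [hc]
      apply Finset.card_le_card_of_injOn (fun p => p0.1⁻¹ * p.1)
      · intro p hp
        simp only [Finset.coe_filter, Set.mem_ofPred_eq, Finset.mem_univ, true_and, hT, Finset.mem_filter,
          Finset.mem_product, and_true] at hp hp0 ⊢
        apply h.hgen
        refine ⟨p.2.1, ?_, ?_⟩
        · have := hp.1
          rw [hI, Finset.mem_filter] at this
          exact_mod_cast this.2
        · have h3 : p0.1⁻¹ * p.1 * (g ^ p.2.1 * p.2.2) * (p0.1⁻¹ * p.1)⁻¹ = g ^ p0.2.1 * p0.2.2 := by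
            have := hp.2.trans hp0.2.symm
            simp only [hF] at this
            have h4 : p0.1⁻¹ * p.1 * (g ^ p.2.1 * p.2.2) * (p0.1⁻¹ * p.1)⁻¹ =
              p0.1⁻¹ * (p.1 * (g ^ p.2.1 * p.2.2) * p.1⁻¹) * p0.1 := by group
            rw [h4, this]; group
          have h5 := congrArg (fun z => z ^ M) h3
          simp only [conj_pow, hM'] at h5
          rw [zpow_natCast, h5]
          exact Subgroup.npow_mem_zpowers g _
      · intro p hp q hq hpq
        simp only [Finset.coe_filter, Set.mem_ofPred_eq, hT,
          Finset.mem_product, hI, Finset.mem_filter, Finset.mem_univ, true_and, and_true, Finset.mem_range] at hp hq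
        have hpq1 : p.1 = q.1 := mul_left_cancel hpq
        have h3 := hp.2.trans hq.2.symm
        simp only [hF, hpq1] at h3
        have h4 := mul_left_cancel (mul_right_cancel h3)
        have h5 := congrArg (fun z => z ^ M) h4
        simp only [hM'] at h5
        have h6 : p.2.1 = q.2.1 := by
          apply pow_injOn_Iio_orderOf _ _ h5
          · rw [Set.mem_Iio, h.ord]; exact hp.1.1
          · rw [Set.mem_Iio, h.ord]; exact hq.1.1
        rw [h6] at h4
        exact Prod.ext hpq1 (Prod.ext h6 (Subtype.ext (mul_left_cancel h4)))
  have hne : ∀ p ∈ T, F p ≠ 1 := by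
    intro p hp h1
    simp only [hT, Finset.mem_product, hI, Finset.mem_filter, Finset.mem_univ, true_and, and_true] at hp
    have h2 : g ^ p.2.1 * p.2.2 = 1 := conj_eq_one_iff.mp h1
    have h3 := hM' p.2.2 p.2.1
    rw [h2, one_pow] at h3
    have h4 := orderOf_dvd_of_pow_eq_one h3.symm
    rw [h.ord] at h4
    exact hp.2 ((dvd_pow_self 2 (by have := h.hl; omega)).trans h4)
  have h2 : ∑ p ∈ T, f (F p) ≤ (Nat.card Ch : ℝ) * ∑ y ∈ Finset.univ.erase 1, f y := by
    rw [← Finset.sum_fiberwise_of_maps_to (t := Finset.univ.erase 1) (g := F)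
      (by intro p hp; simp [hne p hp]), Finset.mul_sum]
    apply Finset.sum_le_sum
    intro y _
    rw [Finset.sum_congr rfl (g := fun _ => f y) (by intro p hp; rw [(Finset.mem_filter.mp hp).2])]
    rw [Finset.sum_const, nsmul_eq_mul]
    exact mul_le_mul_of_nonneg_right (by exact_mod_cast hfib y) (hf0 y)
  have h3 := Finset.add_sum_erase Finset.univ f (Finset.mem_univ (1 : G))
  rw [hsum] at h3
  have hGp : (0:ℝ) < Nat.card G := by exact_mod_cast Nat.card_pos
  have hCp : (0:ℝ) < Nat.card Ch := by exact_mod_cast Nat.card_pos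
  have h4 : (Nat.card Ch : ℝ) = 2 * Nat.card C := by rw [h.hChC]; push_cast; ring
  rw [h1] at h2
  rw [← h4]
  have h5 : (Nat.card Ch : ℝ) * ∑ y ∈ Finset.univ.erase 1, f y < Nat.card Ch * Nat.card G := by
    apply mul_lt_mul_of_pos_left _ hCp; linarith
  have h6 := h2.trans_lt h5
  rw [mul_comm (Nat.card Ch : ℝ)] at h6
  exact lt_of_mul_lt_mul_left h6 hGp.le
end

end PartM2

section PartM3

theorem sub_char {G : Type} [Group G] [Fintype G] {V : Type} [AddCommGroup V] [Module ℂ V]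
    [FiniteDimensional ℂ V] (ρ : Representation ℂ G V) (e : Module.End ℂ V) (he : e * e = e)
    (hc : ∀ x, e * ρ x = ρ x * e) :
    ∃ σ : Representation ℂ G (LinearMap.range e), ∀ x, σ.character x = LinearMap.trace ℂ V (e * ρ x) := by
  have hmem : ∀ x, ∀ v ∈ LinearMap.range e, ρ x v ∈ LinearMap.range e := by
    rintro x _ ⟨w, rfl⟩
    exact ⟨ρ x w, congrArg (fun f => f w) (hc x)⟩
  have hid : ∀ v ∈ LinearMap.range e, e v = v := by
    rintro _ ⟨w, rfl⟩
    exact congrArg (fun f => f w) he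
  let σ : Representation ℂ G (LinearMap.range e) :=
    { toFun := fun x => (ρ x).restrict (hmem x)
      map_one' := by ext v; simp
      map_mul' := by intro x y; ext v; simp }
  refine ⟨σ, fun x => ?_⟩
  have hm2 : ∀ v, (e * ρ x) v ∈ LinearMap.range e := fun v => ⟨ρ x v, rfl⟩
  rw [← LinearMap.trace_restrict_eq_of_forall_mem _ _ hm2 (fun v _ => hm2 v)]
  unfold Representation.character
  congr 1
  ext v
  simp only [σ, LinearMap.restrict_apply, MonoidHom.coe_mk, OneHom.coe_mk, Module.End.mul_apply]
  exact (hid _ (hmem x v v.2)).symm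

theorem mult_nat {G : Type} [Group G] [Fintype G] {V : Type} [AddCommGroup V] [Module ℂ V]
    [FiniteDimensional ℂ V] (ρ : Representation ℂ G V) {φ : G → ℂ} (hφ : IsIrreducibleCharacter φ) :
    ∃ n : ℕ, ∑ x, φ x⁻¹ * ρ.character x = (Nat.card G : ℂ) * n := by
  obtain ⟨s, hs, hsum⟩ := char_decomp _ ρ le_rfl
  rw [← hsum]
  clear hsum
  induction s using Multiset.induction_on with
  | empty => exact ⟨0, by simp⟩
  | cons ψ s ih =>
    obtain ⟨n, hn⟩ := ih (fun f hf => hs f (Multiset.mem_cons_of_mem hf))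
    have h1 : ∑ x, φ x⁻¹ * ψ x = if ψ = φ then (Nat.card G : ℂ) else 0 := by
      rw [← irr_orth (hs ψ (Multiset.mem_cons_self _ _)) hφ]
      exact Finset.sum_congr rfl fun _ _ => mul_comm _ _
    refine ⟨(if ψ = φ then 1 else 0) + n, ?_⟩
    simp only [Multiset.sum_cons, Pi.add_apply, mul_add, Finset.sum_add_distrib, hn, h1]
    split_ifs <;> push_cast <;> ring

section
variable {G : Type} [Group G] [Fintype G] {V : Type} [AddCommGroup V] [Module ℂ V]
    [FiniteDimensional ℂ V] (ρ : Representation ℂ G V) (N : Subgroup G) (φ : N → ℂ)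

/-- `(1/|N|) ∑ φ(x⁻¹) tr(q x)` -/
noncomputable def mlt (q : Module.End ℂ V) : ℂ :=
  (Nat.card N : ℂ)⁻¹ * ∑ x : N, φ x⁻¹ * LinearMap.trace ℂ V (q * ρ x)

theorem mlt_smul (a : ℂ) (q : Module.End ℂ V) : mlt ρ N φ (a • q) = a * mlt ρ N φ q := by
  simp only [mlt, smul_mul_assoc, map_smul, smul_eq_mul, Finset.mul_sum]
  apply Finset.sum_congr rfl; intros; ring

theorem mlt_add (p q : Module.End ℂ V) : mlt ρ N φ (p + q) = mlt ρ N φ p + mlt ρ N φ q := by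
  simp only [mlt, add_mul, map_add, mul_add, Finset.sum_add_distrib]

theorem mlt_sum {α : Type*} (s : Finset α) (q : α → Module.End ℂ V) :
    mlt ρ N φ (∑ a ∈ s, q a) = ∑ a ∈ s, mlt ρ N φ (q a) := by
  induction s using Finset.induction_on with
  | empty => simp [mlt]
  | insert a s ha ih => rw [Finset.sum_insert ha, Finset.sum_insert ha, mlt_add, ih]

theorem mlt_nat (hφ : IsIrreducibleCharacter φ) (q : Module.End ℂ V) (hq : q * q = q)
    (hc : ∀ x : N, q * ρ x = ρ x * q) : ∃ n : ℕ, mlt ρ N φ q = n := by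
  obtain ⟨σ, hσ⟩ := sub_char (ρ.comp N.subtype) q hq hc
  obtain ⟨n, hn⟩ := mult_nat σ hφ
  refine ⟨n, ?_⟩
  have : (Nat.card N : ℂ) ≠ 0 := by exact_mod_cast Nat.card_pos.ne'
  rw [mlt, inv_mul_eq_iff_eq_mul₀ this, ← hn]
  apply Finset.sum_congr rfl
  intro x _
  rw [hσ]; rfl

/-- multiplicities of eigenvalues -/
theorem mlt_eig (hφ : IsIrreducibleCharacter φ) {g : G} {m : ℕ} (hm : 0 < m) (hg : g ^ m = 1)
    {ω : ℂ} (hω : IsPrimitiveRoot ω m) (hc : ∀ x : N, Commute g (x : G)) :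
    ∃ Y : ℤ → ℕ, (∀ j, mlt ρ N φ (eigProj ρ g m ω j) = Y j) ∧ (∀ j, Y (j + m) = Y j) ∧
      (∀ i : ℤ, mlt ρ N φ (ρ (g ^ i)) = ∑ j ∈ Finset.range m, ω ^ (i * j) * (Y j : ℂ)) ∧
      (∀ j : ℤ, (m : ℂ) * Y j = ∑ i ∈ Finset.range m, ω ^ (-((i : ℤ) * j)) * mlt ρ N φ (ρ (g ^ (i : ℤ)))) := by
  choose Y hY using fun j => mlt_nat ρ N φ hφ (eigProj ρ g m ω j) (eig_idem ρ hm hg hω j)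
    (fun x => (eig_comm ρ (ρ x) (by
      change ρ g * ρ x = ρ x * ρ g
      rw [← map_mul, ← map_mul, (hc x).eq]) j).eq)
  refine ⟨Y, hY, ?_, ?_, ?_⟩
  · intro j
    have : (Y (j + m) : ℂ) = Y j := by
      rw [← hY, ← hY, eig_per ρ hm hg hω (j + m) j (by simp)]
    exact_mod_cast this
  · intro i
    rw [← eig_sum ρ hm hg hω, mlt_sum]
    apply Finset.sum_congr rfl
    intro j _
    rw [mlt_smul, hY]
  · intro j
    rw [← hY, eigProj, mlt_smul, mlt_sum, ← mul_assoc, mul_inv_cancel₀ (by exact_mod_cast hm.ne'), one_mul]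
    apply Finset.sum_congr rfl
    intro i _
    rw [mlt_smul]

/-- extension by zero -/
noncomputable def zext : G → ℂ := fun y => if h : y ∈ N then φ ⟨y, h⟩ else 0

theorem zext_coe (x : N) : zext N φ x = φ x := by simp [zext]

def stabG (F : G → ℂ) : Subgroup G where
  carrier := {t | ∀ y, F (t * y * t⁻¹) = F y}
  one_mem' := by intro y; simp
  mul_mem' := by
    intro a b ha hb y
    have : a * b * y * (a * b)⁻¹ = a * (b * y * b⁻¹) * a⁻¹ := by group
    rw [this, ha, hb]
  inv_mem' := by
    intro a ha y
    have := ha (a⁻¹ * y * a⁻¹⁻¹)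
    rw [← this]; congr 1; group

theorem mem_stabG (F : G → ℂ) (t : G) : t ∈ stabG F ↔ ∀ y, F (t * y * t⁻¹) = F y := Iff.rfl

variable {N} in
def cj (t : G) (ht : ∀ x ∈ N, t * x * t⁻¹ ∈ N) (ht' : ∀ x ∈ N, t⁻¹ * x * t ∈ N) : N ≃* N where
  toFun x := ⟨t * x * t⁻¹, ht x x.2⟩
  invFun x := ⟨t⁻¹ * x * t, ht' x x.2⟩
  left_inv x := by ext; simp [mul_assoc]
  right_inv x := by ext; simp [mul_assoc]
  map_mul' x y := by ext; simp [mul_assoc]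

theorem stab_iff (t : G) (ht : ∀ x ∈ N, t * x * t⁻¹ ∈ N) (ht' : ∀ x ∈ N, t⁻¹ * x * t ∈ N) :
    t ∈ stabG (zext N φ) ↔ (fun x => φ (cj t ht ht' x)) = φ := by
  rw [mem_stabG]
  constructor
  · intro h
    ext x
    have := h x
    rw [zext_coe] at this
    rw [← this]
    exact (zext_coe N φ (cj t ht ht' x)).symm
  · intro h y
    by_cases hy : y ∈ N
    · have e1 := zext_coe N φ (cj t ht ht' ⟨y, hy⟩)
      have e2 := zext_coe N φ ⟨y, hy⟩
      exact e1.trans ((congrFun h ⟨y, hy⟩).trans e2.symm)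
    · have : t * y * t⁻¹ ∉ N := by
        intro hn
        apply hy
        have := ht' _ hn
        have h2 : t⁻¹ * (t * y * t⁻¹) * t = y := by group
        rwa [h2] at this
      simp [zext, hy, this]

theorem zext_integral (hφ : IsIrreducibleCharacter φ) (y : G) : IsIntegral ℤ (zext N φ y) := by
  unfold zext
  split_ifs with h
  · exact irr_integral hφ _
  · exact isIntegral_zero
end

end PartM3

section PartM4

section
variable {G : Type} [Group G] [Fintype G] {r s g : G} {v l : ℕ} {C N Ch : Subgroup G}

theorem CSetup.conj' (h : CSetup r s g v l C N Ch) (t : G) (ht : t ∈ Ch) : ∀ x ∈ N, t⁻¹ * x * t ∈ N := by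
  intro x hx
  have := h.hconj t⁻¹ (Ch.inv_mem ht) x hx
  rwa [inv_inv] at this

theorem CSetup.stab (h : CSetup r s g v l C N Ch) {φ : N → ℂ} (hφ : IsIrreducibleCharacter φ) :
    N ≤ stabG (zext N φ) ⊓ C ∧ ∃ d, l ≤ d ∧ d ≤ v ∧
      Nat.card ↥(stabG (zext N φ) ⊓ C) = Nat.card N * 2 ^ d := by
  have h1 : N ≤ stabG (zext N φ) ⊓ C := by
    intro x hx
    refine ⟨?_, h.hNC hx⟩
    have hxc := h.hCCh (h.hNC hx)
    change x ∈ stabG (zext N φ)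
    rw [stab_iff N φ x (h.hconj x hxc) (h.conj' x hxc)]
    ext y
    exact irr_conj hφ ⟨x, hx⟩ y
  have hg : g ∈ stabG (zext N φ) ⊓ C := by
    have hgC : g ∈ C := (h.hC g).mpr rfl
    refine ⟨?_, hgC⟩
    have hxc := h.hCCh hgC
    change g ∈ stabG (zext N φ)
    rw [stab_iff N φ g (h.hconj g hxc) (h.conj' g hxc)]
    ext y
    congr 1
    ext
    change g * y * g⁻¹ = y
    rw [(h.comm y).eq]; group
  refine ⟨h1, ?_⟩
  have hNpos : 0 < Nat.card N := Nat.card_pos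
  obtain ⟨q, hq⟩ := Subgroup.card_dvd_of_le h1
  have h2 : q ∣ 2 ^ v := by
    have := Subgroup.card_dvd_of_le (inf_le_right : stabG (zext N φ) ⊓ C ≤ C)
    rw [hq, h.hCN] at this
    exact Nat.dvd_of_mul_dvd_mul_left hNpos this
  obtain ⟨d, hd, rfl⟩ := (Nat.dvd_prime_pow Nat.prime_two).mp h2
  refine ⟨d, ?_, hd, hq⟩
  have h3 : orderOf g ∣ Nat.card ↥(stabG (zext N φ) ⊓ C) := by
    rw [← Nat.card_zpowers]
    exact Subgroup.card_dvd_of_le (by rwa [Subgroup.zpowers_le])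
  rw [h.ord, hq] at h3
  have hcop : (2 ^ l).Coprime (Nat.card N) :=
    Nat.Coprime.pow_left _ ((Nat.Prime.coprime_iff_not_dvd Nat.prime_two).mpr h.hN2)
  exact (Nat.pow_dvd_pow_iff_le_right (by norm_num)).mp (hcop.dvd_of_dvd_mul_left h3)

/-- norm of the sum of conjugates -/
theorem CSetup.phi_norm (h : CSetup r s g v l C N Ch) {φ : N → ℂ} (hφ : IsIrreducibleCharacter φ) :
    ∑ x : N, ‖∑ t : C, zext N φ (t * x * (t : G)⁻¹)‖ ^ 2 =
      (Nat.card N : ℝ) * Nat.card C * Nat.card ↥(stabG (zext N φ) ⊓ C) := by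
  have hC' : ∀ t : C, (t : G) ∈ Ch := fun t => h.hCCh t.2
  obtain ⟨c, hc⟩ : ∃ c : C → (N ≃* N), ∀ t x, ((c t x : N) : G) = t * x * (t : G)⁻¹ :=
    ⟨fun t => cj (t : G) (h.hconj t (hC' t)) (h.conj' t (hC' t)), fun t x => rfl⟩
  have hz : ∀ (t : C) (x : N), zext N φ (t * x * (t : G)⁻¹) = φ (c t x) := by
    intro t x; rw [← hc, zext_coe]
  have hir : ∀ t, IsIrreducibleCharacter (fun x => φ (c t x)) := fun t => irr_comp (c t) hφ
  have heq : ∀ t u : C, ((fun x => φ (c t x)) = (fun x => φ (c u x))) ↔ (((t * u⁻¹ : C) : G) ∈ stabG (zext N φ)) := by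
    intro t u
    rw [mem_stabG]
    constructor
    · intro he y
      by_cases hy : y ∈ N
      · have hy' : (u : G)⁻¹ * y * u ∈ N := h.conj' u (hC' u) y hy
        have := congrFun he ⟨_, hy'⟩
        simp only [← hz] at this
        convert this using 2 <;> push_cast <;> group
      · have hy' : ((t * u⁻¹ : C) : G) * y * ((t * u⁻¹ : C) : G)⁻¹ ∉ N := by
          intro hn
          apply hy
          have := h.conj' _ (hC' (t * u⁻¹)) _ hn
          convert this using 1; group
        simp only [zext, hy, hy', dite_false]
    · intro he
      ext x
      rw [← hz, ← hz, ← he (u * x * (u : G)⁻¹)]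
      congr 1; push_cast; group
  have key : ((∑ x : N, ‖∑ t : C, zext N φ (t * x * (t : G)⁻¹)‖ ^ 2 : ℝ) : ℂ) =
      (Nat.card N : ℂ) * Nat.card C * Nat.card ↥(stabG (zext N φ) ⊓ C) := by
    push_cast
    have e1 : ∀ x : N, ((‖∑ t : C, zext N φ (t * x * (t : G)⁻¹)‖ : ℂ)) ^ 2 =
        ∑ t : C, ∑ u : C, φ (c t x) * φ (c u x⁻¹) := by
      intro x
      rw [← Complex.mul_conj', map_sum, Finset.sum_mul_sum]
      simp only [hz, map_inv, irr_inv hφ]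
    simp only [e1]
    rw [Finset.sum_comm]
    have e2 : ∀ t : C, ∑ x : N, ∑ u : C, φ (c t x) * φ (c u x⁻¹) =
        (Nat.card N : ℂ) * Nat.card ↥(stabG (zext N φ) ⊓ C) := by
      intro t
      rw [Finset.sum_comm]
      have e3 : ∀ u : C, ∑ x : N, φ (c t x) * φ (c u x⁻¹) =
          if (((t * u⁻¹ : C) : G) ∈ stabG (zext N φ)) then (Nat.card N : ℂ) else 0 := by
        intro u
        have := irr_orth (hir t) (hir u)
        simp only [heq] at this
        exact this
      simp only [e3]
      rw [Fintype.sum_equiv ((Equiv.inv C).trans (Equiv.mulLeft t)) _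
        (fun w : C => if ((w : G) ∈ stabG (zext N φ)) then (Nat.card N : ℂ) else 0) (by intro u; rfl)]
      rw [← Finset.sum_filter, Finset.sum_const, nsmul_eq_mul, mul_comm]
      congr 2
      rw [← Fintype.card_subtype, ← Nat.card_eq_fintype_card]
      refine Nat.card_congr ⟨fun a => ⟨a.1.1, a.2, a.1.2⟩, fun a => ⟨⟨a.1, a.2.2⟩, a.2.1⟩, ?_, ?_⟩
      · intro a; rfl
      · intro a; rfl
    simp only [e2, Finset.sum_const, nsmul_eq_mul, Finset.card_univ, ← Nat.card_eq_fintype_card]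
    ring
  exact_mod_cast key

variable {V : Type} [AddCommGroup V] [Module ℂ V] [FiniteDimensional ℂ V]

theorem odd_sum {l : ℕ} (hl : 1 ≤ l) {ω : ℂ} (hω : IsPrimitiveRoot ω (2 ^ l)) (d : ℤ → ℂ) (Y : ℤ → ℂ)
    (hY : ∀ j : ℤ, ((2 ^ l : ℕ) : ℂ) * Y j = ∑ i ∈ Finset.range (2 ^ l), ω ^ (-((i : ℤ) * j)) * d i) (j : ℤ) :
    ∑ i ∈ (Finset.range (2 ^ l)).filter (fun i => ¬ 2 ∣ i), ω ^ (-((i : ℤ) * j)) * d i =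
      2 ^ (l - 1) * (Y j - Y (j + 2 ^ (l - 1))) := by
  have hω0 : ω ≠ 0 := hω.ne_zero (by positivity)
  have hm1 : ω ^ (2 ^ (l - 1)) = -1 := by
    have : (2 : ℕ) ^ l = 2 ^ (l - 1) * 2 := by rw [← pow_succ]; congr 1; omega
    exact (IsPrimitiveRoot.pow (by positivity) hω this).eq_neg_one_of_two_right
  have hz : ∀ i : ℕ, ω ^ (-((i : ℤ) * (j + 2 ^ (l - 1)))) = ω ^ (-((i : ℤ) * j)) * (if 2 ∣ i then 1 else -1) := by
    intro i
    have : -((i : ℤ) * (j + 2 ^ (l - 1))) = -((i : ℤ) * j) + ((2 ^ (l - 1) : ℕ) : ℤ) * (-i) := by push_cast; ring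
    rw [this, zpow_add₀ hω0, zpow_mul ω _ (-(i : ℤ)), zpow_natCast, hm1]
    congr 1
    rw [zpow_neg, zpow_natCast]
    split_ifs with hi
    · rw [(even_iff_two_dvd.mpr hi).neg_one_pow]; simp
    · rw [(Nat.not_even_iff_odd.mp (fun he => hi he.two_dvd)).neg_one_pow]; norm_num
  have h2 : ((2 ^ l : ℕ) : ℂ) = 2 * 2 ^ (l - 1) := by
    push_cast
    rw [← pow_succ']; congr 1; omega
  have e : 2 * ∑ i ∈ (Finset.range (2 ^ l)).filter (fun i => ¬ 2 ∣ i), ω ^ (-((i : ℤ) * j)) * d i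
      = 2 * (2 ^ (l - 1) * (Y j - Y (j + 2 ^ (l - 1)))) := by
    rw [← mul_assoc, ← h2, mul_sub, hY, hY, ← Finset.sum_sub_distrib, Finset.sum_filter, Finset.mul_sum]
    apply Finset.sum_congr rfl
    intro i _
    rw [hz]
    by_cases hi : 2 ∣ i <;> simp [hi] <;> ring
  exact mul_left_cancel₀ two_ne_zero e

theorem CSetup.bound (h : CSetup r s g v l C N Ch) (ρ : Representation ℂ G V)
    (hχ : IsIrreducibleCharacter ρ.character) {φ : N → ℂ} (hφ : IsIrreducibleCharacter φ)
    {ω : ℂ} (hω : IsPrimitiveRoot ω (2 ^ l)) (Y : ℤ → ℕ)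
    (hY : ∀ j : ℤ, ((2 ^ l : ℕ) : ℂ) * Y j = ∑ i ∈ Finset.range (2 ^ l), ω ^ (-((i : ℤ) * j)) * mlt ρ N φ (ρ (g ^ (i : ℤ))))
    (d : ℕ) (hd : Nat.card ↥(stabG (zext N φ) ⊓ C) = Nat.card N * 2 ^ d) (j : ℤ) :
    2 ^ l * ((Y j : ℤ) - Y (j + 2 ^ (l - 1))) ^ 2 < 2 ^ (d + 2) := by
  obtain ⟨I, hI⟩ : ∃ I, I = (Finset.range (2 ^ l)).filter (fun i => ¬ 2 ∣ i) := ⟨_, rfl⟩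
  obtain ⟨Φ, hΦ⟩ : ∃ Φ : N → ℂ, ∀ x, Φ x = ∑ t : C, zext N φ (t * x * (t : G)⁻¹) := ⟨_, fun _ => rfl⟩
  have hodd := odd_sum (by have := h.hl; omega) hω (fun i => mlt ρ N φ (ρ (g ^ i))) (fun j => (Y j : ℂ)) hY j
  rw [← hI] at hodd
  have hNpos : (0 : ℝ) < Nat.card N := by exact_mod_cast Nat.card_pos
  have hCpos : (0 : ℝ) < Nat.card C := by exact_mod_cast Nat.card_pos
  -- the key sum
  have e1 : ∀ i : ℕ, ∑ x : N, Φ x⁻¹ * ρ.character (g ^ i * x) =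
      (Nat.card C : ℂ) * Nat.card N * mlt ρ N φ (ρ (g ^ (i : ℤ))) := by
    intro i
    simp only [hΦ, Finset.sum_mul]
    rw [Finset.sum_comm]
    have : ∀ t : C, ∑ x : N, zext N φ (t * ((x⁻¹ : N) : G) * (t : G)⁻¹) * ρ.character (g ^ i * x) =
        Nat.card N * mlt ρ N φ (ρ (g ^ (i : ℤ))) := by
      intro t
      have ht := h.hCCh t.2
      rw [mlt, ← mul_assoc, mul_inv_cancel₀ (by exact_mod_cast hNpos.ne'), one_mul]
      refine Fintype.sum_equiv (cj (t : G) (h.hconj t ht) (h.conj' t ht)).toEquiv _ _ ?_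
      intro x
      have a1 := zext_coe N φ (cj (t : G) (h.hconj t ht) (h.conj' t ht) x⁻¹)
      have a2 : (cj (t : G) (h.hconj t ht) (h.conj' t ht)).toEquiv x = cj (t : G) (h.hconj t ht) (h.conj' t ht) x := rfl
      rw [a2, ← map_inv, ← a1]
      congr 1
      rw [← map_mul, zpow_natCast]
      change _ = ρ.character _
      have a3 : g ^ i * ((cj (t : G) (h.hconj t ht) (h.conj' t ht) x : N) : G) = t * (g ^ i * x) * (t : G)⁻¹ := by
        change g ^ i * (t * x * (t : G)⁻¹) = _
        have : (t : G) * g ^ i = g ^ i * t := (Commute.pow_right ((h.hC t).mp t.2 : Commute (t : G) g) i).eq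
        rw [← mul_assoc (t : G) (g ^ i), this]; group
      rw [a3, Representation.char_conj]
    simp only [this, Finset.sum_const, nsmul_eq_mul, Finset.card_univ, ← Nat.card_eq_fintype_card]
    ring
  have hT : ∑ p ∈ I ×ˢ (Finset.univ : Finset N), (Φ p.2⁻¹) * (ω ^ (-((p.1 : ℤ) * j)) * ρ.character (g ^ p.1 * p.2)) =
      (Nat.card C : ℂ) * Nat.card N * (2 ^ (l - 1) * (Y j - Y (j + 2 ^ (l - 1)))) := by
    rw [Finset.sum_product, ← hodd, Finset.mul_sum]
    apply Finset.sum_congr rfl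
    intro i _
    rw [mul_left_comm, ← e1, Finset.mul_sum]
    apply Finset.sum_congr rfl
    intro x _
    ring
  have hcs := Finset.sum_mul_sq_le_sq_mul_sq (I ×ˢ (Finset.univ : Finset N)) (fun p => ‖Φ p.2⁻¹‖)
    (fun p => ‖ρ.character (g ^ p.1 * p.2)‖)
  have hωn : ‖ω‖ = 1 := hω.norm'_eq_one (by positivity)
  have hle : (Nat.card C : ℝ) * Nat.card N * (2 ^ (l - 1) * |(Y j : ℝ) - Y (j + 2 ^ (l - 1))|) ≤
      ∑ p ∈ I ×ˢ (Finset.univ : Finset N), ‖Φ p.2⁻¹‖ * ‖ρ.character (g ^ p.1 * p.2)‖ := by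
    have := norm_sum_le (I ×ˢ (Finset.univ : Finset N)) (fun p => (Φ p.2⁻¹) * (ω ^ (-((p.1 : ℤ) * j)) * ρ.character (g ^ p.1 * p.2)))
    rw [hT] at this
    simp only [norm_mul, norm_zpow, hωn, one_zpow, one_mul] at this
    refine le_trans (le_of_eq ?_) this
    have : ((Y j : ℂ) - Y (j + 2 ^ (l - 1))) = (((Y j : ℝ) - Y (j + 2 ^ (l - 1)) : ℝ) : ℂ) := by push_cast; rfl
    rw [this, Complex.norm_real]
    simp
  have hcardI : I.card = 2 ^ (l - 1) := by
    rw [hI]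
    have h1 := Finset.card_filter_add_card_filter_not (s := Finset.range (2 ^ l)) (fun i => 2 ∣ i)
    have h2 : ((Finset.range (2 ^ l)).filter (fun i => 2 ∣ i)).card = 2 ^ (l - 1) := by
      have : (Finset.range (2 ^ l)).filter (fun i => 2 ∣ i) = (Finset.range (2 ^ (l - 1))).image (fun i => 2 * i) := by
        have hp : 2 ^ l = 2 * 2 ^ (l - 1) := by
          rw [← pow_succ']; congr 1; have := h.hl; omega
        ext i
        simp only [Finset.mem_filter, Finset.mem_range, Finset.mem_image, hp]
        constructor
        · rintro ⟨a, b, rfl⟩; exact ⟨b, by omega, rfl⟩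
        · rintro ⟨b, hb, rfl⟩; exact ⟨by omega, by simp⟩
      rw [this, Finset.card_image_of_injective _ (by intro a b; simp), Finset.card_range]
    have hp : 2 ^ l = 2 * 2 ^ (l - 1) := by
      rw [← pow_succ']; congr 1; have := h.hl; omega
    rw [Finset.card_range] at h1
    omega
  have hA : ∑ p ∈ I ×ˢ (Finset.univ : Finset N), ‖Φ p.2⁻¹‖ ^ 2 =
      2 ^ (l - 1) * ((Nat.card N : ℝ) * Nat.card C * (Nat.card N * 2 ^ d)) := by
    have hp := h.phi_norm hφ
    rw [hd] at hp
    push_cast at hp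
    rw [Finset.sum_product]
    simp only
    rw [Finset.sum_const, hcardI, nsmul_eq_mul, ← hp]
    push_cast
    congr 1
    rw [Fintype.sum_equiv (Equiv.inv N) (fun x => ‖Φ x⁻¹‖ ^ 2) (fun x => ‖Φ x‖ ^ 2) (fun x => rfl)]
    simp only [hΦ]
  have hB : ∑ p ∈ I ×ˢ (Finset.univ : Finset N), ‖ρ.character (g ^ p.1 * p.2)‖ ^ 2 < 2 * (Nat.card C : ℝ) := by
    rw [Finset.sum_product, hI]
    refine h.norm_bound (fun y => ‖ρ.character y‖ ^ 2) (fun y => by positivity) ?_ ?_ ?_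
    · intro t y
      simp only [Representation.char_conj]
    · obtain ⟨n, hn, _, h1⟩ := irr_degree hχ
      rw [h1]
      have : (0 : ℝ) < n := by exact_mod_cast hn
      simp only [Complex.norm_natCast]; positivity
    · have := irr_norm hχ
      simp only [char_mul_inv] at this
      exact_mod_cast this
  have hApos : 0 < ∑ p ∈ I ×ˢ (Finset.univ : Finset N), ‖Φ p.2⁻¹‖ ^ 2 := by
    rw [hA]; positivity
  have hfin : ((Nat.card C : ℝ) * Nat.card N * (2 ^ (l - 1) * |(Y j : ℝ) - Y (j + 2 ^ (l - 1))|)) ^ 2 <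
      (2 ^ (l - 1) * ((Nat.card N : ℝ) * Nat.card C * (Nat.card N * 2 ^ d))) * (2 * (Nat.card C : ℝ)) := by
    calc _ ≤ _ := pow_le_pow_left₀ (by positivity) hle 2
      _ ≤ _ := hcs
      _ < _ := by
        rw [← hA]; exact mul_lt_mul_of_pos_left hB hApos
  have h3 : (2 : ℝ) ^ (l - 1) * ((Y j : ℝ) - Y (j + 2 ^ (l - 1))) ^ 2 < 2 * 2 ^ d := by
    have hpos : 0 < ((Nat.card C : ℝ) * Nat.card N) ^ 2 * 2 ^ (l - 1) := by positivity
    rw [mul_pow _ (2 ^ (l - 1) * _), mul_pow (2 ^ (l - 1)), sq_abs] at hfin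
    refine lt_of_mul_lt_mul_left (a := ((Nat.card C : ℝ) * Nat.card N) ^ 2 * 2 ^ (l - 1)) ?_ hpos.le
    calc _ = ((Nat.card C : ℝ) * Nat.card N) ^ 2 * ((2 ^ (l - 1)) ^ 2 * ((Y j : ℝ) - Y (j + 2 ^ (l - 1))) ^ 2) := by ring
      _ < _ := hfin
      _ = _ := by ring
  have h4 : (2 : ℤ) ^ (l - 1) * ((Y j : ℤ) - Y (j + 2 ^ (l - 1))) ^ 2 < 2 * 2 ^ d := by exact_mod_cast h3
  have h5 : (2 : ℤ) ^ l = 2 * 2 ^ (l - 1) := by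
    rw [← pow_succ']; congr 1; have := h.hl; omega
  rw [h5, pow_add]
  nlinarith
end

end PartM4

section PartM5

theorem cyc_int {l : ℕ} {ω : ℂ} (hω : IsPrimitiveRoot ω (2 ^ l)) (β : ℂ)
    (hβ : β ∈ IntermediateField.adjoin ℚ {ω}) (hi : IsIntegral ℤ β) :
    ∃ p : Polynomial ℤ, β = Polynomial.aeval ω p := by
  have : NeZero ((2 : ℕ) ^ l) := ⟨by positivity⟩
  have hfact : Fact (Nat.Prime 2) := ⟨Nat.prime_two⟩
  have hcyc : IsCyclotomicExtension {2 ^ l} ℚ (IntermediateField.adjoin ℚ {ω}) := by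
    change IsCyclotomicExtension {2 ^ l} ℚ (IntermediateField.adjoin ℚ {ω}).toSubalgebra
    rw [IntermediateField.adjoin_simple_toSubalgebra_of_isAlgebraic
      ((hω.isIntegral (by positivity)).tower_top (A := ℚ)).isAlgebraic]
    exact hω.adjoin_isCyclotomicExtension ℚ
  let K := IntermediateField.adjoin ℚ {ω}
  let ζ : K := ⟨ω, IntermediateField.mem_adjoin_simple_self ℚ ω⟩
  have hζ : IsPrimitiveRoot ζ (2 ^ l) := by
    apply IsPrimitiveRoot.of_map_of_injective (f := algebraMap K ℂ) (hf := (algebraMap K ℂ).injective)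
    exact hω
  have hic := IsCyclotomicExtension.Rat.isIntegralClosure_adjoin_singleton_of_prime_pow hζ
  have h1 : IsIntegral ℤ (⟨β, hβ⟩ : K) := by
    have : IsIntegral ℤ (algebraMap K ℂ ⟨β, hβ⟩) := hi
    exact (isIntegral_algebraMap_iff (algebraMap K ℂ).injective).mp this
  obtain ⟨y, hy⟩ := hic.isIntegral_iff.mp h1
  have h2 : (⟨β, hβ⟩ : K) ∈ Algebra.adjoin ℤ ({ζ} : Set K) := by rw [← hy]; exact y.2
  rw [Algebra.adjoin_singleton_eq_range_aeval] at h2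
  obtain ⟨p, hp⟩ := h2
  refine ⟨p, ?_⟩
  have h3 := congrArg (algebraMap K ℂ) hp
  have h4 : algebraMap K ℂ (Polynomial.aeval ζ p) = Polynomial.aeval ω p :=
    (Polynomial.aeval_algebraMap_apply ℂ ζ p).symm
  exact (h4.symm.trans h3).symm

theorem cyc_coeff {l : ℕ} (hl : 1 ≤ l) {ω : ℂ} (hω : IsPrimitiveRoot ω (2 ^ l)) (a : ℕ → ℤ) (M : ℤ) (hM : M ≠ 0)
    (hi : IsIntegral ℤ ((∑ j ∈ Finset.range (2 ^ (l - 1)), (a j : ℂ) * ω ^ j) / (M : ℂ))) :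
    ∀ j < 2 ^ (l - 1), M ∣ a j := by
  obtain ⟨p, hp⟩ := cyc_int hω _ (by
    have hm : ω ∈ IntermediateField.adjoin ℚ {ω} := IntermediateField.mem_adjoin_simple_self ℚ ω
    apply div_mem
    · apply sum_mem
      intro j _
      exact mul_mem (intCast_mem _ _) (pow_mem hm _)
    · exact intCast_mem _ _) hi
  have hpos : 0 < 2 ^ l := by positivity
  have hM' : (M : ℂ) ≠ 0 := by exact_mod_cast hM
  let q : Polynomial ℤ := ∑ j ∈ Finset.range (2 ^ (l - 1)), Polynomial.monomial j (a j)
  have hq : Polynomial.aeval ω (q - M • p) = 0 := by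
    rw [map_sub, map_zsmul, ← hp, zsmul_eq_mul, mul_div_cancel₀ _ hM']
    simp [q, map_sum, Polynomial.aeval_monomial]
  have hdvd : Polynomial.cyclotomic (2 ^ l) ℤ ∣ q - M • p := by
    rw [Polynomial.cyclotomic_eq_minpoly hω hpos]
    exact minpoly.isIntegrallyClosed_dvd (hω.isIntegral hpos) hq
  have hmon := Polynomial.cyclotomic.monic (2 ^ l) ℤ
  have h0 := (Polynomial.modByMonic_eq_zero_iff_dvd hmon).mpr hdvd
  rw [Polynomial.sub_modByMonic, Polynomial.smul_modByMonic] at h0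
  have hdeg : q %ₘ Polynomial.cyclotomic (2 ^ l) ℤ = q := by
    rw [Polynomial.modByMonic_eq_self_iff hmon]
    rw [Polynomial.degree_cyclotomic, Nat.totient_prime_pow Nat.prime_two (by omega)]
    refine lt_of_le_of_lt (Polynomial.degree_sum_le _ _) ?_
    rw [Finset.sup_lt_iff (by exact WithBot.bot_lt_coe _)]
    intro j hj
    refine lt_of_le_of_lt (Polynomial.degree_monomial_le _ _) ?_
    have := Finset.mem_range.mp hj
    norm_num
    exact_mod_cast this
  rw [hdeg, sub_eq_zero] at h0
  intro j hj
  have h1 := congrArg (fun f => Polynomial.coeff f j) h0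
  simp only [q, Polynomial.finsetSum_coeff, Polynomial.coeff_monomial, Polynomial.coeff_smul] at h1
  rw [Finset.sum_ite_eq' , if_pos (Finset.mem_range.mpr hj)] at h1
  exact ⟨_, h1⟩

theorem half_sum {l : ℕ} (hl : 1 ≤ l) {ω : ℂ} (hω : IsPrimitiveRoot ω (2 ^ l)) (Y : ℤ → ℂ) (i : ℤ) (hi : ¬ 2 ∣ i) :
    ∑ j ∈ Finset.range (2 ^ l), ω ^ (i * (j : ℤ)) * Y j =
    ∑ j ∈ Finset.range (2 ^ (l - 1)), ω ^ (i * (j : ℤ)) * (Y j - Y (j + 2 ^ (l - 1))) := by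
  have hω0 : ω ≠ 0 := hω.ne_zero (by positivity)
  have h2 : (2 : ℕ) ^ l = 2 ^ (l - 1) + 2 ^ (l - 1) := by
    rw [← two_mul, ← pow_succ']; congr 1; omega
  have hm1 : ω ^ (2 ^ (l - 1)) = -1 := by
    have : (2 : ℕ) ^ l = 2 ^ (l - 1) * 2 := by omega
    exact (IsPrimitiveRoot.pow (by positivity) hω this).eq_neg_one_of_two_right
  conv_lhs => rw [h2]
  rw [Finset.sum_range_add, ← Finset.sum_add_distrib]
  apply Finset.sum_congr rfl
  intro j _
  have : ω ^ (i * ((2 ^ (l - 1) + j : ℕ) : ℤ)) = - ω ^ (i * (j : ℤ)) := by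
    have e : i * ((2 ^ (l - 1) + j : ℕ) : ℤ) = ((2 ^ (l - 1) : ℕ) : ℤ) * i + i * j := by push_cast; ring
    rw [e, zpow_add₀ hω0, zpow_mul, zpow_natCast, hm1]
    have : Odd i := Int.not_even_iff_odd.mp (fun he => hi he.two_dvd)
    rw [this.neg_one_zpow]; ring
  rw [this]
  push_cast
  rw [add_comm ((2 : ℤ) ^ (l - 1))]
  ring

section
variable {G : Type} [Group G] [Fintype G] {r s g : G} {v l : ℕ} {C N Ch : Subgroup G}
variable {V : Type} [AddCommGroup V] [Module ℂ V] [FiniteDimensional ℂ V] [Nontrivial V]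

theorem zext_sum (φ : N → ℂ) (f : G → ℂ) : ∑ y, zext N φ y * f y = ∑ x : N, φ x * f x := by
  have h1 : ∑ y, zext N φ y * f y = ∑ y ∈ Finset.univ.filter (fun y => y ∈ N), zext N φ y * f y := by
    rw [Finset.sum_filter]
    apply Finset.sum_congr rfl
    intro y _
    by_cases hy : y ∈ N <;> simp [zext, hy]
  rw [h1, Finset.sum_subtype (p := fun y => y ∈ N) (Finset.univ.filter (fun y => y ∈ N)) (by simp)]
  apply Finset.sum_congr rfl
  intro x _
  rw [zext_coe]

theorem mlt_integral (ρ : Representation ℂ G V) (hS : SchurRep ρ) (c : ℕ)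
    (hc : Nat.card G = c * Module.finrank ℂ V) {φ : N → ℂ} (hφ : IsIrreducibleCharacter φ)
    (w : G) (S : Subgroup G) (hw : ∀ t ∈ S, t * w = w * t) (hSs : S ≤ stabG (zext N φ)) (e : ℕ)
    (hSc : Nat.card S = Nat.card N * e) :
    IsIntegral ℤ ((c : ℂ) * mlt ρ N φ (ρ w) / e) := by
  have hn : (Module.finrank ℂ V : ℂ) ≠ 0 := by
    exact_mod_cast (Module.finrank_pos (R := ℂ) (M := V)).ne'
  have hN : (Nat.card N : ℂ) ≠ 0 := by exact_mod_cast Nat.card_pos.ne'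
  have h1 := sum_conj_integral ρ hS (fun y => zext N φ (w⁻¹ * y)⁻¹) S (by
    intro t ht y
    have h2 := hSs (S.inv_mem ht) (w⁻¹ * y)⁻¹
    rw [← h2]
    congr 1
    have h3 : w⁻¹ * t⁻¹ = t⁻¹ * w⁻¹ := by
      rw [← mul_inv_rev, ← mul_inv_rev, hw t ht]
    rw [← mul_assoc, ← mul_assoc, h3]; group) (fun y => zext_integral N φ hφ _)
  convert h1 using 1
  have h2 : ∑ y, zext N φ (w⁻¹ * y)⁻¹ * ρ.character y = Nat.card N * mlt ρ N φ (ρ w) := by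
    rw [mlt, mul_inv_cancel_left₀ hN]
    rw [Fintype.sum_equiv (Equiv.mulLeft w⁻¹ |>.trans (Equiv.inv G)) _
      (fun z => zext N φ z * ρ.character (w * z⁻¹)) (by intro y; simp), zext_sum]
    rw [← Equiv.sum_comp (Equiv.inv N)]
    apply Finset.sum_congr rfl
    intro x _
    simp [Representation.character]
  rw [h2, hc, hSc]
  push_cast
  by_cases he : (e : ℂ) = 0
  · simp [he]
  field_simp

theorem two_pow_dvd_of {c k d : ℕ} {D : ℤ} (hk : ¬ 2 ^ (k + 1) ∣ c) (h : (2 : ℤ) ^ d ∣ c * D) : (2 : ℤ) ^ (d - k) ∣ D := by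
  have hc0 : c ≠ 0 := by rintro rfl; simp at hk
  obtain ⟨k', c', hc', hcc⟩ := Nat.exists_eq_two_pow_mul_odd hc0
  have hk' : k' ≤ k := by
    by_contra hlt
    exact hk (hcc ▸ Dvd.dvd.mul_right (pow_dvd_pow 2 (by omega)) _)
  by_cases hd : d ≤ k'
  · have : d - k = 0 := by omega
    simp [this]
  have h1 : (2 : ℤ) ^ (d - k') ∣ c' * D := by
    have h2 : (2 : ℤ) ^ d = 2 ^ k' * 2 ^ (d - k') := by rw [← pow_add]; congr 1; omega
    rw [hcc, h2] at h
    push_cast at h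
    rw [mul_assoc] at h
    exact Int.dvd_of_mul_dvd_mul_left (by positivity) h
  have h3 : IsCoprime ((2 : ℤ) ^ (d - k')) (c' : ℤ) := by
    apply IsCoprime.pow_left
    rw [Int.isCoprime_iff_gcd_eq_one]
    have := (Nat.coprime_two_left).mpr hc'
    exact_mod_cast this
  exact (pow_dvd_pow 2 (by omega)).trans (h3.dvd_of_dvd_mul_left h1)

theorem CSetup.vanish (h : CSetup r s g v l C N Ch) (ρ : Representation ℂ G V) (hS : SchurRep ρ)
    (hχ : IsIrreducibleCharacter ρ.character) (c k : ℕ) (hc : Nat.card G = c * Module.finrank ℂ V)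
    (hk : ¬ 2 ^ (k + 1) ∣ c) (hkl : k + 1 ≤ l) (i : ℤ) (hi : ¬ 2 ∣ i) (x : N) :
    ρ.character (g ^ i * x) = 0 := by
  have hl := h.hl
  have hω : IsPrimitiveRoot (Complex.exp (2 * Real.pi * Complex.I / (2 ^ l : ℕ))) (2 ^ l) :=
    Complex.isPrimitiveRoot_exp _ (by positivity)
  obtain ⟨ω, hωd⟩ : ∃ ω, ω = Complex.exp (2 * Real.pi * Complex.I / (2 ^ l : ℕ)) := ⟨_, rfl⟩
  rw [← hωd] at hω
  have hN : (Nat.card N : ℂ) ≠ 0 := by exact_mod_cast Nat.card_pos.ne'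
  have key : ∀ φ : N → ℂ, IsIrreducibleCharacter φ → mlt ρ N φ (ρ (g ^ i)) = 0 := by
    intro φ hφ
    obtain ⟨Y, hY1, hY2, hY3, hY4⟩ := mlt_eig ρ N φ hφ (by positivity) (by rw [← h.ord]; exact pow_orderOf_eq_one g) hω h.comm
    obtain ⟨hNS, d, hld, hdv, hd⟩ := h.stab hφ
    have hB := h.bound ρ hχ hφ hω Y hY4 d hd
    have hI := mlt_integral ρ hS c hc hφ g (stabG (zext N φ) ⊓ C) (fun t ht => (h.hC t).mp ht.2) inf_le_left _ hd
    have h1 : mlt ρ N φ (ρ g) = ∑ j ∈ Finset.range (2 ^ (l - 1)), ω ^ (1 * (j : ℤ)) * ((Y j : ℂ) - Y (j + 2 ^ (l - 1))) := by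
      have := hY3 1
      rw [zpow_one] at this
      rw [this, half_sum (by omega) hω (fun j => (Y j : ℂ)) 1 (by norm_num)]
    have hdv := cyc_coeff (by omega) hω (fun j => (c : ℤ) * ((Y j : ℤ) - Y (j + 2 ^ (l - 1)))) (2 ^ d) (by positivity) (by
      convert hI using 1
      rw [h1, Finset.mul_sum]
      push_cast
      congr 1
      apply Finset.sum_congr rfl
      intro j _
      rw [one_mul, zpow_natCast]; ring)
    have hz : ∀ j < 2 ^ (l - 1), (Y (j : ℕ) : ℤ) - Y (j + 2 ^ (l - 1)) = 0 := by
      intro j hj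
      obtain ⟨q, hq⟩ := two_pow_dvd_of hk (hdv j hj)
      have hb := hB j
      by_contra hne
      rw [hq] at hb hne
      have hq0 : q ≠ 0 := by rintro rfl; simp at hne
      have hq2 : 1 ≤ q ^ 2 := by
        have : 0 < q ^ 2 := by positivity
        omega
      have : (2 : ℤ) ^ (d + 2) ≤ 2 ^ l * (2 ^ (d - k) * q) ^ 2 := by
        calc (2 : ℤ) ^ (d + 2) ≤ 2 ^ (l + (d - k) * 2) := pow_le_pow_right₀ (by norm_num) (by omega)
          _ = 2 ^ l * (2 ^ (d - k)) ^ 2 * 1 := by rw [pow_add, pow_mul]; ring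
          _ ≤ 2 ^ l * (2 ^ (d - k)) ^ 2 * q ^ 2 := by gcongr
          _ = _ := by ring
      omega
    rw [hY3 i, half_sum (by omega) hω (fun j => (Y j : ℂ)) i hi]
    apply Finset.sum_eq_zero
    intro j hj
    have := hz j (Finset.mem_range.mp hj)
    have h2 : ((Y j : ℂ) - Y (j + 2 ^ (l - 1))) = 0 := by exact_mod_cast this
    rw [h2, mul_zero]
  have := irr_complete (θ := fun x : N => ρ.character (g ^ i * x)) (by
    intro y z
    have hcm := ((h.comm y).zpow_left i).eq
    have : g ^ i * ((y * z * y⁻¹ : N) : G) = y * (g ^ i * z) * (y : G)⁻¹ := by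
      push_cast
      rw [← mul_assoc (y : G) (g ^ i), ← hcm]; group
    rw [this, Representation.char_conj]) (by
    intro φ hφ
    have := key φ hφ
    rw [mlt, mul_eq_zero, or_iff_right (inv_ne_zero hN)] at this
    rw [← this]
    apply Finset.sum_congr rfl
    intro x _
    rw [mul_comm, ← map_mul]; rfl)
  exact congrFun this x
end

end PartM5

section PartM6

structure GSetup {G : Type} [Group G] (r s : G) (v : ℕ) : Prop where
  hr : orderOf r = 2 ^ v
  hsr : s * r * s⁻¹ = r⁻¹
  hs : s * s = 1
  hG : ¬ 2 ^ (v + 2) ∣ Nat.card G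
  hfus : ∀ (u : G) (l : ℕ), 2 ≤ l → orderOf u = 2 ^ l → ∃ (t : G) (i : ℤ), t * u * t⁻¹ = r ^ i

section
variable {G : Type} [Group G] [Fintype G] {r s g : G} {v l : ℕ} {C N Ch : Subgroup G}
variable {V : Type} [AddCommGroup V] [Module ℂ V] [FiniteDimensional ℂ V] [Nontrivial V]

theorem two_part (y : G) : ∃ (l : ℕ) (u x : G), 2 ^ l ∣ orderOf y ∧ ¬ 2 ^ (l + 1) ∣ orderOf y ∧
    y = u * x ∧ Commute u x ∧ orderOf u = 2 ^ l ∧ ¬ 2 ∣ orderOf x := by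
  have hpos : orderOf y ≠ 0 := (orderOf_pos y).ne'
  obtain ⟨l, o, ho, hlo⟩ := Nat.exists_eq_two_pow_mul_odd hpos
  have hno : ¬ 2 ∣ o := fun hh => (Nat.not_even_iff_odd.mpr ho) (even_iff_two_dvd.mpr hh)
  have hcop : (2 ^ l).Coprime o := Nat.Coprime.pow_left _ (Nat.coprime_two_left.mpr ho)
  obtain ⟨E, hE1, hE2⟩ := Nat.chineseRemainder hcop 1 0
  have hoE : o ∣ E := (Nat.modEq_zero_iff_dvd).mp hE2
  have hlE : ((2 ^ l : ℕ) : ℤ) ∣ 1 - E := by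
    have := (Nat.modEq_iff_dvd).mp hE1
    simpa using this
  have hx : y = y ^ (E : ℤ) * y ^ (1 - E : ℤ) := by rw [← zpow_add]; simp
  have ho1 : (y ^ (1 - E : ℤ)) ^ o = 1 := by
    rw [← zpow_natCast, ← zpow_mul]
    apply orderOf_dvd_iff_zpow_eq_one.mp
    rw [hlo]; push_cast
    exact mul_dvd_mul (by exact_mod_cast hlE) dvd_rfl
  refine ⟨l, y ^ (E : ℤ), y ^ (1 - E : ℤ), hlo ▸ dvd_mul_right _ _, ?_, hx, ?_, ?_, ?_⟩
  · rw [hlo, pow_succ]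
    intro hd
    exact hno (Nat.dvd_of_mul_dvd_mul_left (by positivity) hd)
  · exact ((Commute.refl y).zpow_left _).zpow_right _
  · rcases Nat.eq_zero_or_pos l with rfl | hl
    · rw [pow_zero, orderOf_eq_one_iff]
      apply orderOf_dvd_iff_zpow_eq_one.mp
      rw [hlo]; simpa using (by exact_mod_cast hoE : (o : ℤ) ∣ E)
    · obtain ⟨l', rfl⟩ : ∃ l', l = l' + 1 := ⟨l - 1, by omega⟩
      apply orderOf_eq_prime_pow
      · rw [← zpow_natCast, ← zpow_mul, ← orderOf_dvd_iff_zpow_eq_one, hlo]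
        intro hd
        have hd' : 2 ^ (l' + 1) * o ∣ 2 ^ l' * E := by
          rw [mul_comm (2 ^ l') E]; exact_mod_cast hd
        have h2 : 2 ^ (l' + 1) ∣ 2 ^ l' * E := (dvd_mul_right _ _).trans hd'
        rw [pow_succ] at h2
        have h3 : 2 ∣ E := Nat.dvd_of_mul_dvd_mul_left (by positivity) h2
        have h4 : (2 : ℤ) ∣ 1 - E := by
          refine dvd_trans ?_ hlE
          push_cast
          exact dvd_pow_self 2 (by omega)
        omega
      · rw [← zpow_natCast, ← zpow_mul, ← orderOf_dvd_iff_zpow_eq_one, hlo]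
        push_cast
        rw [mul_comm]
        exact mul_dvd_mul (by exact_mod_cast hoE) dvd_rfl
  · intro hd
    exact hno (hd.trans (orderOf_dvd_of_pow_eq_one ho1))

theorem zpow_gen {r : G} {v l : ℕ} (hr : orderOf r = 2 ^ v) (hl : 1 ≤ l) (i : ℤ) (hi : orderOf (r ^ i) = 2 ^ l) :
    l ≤ v ∧ ∃ i' : ℤ, ¬ 2 ∣ i' ∧ r ^ i = (r ^ (2 ^ (v - l))) ^ i' := by
  have h1 : (2 : ℕ) ^ l ∣ 2 ^ v := by rw [← hi, ← hr]; exact orderOf_dvd_of_mem_zpowers ⟨i, rfl⟩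
  have hlv : l ≤ v := (Nat.pow_dvd_pow_iff_le_right (by norm_num)).mp h1
  refine ⟨hlv, ?_⟩
  have h2 : (r ^ i) ^ (2 ^ l) = 1 := by rw [← hi]; exact pow_orderOf_eq_one _
  rw [← zpow_natCast, ← zpow_mul, ← orderOf_dvd_iff_zpow_eq_one, hr] at h2
  have h3 : (2 : ℕ) ^ v = 2 ^ (v - l) * 2 ^ l := by rw [← pow_add]; congr 1; omega
  rw [h3] at h2
  push_cast at h2
  obtain ⟨i', hi'⟩ := Int.dvd_of_mul_dvd_mul_right (by positivity) h2
  refine ⟨i', ?_, ?_⟩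
  · rintro ⟨j, rfl⟩
    have h4 : (r ^ i) ^ (2 ^ (l - 1)) = 1 := by
      rw [← zpow_natCast, ← zpow_mul, ← orderOf_dvd_iff_zpow_eq_one, hr, hi', h3]
      have : (2 : ℤ) ^ l = 2 * 2 ^ (l - 1) := by rw [← pow_succ']; congr 1; omega
      push_cast
      rw [this]
      exact ⟨j, by ring⟩
    have h5 := orderOf_dvd_of_pow_eq_one h4
    rw [hi, Nat.pow_dvd_pow_iff_le_right (by norm_num)] at h5
    omega
  · rw [hi', zpow_mul]
    congr 1
    exact_mod_cast zpow_natCast r (2 ^ (v - l))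

theorem GSetup.vanish (h : GSetup r s v) (ρ : Representation ℂ G V) (hS : SchurRep ρ)
    (hχ : IsIrreducibleCharacter ρ.character) (c k : ℕ) (hc : Nat.card G = c * Module.finrank ℂ V)
    (hk : ¬ 2 ^ (k + 1) ∣ c) (y : G) (h1 : 2 ^ (k + 1) ∣ orderOf y) (h2 : 4 ∣ orderOf y) :
    ρ.character y = 0 := by
  obtain ⟨l, u, x, hl1, hl2, hy, hux, hu, hx⟩ := two_part y
  have hkl : k + 1 ≤ l := by
    by_contra hlt
    exact hl2 ((pow_dvd_pow 2 (by omega)).trans h1)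
  have hl : 2 ≤ l := by
    by_contra hlt
    exact hl2 ((pow_dvd_pow 2 (by omega : l + 1 ≤ 2)).trans h2)
  obtain ⟨t, i, hti⟩ := h.hfus u l hl hu
  have hoi : orderOf (r ^ i) = 2 ^ l := by
    rw [← hti, ← hu]
    exact orderOf_injective (MulAut.conj t).toMonoidHom (MulAut.conj t).injective u
  obtain ⟨hlv, i', hi', hri⟩ := zpow_gen h.hr (by omega) i hoi
  obtain ⟨C, N, Ch, hset⟩ := csetup r s v l h.hr h.hsr h.hG hl hlv
  obtain ⟨g, hg⟩ : ∃ g, g = r ^ (2 ^ (v - l)) := ⟨_, rfl⟩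
  rw [← hg] at hset hri
  have hcomm : Commute (t * x * t⁻¹) (r ^ i) := by
    rw [← hti]
    exact (SemiconjBy.conj_iff.mpr hux.symm : SemiconjBy (t * x * t⁻¹) (t * u * t⁻¹) (t * u * t⁻¹))
  have hcg : Commute (t * x * t⁻¹) g := by
    have hcop : IsCoprime i' ((2 ^ l : ℕ) : ℤ) := by
      push_cast
      apply IsCoprime.pow_right
      rw [Int.isCoprime_iff_gcd_eq_one, Int.gcd_comm]
      have : Nat.Coprime 2 i'.natAbs := (Nat.Prime.coprime_iff_not_dvd Nat.prime_two).mpr (by omega)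
      exact this
    obtain ⟨a, b, hab⟩ := hcop
    have : g = (r ^ i) ^ a := by
      rw [hri, ← zpow_mul]
      have e : i' * a = 1 - b * ((2 ^ l : ℕ) : ℤ) := by rw [← hab]; ring
      rw [e, zpow_sub, zpow_one, mul_comm b, zpow_mul, zpow_natCast, ← hset.ord, pow_orderOf_eq_one]
      simp
    rw [this]
    exact hcomm.zpow_right a
  have hxN : t * x * t⁻¹ ∈ N := by
    apply hset.hodd _ ((hset.hC _).mpr hcg.eq)
    have : orderOf (t * x * t⁻¹) = orderOf x :=
      orderOf_injective (MulAut.conj t).toMonoidHom (MulAut.conj t).injective x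
    rwa [this]
  have := hset.vanish ρ hS hχ c k hc hk hkl i' hi' ⟨_, hxN⟩
  rw [← Representation.char_conj ρ y t, ← this, ← hri, ← hti, hy]
  congr 1; group
end

end PartM6

section PartM7

section
variable {G : Type} [Group G] [Fintype G] {V : Type} [AddCommGroup V] [Module ℂ V]
    [FiniteDimensional ℂ V] (ρ : Representation ℂ G V) (N : Subgroup G)

/-- central idempotent -/
noncomputable def pphi (φ : N → ℂ) : Module.End ℂ V :=
  (φ 1 / (Nat.card N : ℂ)) • ∑ x : N, φ x⁻¹ • ρ x

theorem pphi_trace (φ : N → ℂ) (q : Module.End ℂ V) :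
    LinearMap.trace ℂ V (q * pphi ρ N φ) = φ 1 * mlt ρ N φ q := by
  simp only [pphi, mlt, mul_smul_comm, Finset.mul_sum, map_smul, map_sum, smul_eq_mul]
  apply Finset.sum_congr rfl
  intro x _
  rw [div_eq_mul_inv]; ring

theorem pphi_mul {φ ψ : N → ℂ} (hφ : IsIrreducibleCharacter φ) (hψ : IsIrreducibleCharacter ψ) :
    pphi ρ N φ * pphi ρ N ψ = if φ = ψ then pphi ρ N φ else 0 := by
  have hN : (Nat.card N : ℂ) ≠ 0 := by exact_mod_cast Nat.card_pos.ne'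
  have h1 : (∑ x : N, φ x⁻¹ • ρ x) * (∑ y : N, ψ y⁻¹ • ρ y) =
      ∑ z : N, (∑ x : N, φ x⁻¹ * ψ (x * z⁻¹)) • ρ z := by
    simp only [Finset.sum_smul]
    rw [Finset.sum_comm, Finset.sum_mul]
    apply Finset.sum_congr rfl
    intro x _
    rw [Finset.mul_sum]
    refine Fintype.sum_equiv (Equiv.mulLeft x) _ _ ?_
    intro y
    have : x * (x * y)⁻¹ = x * y⁻¹ * x⁻¹ := by group
    simp only [Equiv.coe_mulLeft, this, irr_conj hψ]
    rw [smul_mul_smul_comm, ← map_mul]; rfl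
  simp only [irr_conv hφ hψ] at h1
  simp only [pphi]
  rw [smul_mul_smul_comm, h1]
  split_ifs with h
  · subst h
    obtain ⟨n, hn, _, hn1⟩ := irr_degree hφ
    have h0 : φ 1 ≠ 0 := by rw [hn1]; exact_mod_cast hn.ne'
    simp only [mul_smul, ← Finset.smul_sum]
    rw [smul_smul, smul_smul]
    congr 1
    field_simp
  · simp

theorem pphi_sum : ∑ φ ∈ IrrF N, pphi ρ N φ = 1 := by
  have hN : (Nat.card N : ℂ) ≠ 0 := by exact_mod_cast Nat.card_pos.ne'
  simp only [pphi, Finset.smul_sum, smul_smul]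
  rw [Finset.sum_comm]
  have : ∀ x : N, ∑ φ ∈ IrrF N, (φ 1 / (Nat.card N : ℂ) * φ x⁻¹) • ρ (x : G) = if x = 1 then 1 else 0 := by
    intro x
    rw [← Finset.sum_smul]
    have h1 := irr_col x⁻¹
    have h2 : ∑ φ ∈ IrrF N, φ 1 / (Nat.card N : ℂ) * φ x⁻¹ = (Nat.card N : ℂ)⁻¹ * ∑ φ ∈ IrrF N, φ 1 * φ x⁻¹ := by
      rw [Finset.mul_sum]
      apply Finset.sum_congr rfl
      intros; rw [div_eq_mul_inv]; ring
    rw [h2, h1]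
    by_cases hx : x = 1
    · subst hx; simp [hN]
    · simp [hx]
  simp only [this]
  simp

theorem pphi_conj (φ : N → ℂ) (t : G) (ht : ∀ x ∈ N, t * x * t⁻¹ ∈ N) (ht' : ∀ x ∈ N, t⁻¹ * x * t ∈ N) :
    ρ t * pphi ρ N (fun x => φ (cj t ht ht' x)) = pphi ρ N φ * ρ t := by
  simp only [pphi, mul_smul_comm, smul_mul_assoc, map_one, Finset.mul_sum, Finset.sum_mul]
  congr 1
  refine Fintype.sum_equiv (cj t ht ht').toEquiv _ _ ?_
  intro x
  have : (cj t ht ht').toEquiv x = cj t ht ht' x := rfl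
  rw [this, map_inv, ← map_mul, ← map_mul]
  congr 2
  change t * x = t * x * t⁻¹ * t
  group

theorem mlt_not_stab {φ : N → ℂ} (hφ : IsIrreducibleCharacter φ) (t : G)
    (ht : ∀ x ∈ N, t * x * t⁻¹ ∈ N) (ht' : ∀ x ∈ N, t⁻¹ * x * t ∈ N) (hst : t ∉ stabG (zext N φ)) :
    mlt ρ N φ (ρ t) = 0 := by
  obtain ⟨n, hn, _, hn1⟩ := irr_degree hφ
  have h0 : φ 1 ≠ 0 := by rw [hn1]; exact_mod_cast hn.ne'
  rw [stab_iff N φ t ht ht'] at hst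
  have h1 : LinearMap.trace ℂ V (ρ t * pphi ρ N φ) = 0 := by
    have e1 : pphi ρ N φ = pphi ρ N φ * pphi ρ N φ := by rw [pphi_mul ρ N hφ hφ, if_pos rfl]
    rw [e1, ← mul_assoc, LinearMap.trace_mul_comm, ← mul_assoc, ← pphi_conj ρ N φ t ht ht', mul_assoc,
      pphi_mul ρ N (irr_comp (cj t ht ht') hφ) hφ, if_neg hst]
    simp
  rw [pphi_trace] at h1
  exact (mul_eq_zero.mp h1).resolve_left h0

/-- commuting with the stabilizer -/
theorem pphi_comm {φ : N → ℂ} (t : G)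
    (ht : ∀ x ∈ N, t * x * t⁻¹ ∈ N) (ht' : ∀ x ∈ N, t⁻¹ * x * t ∈ N) (hst : t ∈ stabG (zext N φ)) :
    Commute (ρ t) (pphi ρ N φ) := by
  rw [stab_iff N φ t ht ht'] at hst
  have := pphi_conj ρ N φ t ht ht'
  rw [hst] at this
  exact this

theorem tr_inv_le (S f : Module.End ℂ V) (hS : S * S = 1) (hf : f * f = f) (hSf : S * f = f * S) :
    ∃ (a : ℤ) (b : ℕ), LinearMap.trace ℂ V (S * f) = a ∧ LinearMap.trace ℂ V f = b ∧ |a| ≤ b ∧ 2 ∣ a - b := by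
  have h1 : ∀ T : Module.End ℂ V, T * T = 1 → T * f = f * T →
      ∃ n : ℕ, LinearMap.trace ℂ V f + LinearMap.trace ℂ V (T * f) = 2 * n := by
    intro T hT hTf
    have he : (((2 : ℂ)⁻¹) • (f + T * f)) * (((2 : ℂ)⁻¹) • (f + T * f)) = ((2 : ℂ)⁻¹) • (f + T * f) := by
      have e1 : (f + T * f) * (f + T * f) = (2 : ℂ) • (f + T * f) := by
        have a1 : T * f * f = T * f := by rw [mul_assoc, hf]
        have a2 : f * (T * f) = T * f := by rw [← mul_assoc, ← hTf, mul_assoc, hf]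
        have a3 : T * f * (T * f) = f := by rw [mul_assoc, a2, ← mul_assoc, hT, one_mul]
        rw [add_mul, mul_add, mul_add, hf, a1, a2, a3, two_smul]
        abel
      rw [smul_mul_smul_comm, e1, smul_smul]
      norm_num
    have := idem_trace_nat _ he
    rw [map_smul, map_add, smul_eq_mul] at this
    refine ⟨Module.finrank ℂ ↥(LinearMap.range ((2 : ℂ)⁻¹ • (f + T * f))), ?_⟩
    rw [← this]; ring
  obtain ⟨n1, h1'⟩ := h1 S hS hSf
  obtain ⟨n2, h2'⟩ := h1 (-S) (by simpa using hS) (by rw [neg_mul, mul_neg, hSf])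
  rw [neg_mul, map_neg] at h2'
  refine ⟨(n1 : ℤ) - n2, n1 + n2, ?_, ?_, ?_, ?_⟩
  · push_cast
    linear_combination (1 / 2) * h1' - (1 / 2) * h2'
  · push_cast
    linear_combination (1 / 2) * h1' + (1 / 2) * h2'
  · rw [abs_le]; push_cast; constructor <;> linarith
  · exact ⟨-n2, by push_cast; ring⟩
end

end PartM7

section PartM8

section
variable {G : Type} [Group G] [Fintype G] {r s g : G} {v l : ℕ} {C N Ch : Subgroup G}
variable {V : Type} [AddCommGroup V] [Module ℂ V] [FiniteDimensional ℂ V] [Nontrivial V]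

theorem CSetup.rCh (h : CSetup r s g v l C N Ch) (i : ℤ) : r ^ i ∈ Ch := Ch.zpow_mem (h.hCCh h.hrC) i

theorem CSetup.ord_mul (h : CSetup r s g v l C N Ch) (i : ℤ) (hi : ¬ (2 : ℤ) ^ (v - l) ∣ i) (x : N) :
    2 ^ (l + 1) ∣ orderOf (r ^ i * (x : G)) := by
  have hlv := h.hlv
  have h1 : ∀ n : ℕ, ∃ y ∈ N, (r ^ i * (x : G)) ^ n = (r ^ i) ^ n * y := by
    intro n
    induction n with
    | zero => exact ⟨1, N.one_mem, by simp⟩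
    | succ n ih =>
      obtain ⟨y, hy, he⟩ := ih
      refine ⟨(r ^ i)⁻¹ * y * (r ^ i) * x, N.mul_mem (h.conj' _ (h.rCh i) y hy) x.2, ?_⟩
      rw [pow_succ, he, pow_succ]; group
  obtain ⟨y, hy, he⟩ := h1 (orderOf (r ^ i * (x : G)))
  rw [pow_orderOf_eq_one] at he
  obtain ⟨o, ho⟩ : ∃ o, o = orderOf (r ^ i * (x : G)) := ⟨_, rfl⟩
  rw [← ho] at he ⊢
  have h2 : y = r ^ (-(i * o)) := by
    rw [zpow_neg, zpow_mul, zpow_natCast]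
    exact (inv_eq_of_mul_eq_one_right he.symm).symm
  have h3 : orderOf y ∣ Nat.card N := by
    have := orderOf_dvd_natCard (⟨y, hy⟩ : N)
    rwa [Subgroup.orderOf_mk] at this
  have h4 : orderOf y ∣ 2 ^ v := by
    rw [← h.hr]; exact orderOf_dvd_of_mem_zpowers ⟨_, h2.symm⟩
  have hcop : (2 ^ v).Coprime (Nat.card N) :=
    Nat.Coprime.pow_left _ ((Nat.Prime.coprime_iff_not_dvd Nat.prime_two).mpr h.hN2)
  have h5 : orderOf y = 1 := Nat.eq_one_of_dvd_coprimes hcop h4 h3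
  rw [orderOf_eq_one_iff] at h5
  rw [h5] at h2
  have h6 := orderOf_dvd_iff_zpow_eq_one.mpr h2.symm
  rw [h.hr, dvd_neg] at h6
  push_cast at h6
  have hvl : v - l ≠ 0 := by
    intro h0
    rw [h0] at hi
    simp at hi
  have h7 := two_pow_dvd_of (c := i.natAbs) (k := v - l - 1) (d := v) (D := (o : ℤ)) (by
    have : v - l - 1 + 1 = v - l := by omega
    rw [this]
    intro hd
    apply hi
    rw [← Int.dvd_natAbs]
    exact_mod_cast hd) (by
    rcases Int.natAbs_eq i with e | e
    · rwa [← e]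
    · rw [e] at h6
      rw [neg_mul, dvd_neg] at h6
      exact h6)
  have e : v - (v - l - 1) = l + 1 := by omega
  rw [e] at h7
  exact_mod_cast h7

theorem CSetup.mlt_zero (h : CSetup r s g v l C N Ch) (hg : GSetup r s v) (ρ : Representation ℂ G V) (hS : SchurRep ρ)
    (hχ : IsIrreducibleCharacter ρ.character) (c : ℕ) (hc : Nat.card G = c * Module.finrank ℂ V)
    (hk : ¬ 2 ^ (l + 1) ∣ c) (φ : N → ℂ) (i : ℤ) (hi : ¬ (2 : ℤ) ^ (v - l) ∣ i) :
    mlt ρ N φ (ρ (r ^ i)) = 0 := by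
  rw [mlt, Finset.sum_eq_zero, mul_zero]
  intro x _
  have h1 := h.ord_mul i hi x
  have h2 := hg.vanish ρ hS hχ c l hc hk _ h1 ((pow_dvd_pow 2 (by have := h.hl; omega : 2 ≤ l + 1)).trans h1)
  rw [← map_mul]
  change _ * ρ.character _ = 0
  rw [h2, mul_zero]

theorem CSetup.eigR (h : CSetup r s g v l C N Ch) (ρ : Representation ℂ G V) (φ : N → ℂ)
    (h0 : ∀ i : ℤ, ¬ (2 : ℤ) ^ (v - l) ∣ i → mlt ρ N φ (ρ (r ^ i)) = 0)
    (d : ℕ) (hld : l ≤ d) (hdv : d ≤ v) (ζ : ℂ) (j : ℤ) :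
    ((2 ^ d : ℕ) : ℂ) * mlt ρ N φ (eigProj ρ (r ^ (2 ^ (v - d))) (2 ^ d) ζ j) =
      ∑ i ∈ Finset.range (2 ^ l), (ζ ^ (2 ^ (d - l))) ^ (-((i : ℤ) * j)) * mlt ρ N φ (ρ (g ^ (i : ℤ))) := by
  have hd0 : ((2 ^ d : ℕ) : ℂ) ≠ 0 := by exact_mod_cast (by positivity : (2 : ℕ) ^ d ≠ 0)
  rw [eigProj, mlt_smul, mlt_sum, mul_inv_cancel_left₀ hd0]
  simp only [mlt_smul]
  have h2 : (2 : ℕ) ^ d = 2 ^ (d - l) * 2 ^ l := by rw [← pow_add]; congr 1; omega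
  obtain ⟨F, hF⟩ : ∃ F : ℤ → ℂ, ∀ i, F i = ζ ^ (-(i * j)) * mlt ρ N φ (ρ ((r ^ (2 ^ (v - d))) ^ i)) :=
    ⟨_, fun _ => rfl⟩
  simp only [← hF]
  rw [h2, sum_range_block]
  apply Finset.sum_congr rfl
  intro i _
  have hz : ∀ c ∈ Finset.range (2 ^ (d - l)), c ≠ 0 → F (c + (2 ^ (d - l) : ℕ) * i) = 0 := by
    intro c hc hc0
    rw [hF, ← zpow_natCast, ← zpow_mul, h0, mul_zero]
    intro hd
    have e : (2 : ℤ) ^ (v - l) = 2 ^ (v - d) * 2 ^ (d - l) := by rw [← pow_add]; congr 1; omega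
    rw [e] at hd
    push_cast at hd
    have h3 := Int.dvd_of_mul_dvd_mul_left (by positivity) hd
    have h4 : (2 : ℤ) ^ (d - l) ∣ c := (dvd_add_left (dvd_mul_right _ _)).mp h3
    have h5 : 2 ^ (d - l) ∣ c := by exact_mod_cast h4
    exact hc0 (Nat.eq_zero_of_dvd_of_lt h5 (Finset.mem_range.mp hc))
  rw [Finset.sum_eq_single 0 hz (fun hn => absurd (Finset.mem_range.mpr (by positivity)) hn), hF]
  congr 1
  · rw [← zpow_natCast, ← zpow_mul]
    congr 1; push_cast; ring
  · congr 2
    rw [h.hg, ← zpow_natCast, ← zpow_natCast, ← zpow_mul, ← zpow_mul]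
    congr 1
    have e : (2 : ℤ) ^ (v - l) = 2 ^ (v - d) * 2 ^ (d - l) := by rw [← pow_add]; congr 1; omega
    push_cast
    rw [e]; ring

theorem odd_gen {g : G} {l : ℕ} (hg : orderOf g ∣ 2 ^ l) (i : ℤ) (hi : ¬ 2 ∣ i) : ∃ a : ℤ, g = (g ^ i) ^ a := by
  have hcop : IsCoprime i ((2 ^ l : ℕ) : ℤ) := by
    push_cast
    apply IsCoprime.pow_right
    rw [Int.isCoprime_iff_gcd_eq_one, Int.gcd_comm]
    have : Nat.Coprime 2 i.natAbs := (Nat.Prime.coprime_iff_not_dvd Nat.prime_two).mpr (by omega)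
    exact this
  obtain ⟨a, b, hab⟩ := hcop
  refine ⟨a, ?_⟩
  rw [← zpow_mul]
  have e : i * a = 1 - ((2 ^ l : ℕ) : ℤ) * b := by rw [← hab]; ring
  rw [e, zpow_sub, zpow_one, zpow_mul, zpow_natCast, orderOf_dvd_iff_pow_eq_one.mp hg]
  simp

theorem CSetup.r_mem (h : CSetup r s g v l C N Ch) (S : Subgroup G) (hSC : S ≤ C) (d : ℕ) (hdv : d ≤ v)
    (hd : Nat.card S = Nat.card N * 2 ^ d) : r ^ (2 ^ (v - d)) ∈ S := by
  have hidx : S.relIndex C = 2 ^ (v - d) := by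
    have h1 := Subgroup.card_mul_index (S.subgroupOf C)
    have h2 : Nat.card (S.subgroupOf C) = Nat.card S := Nat.card_congr (Subgroup.subgroupOfEquivOfLe hSC).toEquiv
    rw [h2, hd, h.hCN] at h1
    have e : (2 : ℕ) ^ v = 2 ^ d * 2 ^ (v - d) := by rw [← pow_add]; congr 1; omega
    rw [e, ← mul_assoc] at h1
    exact Nat.eq_of_mul_eq_mul_left (by have : 0 < Nat.card N := Nat.card_pos
                                        positivity) h1
  obtain ⟨n, hn0, hn, hm⟩ := Subgroup.exists_pow_mem_of_relIndex_ne_zero (H := S) (K := C)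
    (by rw [hidx]; positivity) h.hrC
  rw [hidx] at hn
  obtain ⟨f, o, ho, hfo⟩ := Nat.exists_eq_two_pow_mul_odd hn0.ne'
  have hf : f ≤ v - d := by
    have h1 : 2 ^ f ≤ 2 ^ (v - d) := le_trans (by rw [hfo]; exact Nat.le_mul_of_pos_right _ ho.pos) hn
    exact (Nat.pow_le_pow_iff_right (by norm_num)).mp h1
  obtain ⟨a, ha⟩ := odd_gen (g := r ^ (2 ^ f)) (l := v) (by rw [← h.hr]; exact orderOf_pow_dvd _) (o : ℤ) (by
    intro h2
    have : 2 ∣ o := by exact_mod_cast h2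
    exact (Nat.not_even_iff_odd.mpr ho) (even_iff_two_dvd.mpr this))
  have h3 : r ^ (2 ^ f) ∈ S := by
    rw [ha, zpow_natCast, ← pow_mul, ← hfo]
    exact S.zpow_mem hm.1 a
  have e : 2 ^ (v - d) = 2 ^ f * 2 ^ (v - d - f) := by rw [← pow_add]; congr 1; omega
  rw [e, pow_mul]
  exact S.pow_mem h3 _
end

end PartM8

section PartM9

section
variable {G : Type} [Group G] [Fintype G] {r s g : G} {v l : ℕ} {C N Ch : Subgroup G}
variable {V : Type} [AddCommGroup V] [Module ℂ V] [FiniteDimensional ℂ V] [Nontrivial V]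

theorem CSetup.phi_odd (h : CSetup r s g v l C N Ch) {φ : N → ℂ} (hφ : IsIrreducibleCharacter φ) :
    ∃ f : ℕ, 0 < f ∧ ¬ 2 ∣ f ∧ φ 1 = f := by
  obtain ⟨f, hf, hd, h1⟩ := irr_degree hφ
  exact ⟨f, hf, fun h2 => h.hN2 (h2.trans hd), h1⟩

theorem CSetup.Y_dvd (h : CSetup r s g v l C N Ch) (ρ : Representation ℂ G V) {φ : N → ℂ}
    (hφ : IsIrreducibleCharacter φ)
    (h0 : ∀ i : ℤ, ¬ (2 : ℤ) ^ (v - l) ∣ i → mlt ρ N φ (ρ (r ^ i)) = 0)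
    (d : ℕ) (hld : l ≤ d) (hdv : d ≤ v) (hd : Nat.card ↥(stabG (zext N φ) ⊓ C) = Nat.card N * 2 ^ d)
    {ζ : ℂ} (hζ : IsPrimitiveRoot ζ (2 ^ d)) (Y : ℤ → ℕ)
    (hY : ∀ j : ℤ, ((2 ^ l : ℕ) : ℂ) * Y j = ∑ i ∈ Finset.range (2 ^ l), (ζ ^ (2 ^ (d - l))) ^ (-((i : ℤ) * j)) * mlt ρ N φ (ρ (g ^ (i : ℤ))))
    (j : ℤ) : 2 ^ (d - l) ∣ Y j := by
  have hu := h.r_mem _ inf_le_right d hdv hd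
  have hu1 : (r ^ (2 ^ (v - d))) ^ (2 ^ d) = 1 := by
    rw [← pow_mul, ← pow_add, Nat.sub_add_cancel hdv, ← h.hr, pow_orderOf_eq_one]
  have huC : r ^ (2 ^ (v - d)) ∈ Ch := h.hCCh hu.2
  have hcm := pphi_comm ρ N (φ := φ) _ (fun x hx => h.hconj _ huC x hx) (h.conj' _ huC) hu.1
  have hpos : 0 < 2 ^ d := by positivity
  have hcm2 := eig_comm ρ (N := 2 ^ d) (ω := ζ) _ hcm j
  have hid := eig_idem ρ hpos hu1 hζ j
  have hpp : pphi ρ N φ * pphi ρ N φ = pphi ρ N φ := by rw [pphi_mul ρ N hφ hφ, if_pos rfl]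
  have hI : (eigProj ρ (r ^ (2 ^ (v - d))) (2 ^ d) ζ j * pphi ρ N φ) * (eigProj ρ (r ^ (2 ^ (v - d))) (2 ^ d) ζ j * pphi ρ N φ) = eigProj ρ (r ^ (2 ^ (v - d))) (2 ^ d) ζ j * pphi ρ N φ := by
    rw [mul_assoc, ← mul_assoc (pphi ρ N φ), ← hcm2.eq, mul_assoc, hpp, ← mul_assoc, hid]
  have ht := idem_trace_nat _ hI
  rw [pphi_trace] at ht
  have he := h.eigR ρ φ h0 d hld hdv ζ j
  rw [← hY] at he
  obtain ⟨f, hf, hfo, hf1⟩ := h.phi_odd hφ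
  rw [hf1] at ht
  obtain ⟨M, hM⟩ : ∃ M : ℕ, (f : ℂ) * mlt ρ N φ (eigProj ρ (r ^ (2 ^ (v - d))) (2 ^ d) ζ j) = M := ⟨_, ht⟩
  have h1 : ((2 ^ d * M : ℕ) : ℂ) = ((f * (2 ^ l * Y j) : ℕ) : ℂ) := by
    rw [Nat.cast_mul, Nat.cast_mul, Nat.cast_mul, ← he, ← hM]; ring
  have h2 : 2 ^ d * M = f * (2 ^ l * Y j) := by exact_mod_cast h1
  have e : 2 ^ d = 2 ^ l * 2 ^ (d - l) := by rw [← pow_add]; congr 1; omega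
  have h3 : 2 ^ (d - l) * M = f * Y j := by
    apply Nat.eq_of_mul_eq_mul_left (by positivity : 0 < 2 ^ l)
    rw [← mul_assoc, ← e, h2]; ring
  have hcop : (2 ^ (d - l)).Coprime f :=
    Nat.Coprime.pow_left _ ((Nat.Prime.coprime_iff_not_dvd Nat.prime_two).mpr hfo)
  exact hcop.dvd_of_dvd_mul_left (Dvd.intro _ h3)

theorem CSetup.mlt_conj (h : CSetup r s g v l C N Ch) (ρ : Representation ℂ G V) {φ : N → ℂ}
    (hφ : IsIrreducibleCharacter φ) (t : G) (ht : t ∈ Ch) (hst : t ∈ stabG (zext N φ)) (w : G) :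
    mlt ρ N φ (ρ (t * w * t⁻¹)) = mlt ρ N φ (ρ w) := by
  obtain ⟨f, hf, -, hf1⟩ := h.phi_odd hφ
  have hcm := pphi_comm ρ N (φ := φ) t (fun x hx => h.hconj _ ht x hx) (h.conj' _ ht) hst
  have hne : φ 1 ≠ 0 := by rw [hf1]; exact_mod_cast hf.ne'
  apply mul_left_cancel₀ hne
  rw [← pphi_trace, ← pphi_trace]
  have : ρ (t * w * t⁻¹) * pphi ρ N φ = ρ t * (ρ w * pphi ρ N φ * ρ t⁻¹) := by
    have hc2 : ρ t⁻¹ * pphi ρ N φ = pphi ρ N φ * ρ t⁻¹ := by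
      have := pphi_comm ρ N (φ := φ) t⁻¹ (fun x hx => h.hconj _ (Ch.inv_mem ht) x hx) (h.conj' _ (Ch.inv_mem ht)) ((stabG _).inv_mem hst)
      exact this.eq
    rw [map_mul, map_mul, mul_assoc, mul_assoc, hc2]; simp only [mul_assoc]
  rw [this, LinearMap.trace_mul_comm, mul_assoc, ← map_mul]
  simp

theorem CSetup.sum_dvd (h : CSetup r s g v l C N Ch) (ρ : Representation ℂ G V) (hS : SchurRep ρ)
    (c : ℕ) (hc : Nat.card G = c * Module.finrank ℂ V)
    {φ : N → ℂ} (hφ : IsIrreducibleCharacter φ) (t : G) (ht : t ∈ Ch) (hst : t ∈ stabG (zext N φ)) (htC : t ∉ C)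
    (d : ℕ) (hdv : d ≤ v) (hd : Nat.card ↥(stabG (zext N φ) ⊓ C) = Nat.card N * 2 ^ d)
    (M : ℤ) (hM : mlt ρ N φ (ρ 1) = M) : (2 : ℤ) ^ (d + 1) ∣ c * M := by
  have hle : stabG (zext N φ) ⊓ C ≤ stabG (zext N φ) ⊓ Ch := inf_le_inf_left _ h.hCCh
  obtain ⟨q, hq⟩ := Subgroup.card_dvd_of_le hle
  have hd2 := Subgroup.card_dvd_of_le (inf_le_right : stabG (zext N φ) ⊓ Ch ≤ Ch)
  rw [h.hChC, h.hCN] at hd2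
  have hN : 0 < Nat.card N := Nat.card_pos
  have hq2 : q ∣ 2 ^ (v + 1 - d) := by
    rw [hq, hd] at hd2
    have e : 2 * (Nat.card N * 2 ^ v) = Nat.card N * 2 ^ d * 2 ^ (v + 1 - d) := by
      rw [mul_assoc, ← pow_add, Nat.add_sub_cancel' (by omega), pow_succ]; ring
    rw [e] at hd2
    exact Nat.dvd_of_mul_dvd_mul_left (by positivity) hd2
  obtain ⟨i, hi, rfl⟩ := (Nat.dvd_prime_pow Nat.prime_two).mp hq2
  have hi0 : i ≠ 0 := by
    rintro rfl
    rw [pow_zero, mul_one] at hq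
    have := Subgroup.eq_of_le_of_card_ge hle hq.le
    have h3 : t ∈ stabG (zext N φ) ⊓ Ch := ⟨hst, ht⟩
    rw [← this] at h3
    exact htC h3.2
  have h4 := mlt_integral ρ hS c hc hφ 1 (stabG (zext N φ) ⊓ Ch) (by simp) inf_le_left (2 ^ d * 2 ^ i) (by
    rw [hq, hd, mul_assoc])
  rw [hM] at h4
  have h5 := dvd_of_integral_div (a := c * M) (b := 2 ^ d * 2 ^ i) (by positivity) (by
    push_cast at h4 ⊢; exact h4)
  refine dvd_trans ?_ h5
  rw [← pow_add]
  exact pow_dvd_pow _ (by omega)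

theorem CSetup.good_eq (h : CSetup r s g v l C N Ch) (hG : GSetup r s v) (ρ : Representation ℂ G V) (hS : SchurRep ρ)
    (hχ : IsIrreducibleCharacter ρ.character) (c : ℕ) (hc : Nat.card G = c * Module.finrank ℂ V)
    (hk : ¬ 2 ^ (l + 1) ∣ c)
    {φ : N → ℂ} (hφ : IsIrreducibleCharacter φ) (t : G) (ht : t ∈ Ch) (hst : t ∈ stabG (zext N φ)) (htC : t ∉ C)
    {ζ : ℂ} (hζ : IsPrimitiveRoot ζ (2 ^ v)) (Y : ℤ → ℕ) (hYp : ∀ j, Y (j + (2 ^ l : ℕ)) = Y j)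
    (hY3 : ∀ i : ℤ, mlt ρ N φ (ρ (g ^ i)) = ∑ j ∈ Finset.range (2 ^ l), (ζ ^ (2 ^ (v - l))) ^ (i * j) * (Y j : ℂ))
    (hY : ∀ j : ℤ, ((2 ^ l : ℕ) : ℂ) * Y j = ∑ i ∈ Finset.range (2 ^ l), (ζ ^ (2 ^ (v - l))) ^ (-((i : ℤ) * j)) * mlt ρ N φ (ρ (g ^ (i : ℤ)))) :
    Y 0 = Y ((2 ^ (l - 1) : ℕ) : ℤ) := by
  have hl := h.hl
  have hlv := h.hlv
  obtain ⟨-, d, hld, hdv, hd⟩ := h.stab hφ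
  have hω : IsPrimitiveRoot (ζ ^ (2 ^ (v - l))) (2 ^ l) :=
    IsPrimitiveRoot.pow (by positivity) hζ (by rw [← pow_add]; congr 1; omega)
  have hζd : IsPrimitiveRoot (ζ ^ (2 ^ (v - d))) (2 ^ d) :=
    IsPrimitiveRoot.pow (by positivity) hζ (by rw [← pow_add]; congr 1; omega)
  have hωd : (ζ ^ (2 ^ (v - d))) ^ (2 ^ (d - l)) = ζ ^ (2 ^ (v - l)) := by
    rw [← pow_mul, ← pow_add]; congr 2; omega
  have h0 := fun i hi => h.mlt_zero hG ρ hS hχ c hc hk φ i hi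
  have hdv1 := fun j => h.Y_dvd ρ hφ h0 d hld hdv hd hζd Y (by rw [hωd]; exact hY) j
  choose Z hZ using hdv1
  have hlt := h.bound ρ hχ hφ hω Y hY d hd 0
  have hgl : g ^ (2 ^ l) = 1 := by rw [← h.ord, pow_orderOf_eq_one]
  -- symmetry
  have hneg : ∀ j, Y (-j) = Y j := by
    intro j
    have hp : ((2 ^ l : ℕ) : ℂ) ≠ 0 := by exact_mod_cast (by positivity : (2 : ℕ) ^ l ≠ 0)
    have : (Y (-j) : ℂ) = Y j := by
      apply mul_left_cancel₀ hp
      rw [hY, hY]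
      have : NeZero (2 ^ l) := ⟨by positivity⟩
      rw [← sum_range_neg (N := 2 ^ l) (fun i : ℤ => (ζ ^ (2 ^ (v - l))) ^ (-(i * j)) * mlt ρ N φ (ρ (g ^ i)))]
      · apply Finset.sum_congr rfl
        intro i _
        have e1 : g ^ (-(i : ℤ)) = t * g ^ (i : ℤ) * t⁻¹ := by
          rw [← conj_zpow, h.hinv t ht htC, inv_zpow, zpow_neg]
        rw [e1, h.mlt_conj ρ hφ t ht hst]
        congr 2; ring
      · intro i
        congr 1
        · rw [show -((i + (2 ^ l : ℕ)) * j) = -(i * j) + ((2 ^ l : ℕ) : ℤ) * (-j) by ring,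
            zpow_add₀ (hω.ne_zero (by positivity)), zpow_mul _ ((2 ^ l : ℕ) : ℤ), zpow_natCast, hω.pow_eq_one, one_zpow, mul_one]
        · rw [zpow_add, zpow_natCast, hgl, mul_one]
    exact_mod_cast this
  have hM : mlt ρ N φ (ρ 1) = ((∑ j ∈ Finset.range (2 ^ l), (Y j : ℤ) : ℤ) : ℂ) := by
    have := hY3 0
    simpa using this
  have h6 := two_pow_dvd_of hk (h.sum_dvd ρ hS c hc hφ t ht hst htC d hdv hd _ hM)
  have hl2 : 2 ^ l = 2 * 2 ^ (l - 1) := by rw [← pow_succ']; congr 1; omega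
  have hpZ : ∀ j, Z (j + (2 * 2 ^ (l - 1) : ℕ)) = Z j := by
    intro j
    apply Nat.eq_of_mul_eq_mul_left (by positivity : 0 < 2 ^ (d - l))
    rw [← hZ, ← hZ, ← hl2, hYp]
  have hnZ : ∀ j, Z (-j) = Z j := by
    intro j
    apply Nat.eq_of_mul_eq_mul_left (by positivity : 0 < 2 ^ (d - l))
    rw [← hZ, ← hZ, hneg]
  have h7 : (2 : ℤ) ∣ ∑ j ∈ Finset.range (2 * 2 ^ (l - 1)), (Z j : ℤ) := by
    rw [← hl2]
    have e : ∑ j ∈ Finset.range (2 ^ l), (Y j : ℤ) = 2 ^ (d - l) * ∑ j ∈ Finset.range (2 ^ l), (Z j : ℤ) := by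
      rw [Finset.mul_sum]; apply Finset.sum_congr rfl; intro j _; rw [hZ]; push_cast; rfl
    rw [e, show d + 1 - l = (d - l) + 1 by omega, pow_succ] at h6
    exact Int.dvd_of_mul_dvd_mul_left (by positivity) h6
  rw [sum_range_pair (fun j => (Z j : ℤ)) (2 ^ (l - 1)) (by positivity) (by intro i; exact_mod_cast hpZ i)] at h7
  have h8 : ∑ c ∈ Finset.range (2 ^ (l - 1) - 1), ((Z ((c : ℤ) + 1) : ℤ) + Z (-((c : ℤ) + 1))) =
      2 * ∑ c ∈ Finset.range (2 ^ (l - 1) - 1), (Z ((c : ℤ) + 1) : ℤ) := by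
    rw [Finset.mul_sum]; apply Finset.sum_congr rfl; intro j _; rw [hnZ]; ring
  rw [h8] at h7
  have h9 : (2 : ℤ) ∣ (Z 0 : ℤ) - Z ((2 ^ (l - 1) : ℕ) : ℤ) := by omega
  obtain ⟨w, hw⟩ := h9
  have e1 : (0 : ℤ) + 2 ^ (l - 1) = ((2 ^ (l - 1) : ℕ) : ℤ) := by push_cast; ring
  rw [e1, hZ 0, hZ ((2 ^ (l - 1) : ℕ) : ℤ)] at hlt
  have e2 : (2 : ℤ) ^ (d + 2) = 2 ^ l * 2 ^ (d - l) * 4 := by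
    rw [← pow_add, show d + 2 = l + (d - l) + 2 by omega, pow_add _ _ 2]; norm_num
  have e3 : (2 : ℤ) ^ l * (((2 ^ (d - l) * Z 0 : ℕ) : ℤ) - ((2 ^ (d - l) * Z ((2 ^ (l - 1) : ℕ) : ℤ) : ℕ) : ℤ)) ^ 2
      = 2 ^ l * 2 ^ (d - l) * 4 * (2 ^ (d - l) * w ^ 2) := by
    push_cast at hw ⊢
    rw [← mul_sub, hw]; ring
  rw [e3, e2] at hlt
  have hw0 : w = 0 := by
    by_contra hne
    have h10 : 1 ≤ w ^ 2 := by have := sq_nonneg w; have := pow_ne_zero 2 hne; omega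
    have h11 : (1 : ℤ) ≤ 2 ^ (d - l) := one_le_pow₀ (by norm_num)
    have h12 : (1 : ℤ) ≤ 2 ^ (d - l) * w ^ 2 := by nlinarith
    have h13 : (0 : ℤ) < 2 ^ l * 2 ^ (d - l) * 4 := by positivity
    nlinarith
  rw [hZ 0, hZ ((2 ^ (l - 1) : ℕ) : ℤ)]
  have : Z 0 = Z ((2 ^ (l - 1) : ℕ) : ℤ) := by rw [hw0] at hw; omega
  rw [this]

end

end PartM9

section PartM10

section
variable {G : Type} [Group G] [Fintype G] {r s g : G} {v l : ℕ} {C N Ch : Subgroup G}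
variable {V : Type} [AddCommGroup V] [Module ℂ V] [FiniteDimensional ℂ V]

theorem eig_conj (ρ : Representation ℂ G V) {r s : G} (hsr : s * r * s⁻¹ = r⁻¹) {m : ℕ} (hm : 0 < m) (hr : r ^ m = 1)
    {ζ : ℂ} (hζ : IsPrimitiveRoot ζ m) (j : ℤ) : ρ s * eigProj ρ r m ζ j = eigProj ρ r m ζ (-j) * ρ s := by
  have : NeZero m := ⟨hm.ne'⟩
  rw [eigProj, eigProj, mul_smul_comm, smul_mul_assoc]
  congr 1
  rw [Finset.mul_sum, Finset.sum_mul]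
  rw [← sum_range_neg (N := m) (fun i : ℤ => (ζ ^ (-(i * (-j))) • ρ (r ^ i)) * ρ s)]
  · apply Finset.sum_congr rfl
    intro i _
    rw [mul_smul_comm, smul_mul_assoc, ← map_mul, ← map_mul]
    congr 2
    · ring
    · have : r ^ (-(i : ℤ)) = s * r ^ (i : ℤ) * s⁻¹ := by rw [← conj_zpow, hsr, inv_zpow, zpow_neg]
      rw [this]; group
  · intro i
    congr 2
    · rw [show -((i + (m : ℤ)) * (-j)) = -(i * (-j)) + (m : ℤ) * j by ring,
            zpow_add₀ (hζ.ne_zero hm.ne'), zpow_mul _ (m : ℤ), zpow_natCast, hζ.pow_eq_one, one_zpow, mul_one]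
    · rw [zpow_add, zpow_natCast, hr, mul_one]

theorem pphi_set_comm (ρ : Representation ℂ G V) (A : Finset (N → ℂ)) (t : G) (ht : ∀ x ∈ N, t * x * t⁻¹ ∈ N)
    (ht' : ∀ x ∈ N, t⁻¹ * x * t ∈ N) (hA : ∀ φ ∈ A, (fun x => φ (cj t ht ht' x)) ∈ A) :
    Commute (ρ t) (∑ φ ∈ A, pphi ρ N φ) := by
  obtain ⟨F, hF⟩ : ∃ F : (N → ℂ) → (N → ℂ), ∀ φ, F φ = fun x => φ (cj t ht ht' x) := ⟨_, fun _ => rfl⟩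
  have hinj : Function.Injective F := by
    intro a b hab
    rw [hF, hF] at hab
    funext x
    have := congrFun hab ((cj t ht ht').symm x)
    simpa using this
  have himg : A.image F = A := by
    apply Finset.eq_of_subset_of_card_le
    · intro x hx
      obtain ⟨φ, hφ, rfl⟩ := Finset.mem_image.mp hx
      rw [hF]; exact hA φ hφ
    · rw [Finset.card_image_of_injective _ hinj]
  change ρ t * _ = _ * ρ t
  conv_lhs => rw [← himg]
  rw [Finset.sum_image (fun a _ b _ hab => hinj hab), Finset.mul_sum, Finset.sum_mul]
  apply Finset.sum_congr rfl
  intro φ _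
  rw [hF, pphi_conj]

theorem pphi_set_idem (ρ : Representation ℂ G V) (A : Finset (N → ℂ)) (hA : ∀ φ ∈ A, IsIrreducibleCharacter φ) :
    (∑ φ ∈ A, pphi ρ N φ) * (∑ φ ∈ A, pphi ρ N φ) = ∑ φ ∈ A, pphi ρ N φ := by
  rw [Finset.sum_mul]
  apply Finset.sum_congr rfl
  intro φ hφ
  rw [Finset.mul_sum, Finset.sum_eq_single φ]
  · rw [pphi_mul ρ N (hA _ hφ) (hA _ hφ), if_pos rfl]
  · intro ψ hψ hne
    rw [pphi_mul ρ N (hA _ hφ) (hA _ hψ), if_neg (Ne.symm hne)]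
  · intro h; exact absurd hφ h

theorem zext_cj (φ : N → ℂ) (t : G) (ht : ∀ x ∈ N, t * x * t⁻¹ ∈ N)
    (ht' : ∀ x ∈ N, t⁻¹ * x * t ∈ N) (y : G) :
    zext N (fun x => φ (cj t ht ht' x)) y = zext N φ (t * y * t⁻¹) := by
  by_cases hy : y ∈ N
  · have h2 := ht y hy
    rw [zext, zext, dif_pos hy, dif_pos h2]; rfl
  · have h2 : t * y * t⁻¹ ∉ N := by
      intro h
      apply hy
      have := ht' _ h
      have e : t⁻¹ * (t * y * t⁻¹) * t = y := by group
      rwa [e] at this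
    rw [zext, zext, dif_neg hy, dif_neg h2]

theorem stab_cj (φ : N → ℂ) (t : G) (ht : ∀ x ∈ N, t * x * t⁻¹ ∈ N)
    (ht' : ∀ x ∈ N, t⁻¹ * x * t ∈ N) (u : G) (hu : t * u * t⁻¹ ∈ stabG (zext N φ)) :
    u ∈ stabG (zext N (fun x => φ (cj t ht ht' x))) := by
  rw [mem_stabG] at hu ⊢
  intro y
  rw [zext_cj, zext_cj, ← hu (t * y * t⁻¹)]
  congr 1; group

theorem CSetup.not_C (h : CSetup r s g v l C N Ch) (a : ℤ) : s * r ^ a ∉ C := by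
  intro hm
  have hs : s ∈ C := by
    have := C.mul_mem hm (C.inv_mem (C.zpow_mem h.hrC a))
    simpa using this
  have h1 := (h.hC s).mp hs
  have h2 := h.hsg
  rw [h1] at h2
  have h3 : g ^ 2 = 1 := by
    rw [mul_inv_cancel_right] at h2
    rw [pow_two]; nth_rw 1 [h2]; simp
  have h4 := orderOf_dvd_of_pow_eq_one h3
  rw [h.ord] at h4
  have h5 : 2 ^ 2 ≤ 2 ^ l := Nat.pow_le_pow_right (by norm_num) h.hl
  have := Nat.le_of_dvd (by norm_num) h4
  omega

theorem CSetup.trace_bound [Nontrivial V] (h : CSetup r s g v l C N Ch) (hG : GSetup r s v) (ρ : Representation ℂ G V) (hS : SchurRep ρ)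
    (hχ : IsIrreducibleCharacter ρ.character) (c : ℕ) (hc : Nat.card G = c * Module.finrank ℂ V)
    (hk : ¬ 2 ^ (l + 1) ∣ c) {ζ : ℂ} (hζ : IsPrimitiveRoot ζ (2 ^ v)) (j : ℤ) (hj : ((2 ^ v : ℕ) : ℤ) ∣ 2 * j) :
    ∃ (a : ℤ) (b : ℕ), LinearMap.trace ℂ V (ρ s * eigProj ρ r (2 ^ v) ζ j) = a ∧
      LinearMap.trace ℂ V (eigProj ρ r (2 ^ v) ζ (j + (2 ^ (l - 1) : ℕ))) = b ∧ |a| ≤ b := by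
  have hl := h.hl
  have hlv := h.hlv
  have hpos : 0 < 2 ^ v := by positivity
  have hr1 : r ^ (2 ^ v) = 1 := by rw [← h.hr, pow_orderOf_eq_one]
  have hrs : ∀ i : ℤ, s * r ^ i * s⁻¹ = r ^ (-i) := by
    intro i; rw [← conj_zpow, h.hsr, inv_zpow, zpow_neg]
  obtain ⟨A, hA⟩ : ∃ A : Finset (N → ℂ), ∀ φ, φ ∈ A ↔ IsIrreducibleCharacter φ ∧ ∃ a : ℤ, s * r ^ a ∈ stabG (zext N φ) :=
    ⟨(IrrF N).filter (fun φ => ∃ a : ℤ, s * r ^ a ∈ stabG (zext N φ)), fun φ => by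
      rw [Finset.mem_filter, mem_IrrF]⟩
  have hAsub : A ⊆ IrrF N := by
    intro φ hφ; rw [mem_IrrF]; exact ((hA φ).mp hφ).1
  obtain ⟨q, hq⟩ : ∃ q, q = ∑ φ ∈ A, pphi ρ N φ := ⟨_, rfl⟩
  have hqq : q * q = q := by rw [hq]; exact pphi_set_idem ρ A (fun φ hφ => ((hA φ).mp hφ).1)
  have hrCh : r ∈ Ch := h.hCCh h.hrC
  have hrq : Commute (ρ r) q := by
    rw [hq]
    apply pphi_set_comm ρ A r (fun x hx => h.hconj _ hrCh x hx) (h.conj' _ hrCh)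
    intro φ hφ
    obtain ⟨hi, a, ha⟩ := (hA φ).mp hφ
    refine (hA _).mpr ⟨irr_comp _ hi, a + 2, stab_cj _ _ _ _ _ ?_⟩
    have e : r * (s * r ^ (a + 2)) * r⁻¹ = s * r ^ a := by
      have h1 : r = s * r⁻¹ * s⁻¹ := by
        have := hrs (-1); simp at this; exact this.symm
      have h2 : r * s = s * r⁻¹ := by nth_rw 1 [h1]; group
      rw [← mul_assoc, h2, zpow_add]; group
    rw [e]; exact ha
  have hsq : Commute (ρ s) q := by
    rw [hq]
    apply pphi_set_comm ρ A s (fun x hx => h.hconj _ h.hsCh x hx) (h.conj' _ h.hsCh)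
    intro φ hφ
    obtain ⟨hi, a, ha⟩ := (hA φ).mp hφ
    refine (hA _).mpr ⟨irr_comp _ hi, -a, stab_cj _ _ _ _ _ ?_⟩
    have e : s * (s * r ^ (-a)) * s⁻¹ = s * r ^ a := by
      have := hrs (-a)
      rw [neg_neg] at this
      rw [mul_assoc, this]
    rw [e]; exact ha
  have hEq : ∀ i, Commute (eigProj ρ r (2 ^ v) ζ i) q := fun i => eig_comm ρ q hrq i
  have hEE := fun i => eig_idem ρ hpos hr1 hζ i
  have hEqI : ∀ i, (eigProj ρ r (2 ^ v) ζ i * q) * (eigProj ρ r (2 ^ v) ζ i * q) = eigProj ρ r (2 ^ v) ζ i * q := by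
    intro i
    rw [mul_assoc, ← mul_assoc q, ← (hEq i).eq, mul_assoc, hqq, ← mul_assoc, hEE]
  have hsE : ρ s * eigProj ρ r (2 ^ v) ζ j = eigProj ρ r (2 ^ v) ζ j * ρ s := by
    rw [eig_conj ρ h.hsr hpos hr1 hζ j, eig_per ρ hpos hr1 hζ (-j) j (by
      rw [show -j - j = -(2 * j) by ring, dvd_neg]; exact hj)]
  have hss : ρ s * ρ s = 1 := by rw [← map_mul, hG.hs, map_one]
  obtain ⟨a, b, ha, hb, hab, -⟩ := tr_inv_le (ρ s) (eigProj ρ r (2 ^ v) ζ j * q) hss (hEqI j) (by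
    rw [← mul_assoc, hsE, mul_assoc, hsq.eq, mul_assoc])
  -- trace equality
  have htr : LinearMap.trace ℂ V (ρ s * eigProj ρ r (2 ^ v) ζ j) = a := by
    rw [← ha, ← mul_assoc, hq]
    have e1 : ρ s * eigProj ρ r (2 ^ v) ζ j = ρ s * eigProj ρ r (2 ^ v) ζ j * ∑ φ ∈ IrrF N, pphi ρ N φ := by
      rw [pphi_sum, mul_one]
    conv_lhs => rw [e1]
    rw [Finset.mul_sum, Finset.mul_sum, map_sum, map_sum]
    symm
    apply Finset.sum_subset hAsub
    intro φ hφ hφA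
    rw [mem_IrrF] at hφ
    have hn : ∀ a : ℤ, s * r ^ a ∉ stabG (zext N φ) := fun a ha => hφA ((hA φ).mpr ⟨hφ, a, ha⟩)
    rw [pphi_trace, eigProj, mul_smul_comm, mlt_smul, Finset.mul_sum, mlt_sum, Finset.sum_eq_zero, mul_zero, mul_zero]
    intro i _
    have hm : s * r ^ (i : ℤ) ∈ Ch := Ch.mul_mem h.hsCh (h.rCh i)
    rw [mul_smul_comm, mlt_smul, ← map_mul, mlt_not_stab ρ N hφ _ (fun x hx => h.hconj _ hm x hx) (h.conj' _ hm) (hn _), mul_zero]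
  have hgood : ∀ φ ∈ A, mlt ρ N φ (eigProj ρ r (2 ^ v) ζ j) = mlt ρ N φ (eigProj ρ r (2 ^ v) ζ (j + (2 ^ (l - 1) : ℕ))) := by
    intro φ hφ
    obtain ⟨hi, a, ha⟩ := (hA φ).mp hφ
    have hω : IsPrimitiveRoot (ζ ^ (2 ^ (v - l))) (2 ^ l) :=
      IsPrimitiveRoot.pow (by positivity) hζ (by rw [← pow_add]; congr 1; omega)
    have hgl : g ^ (2 ^ l) = 1 := by rw [← h.ord, pow_orderOf_eq_one]
    obtain ⟨Y, hY1, hY2, hY3, hY4⟩ := mlt_eig ρ N φ hi (m := 2 ^ l) (by positivity) hgl hω (fun x => h.comm x)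
    have hge := h.good_eq hG ρ hS hχ c hc hk hi _ (Ch.mul_mem h.hsCh (h.rCh a)) ha (h.not_C a) hζ Y hY2 hY3 hY4
    have h0 := fun i hi => h.mlt_zero hG ρ hS hχ c hc hk φ i hi
    have hE : ∀ i, ((2 ^ v : ℕ) : ℂ) * mlt ρ N φ (eigProj ρ r (2 ^ v) ζ i) = ((2 ^ l : ℕ) : ℂ) * Y i := by
      intro i
      have := h.eigR ρ φ h0 v hlv le_rfl ζ i
      rw [← hY4, Nat.sub_self, pow_zero, pow_one] at this
      exact this
    have hp : ((2 ^ v : ℕ) : ℂ) ≠ 0 := by exact_mod_cast hpos.ne'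
    apply mul_left_cancel₀ hp
    rw [hE, hE]
    congr 2
    have hl2 : 2 ^ l = 2 * 2 ^ (l - 1) := by rw [← pow_succ']; congr 1; omega
    have hd : ((2 ^ l : ℕ) : ℤ) ∣ 2 * j := by
      refine dvd_trans ?_ hj
      exact_mod_cast pow_dvd_pow 2 hlv
    rw [hl2] at hd
    obtain ⟨m, hm⟩ : ((2 ^ (l - 1) : ℕ) : ℤ) ∣ j := by
      push_cast at hd ⊢; exact Int.dvd_of_mul_dvd_mul_left (by norm_num) hd
    have : NeZero (2 ^ l) := ⟨by positivity⟩
    rcases Int.even_or_odd' m with ⟨u, hu | hu⟩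
    · rw [periodic_congr Y hY2 (a := j) (b := 0) ⟨u, by rw [hm, hu, hl2]; push_cast; ring⟩,
        periodic_congr Y hY2 (a := j + (2 ^ (l - 1) : ℕ)) (b := (2 ^ (l - 1) : ℕ)) ⟨u, by rw [hm, hu, hl2]; push_cast; ring⟩, hge]
    · rw [periodic_congr Y hY2 (a := j) (b := (2 ^ (l - 1) : ℕ)) ⟨u, by rw [hm, hu, hl2]; push_cast; ring⟩,
        periodic_congr Y hY2 (a := j + (2 ^ (l - 1) : ℕ)) (b := 0) ⟨u + 1, by rw [hm, hu, hl2]; push_cast; ring⟩, hge]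
  have htq : ∀ i, LinearMap.trace ℂ V (eigProj ρ r (2 ^ v) ζ i * q) = ∑ φ ∈ A, φ 1 * mlt ρ N φ (eigProj ρ r (2 ^ v) ζ i) := by
    intro i
    rw [hq, Finset.mul_sum, map_sum]
    exact Finset.sum_congr rfl fun φ _ => pphi_trace ρ N φ _
  have hb2 : LinearMap.trace ℂ V (eigProj ρ r (2 ^ v) ζ (j + (2 ^ (l - 1) : ℕ)) * q) = b := by
    rw [← hb, htq, htq]
    exact Finset.sum_congr rfl fun φ hφ => by rw [hgood φ hφ]
  obtain ⟨E, hE⟩ : ∃ E, E = eigProj ρ r (2 ^ v) ζ (j + (2 ^ (l - 1) : ℕ)) := ⟨_, rfl⟩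
  have hEi := hEE (j + (2 ^ (l - 1) : ℕ))
  have hEc := hEq (j + (2 ^ (l - 1) : ℕ))
  rw [← hE] at hb2 hEi hEc ⊢
  have hid : (E - E * q) * (E - E * q) = E - E * q := by
    have e1 : E * (E * q) = E * q := by rw [← mul_assoc, hEi]
    have e2 : E * q * E = E * q := by rw [hEc.eq, mul_assoc, hEi]
    have e3 : E * q * (E * q) = E * q := by rw [← mul_assoc, e2, mul_assoc, hqq]
    rw [sub_mul, mul_sub, mul_sub, hEi, e1, e2, e3]; abel
  have hn := idem_trace_nat _ hid
  refine ⟨a, b + Module.finrank ℂ (LinearMap.range (E - E * q)), htr, ?_, ?_⟩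
  · rw [Nat.cast_add, ← hn, ← hb2, ← map_add]
    congr 1; abel
  · push_cast; omega

end

end PartM10

section PartM11

section
variable {G : Type} [Group G] [Fintype G] {r s : G} {v : ℕ}
variable {V : Type} [AddCommGroup V] [Module ℂ V] [FiniteDimensional ℂ V] [Nontrivial V]

theorem GSetup.ord_zpow (h : GSetup r s v) (l : ℕ) (hlv : l ≤ v) (i : ℤ) (hi : ¬ (2 : ℤ) ^ (v - l) ∣ i) :
    2 ^ (l + 1) ∣ orderOf (r ^ i) := by
  have he : (r ^ i) ^ orderOf (r ^ i) = 1 := pow_orderOf_eq_one _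
  obtain ⟨o, ho⟩ : ∃ o, o = orderOf (r ^ i) := ⟨_, rfl⟩
  rw [← ho] at he ⊢
  rw [← zpow_natCast, ← zpow_mul] at he
  have h6 := orderOf_dvd_iff_zpow_eq_one.mpr he
  rw [h.hr] at h6
  push_cast at h6
  have hvl : v - l ≠ 0 := by
    intro h0
    rw [h0] at hi
    simp at hi
  have h7 := two_pow_dvd_of (c := i.natAbs) (k := v - l - 1) (d := v) (D := (o : ℤ)) (by
    have : v - l - 1 + 1 = v - l := by omega
    rw [this]
    intro hd
    apply hi
    rw [← Int.dvd_natAbs]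
    exact_mod_cast hd) (by
    rcases Int.natAbs_eq i with e | e
    · rwa [← e]
    · rw [e] at h6
      rw [neg_mul, dvd_neg] at h6
      exact h6)
  have e : v - (v - l - 1) = l + 1 := by omega
  rw [e] at h7
  exact_mod_cast h7

theorem GSetup.data {b k : ℕ} (h : GSetup r s (b + (k + 1))) (ρ : Representation ℂ G V) (hS : SchurRep ρ)
    (hχ : IsIrreducibleCharacter ρ.character) (c : ℕ) (hc : Nat.card G = c * Module.finrank ℂ V)
    (hk : ¬ 2 ^ (k + 1 + 1) ∣ c) {ζ : ℂ} (hζ : IsPrimitiveRoot ζ (2 ^ (b + (k + 1)))) :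
    ∃ (y : ℤ → ℕ) (A B : ℤ),
      (∀ j, LinearMap.trace ℂ V (eigProj ρ r (2 ^ (b + (k + 1))) ζ j) = y j) ∧
      (∀ j, y (j + (2 ^ (k + 1) : ℕ)) = y j) ∧ (∀ j, y (-j) = y j) ∧
      (∀ i : ℤ, ρ.character (r ^ i) = ∑ j ∈ Finset.range (2 ^ (b + (k + 1))), ζ ^ (i * j) * y j) ∧
      LinearMap.trace ℂ V (ρ s * eigProj ρ r (2 ^ (b + (k + 1))) ζ 0) = A ∧
      LinearMap.trace ℂ V (ρ s * eigProj ρ r (2 ^ (b + (k + 1))) ζ (2 ^ (b + k) : ℕ)) = B ∧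
      (∀ i : ℤ, ρ.character (s * r ^ i) = ((if 2 ∣ i then A + B else A - B : ℤ) : ℂ)) ∧
      |A| ≤ y 0 ∧ |B| ≤ y (2 ^ (b + k) : ℕ) ∧ (2 : ℤ) ∣ A - y 0 ∧ (2 : ℤ) ∣ B - y (2 ^ (b + k) : ℕ) := by
  have hpos : 0 < 2 ^ (b + (k + 1)) := by positivity
  have hr1 : r ^ (2 ^ (b + (k + 1))) = 1 := by rw [← h.hr, pow_orderOf_eq_one]
  have hz0 : ζ ≠ 0 := hζ.ne_zero hpos.ne'
  have hEE := fun j => eig_idem ρ hpos hr1 hζ j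
  have hm2 : 2 ^ (b + (k + 1)) = 2 * 2 ^ (b + k) := by rw [← pow_succ']; congr 1
  have hty : ∀ j, ∃ n : ℕ, LinearMap.trace ℂ V (eigProj ρ r (2 ^ (b + (k + 1))) ζ j) = n :=
    fun j => ⟨_, idem_trace_nat _ (hEE j)⟩
  choose y hy using hty
  have hss : ρ s * ρ s = 1 := by rw [← map_mul, h.hs, map_one]
  have hconj := fun j => eig_conj ρ h.hsr hpos hr1 hζ j
  have hsE : ∀ j, ((2 ^ (b + (k + 1)) : ℕ) : ℤ) ∣ 2 * j → ρ s * eigProj ρ r (2 ^ (b + (k + 1))) ζ j = eigProj ρ r (2 ^ (b + (k + 1))) ζ j * ρ s := by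
    intro j hj
    rw [hconj j, eig_per ρ hpos hr1 hζ (-j) j (by
      rw [show -j - j = -(2 * j) by ring, dvd_neg]; exact hj)]
  obtain ⟨A, a', hA, ha', hAb, hAp⟩ := tr_inv_le (ρ s) _ hss (hEE 0) (hsE 0 (by simp))
  obtain ⟨B, b', hB, hb', hBb, hBp⟩ := tr_inv_le (ρ s) _ hss (hEE (2 ^ (b + k) : ℕ)) (hsE (2 ^ (b + k) : ℕ) (by
    rw [hm2]; push_cast; rfl))
  have ea : a' = y 0 := by rw [hy] at ha'; exact_mod_cast ha'.symm
  have eb : b' = y (2 ^ (b + k) : ℕ) := by rw [hy] at hb'; exact_mod_cast hb'.symm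
  subst ea; subst eb
  have hζ2 : ζ ^ (2 ^ (b + k)) = -1 :=
    IsPrimitiveRoot.eq_neg_one_of_two_right (IsPrimitiveRoot.pow hpos hζ (by rw [hm2, mul_comm]))
  refine ⟨y, A, B, hy, ?_, ?_, ?_, hA, hB, ?_, hAb, hBb, hAp, hBp⟩
  · intro j
    have : (y (j + (2 ^ (k + 1) : ℕ)) : ℂ) = y j := by
      rw [← hy, ← hy]
      have t1 := fun j => eig_trace ρ (g := r) (N := 2 ^ (b + (k + 1))) (ω := ζ) 1 j
      simp only [mul_one] at t1
      rw [t1, t1]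
      congr 1
      apply Finset.sum_congr rfl
      intro i _
      by_cases hi : (2 : ℤ) ^ (b + (k + 1) - (k + 1)) ∣ (i : ℤ)
      · congr 1
        rw [Nat.add_sub_cancel] at hi
        obtain ⟨u, hu⟩ := hi
        rw [hu, show -((2 : ℤ) ^ b * u * (j + (2 ^ (k + 1) : ℕ))) = -(2 ^ b * u * j) + ((2 ^ (b + (k + 1)) : ℕ) : ℤ) * (-u) by
          push_cast; rw [pow_add]; ring, zpow_add₀ hz0, zpow_mul _ ((2 ^ (b + (k + 1)) : ℕ) : ℤ), zpow_natCast, hζ.pow_eq_one, one_zpow, mul_one]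
      · have h1 := h.ord_zpow (k + 1) (by omega) i hi
        have h2 := h.vanish ρ hS hχ c (k + 1) hc hk _ h1 ((pow_dvd_pow 2 (by omega : 2 ≤ k + 1 + 1)).trans h1)
        have h3 : LinearMap.trace ℂ V (ρ (r ^ (i : ℤ))) = 0 := h2
        rw [h3, mul_zero, mul_zero]
    exact_mod_cast this
  · intro j
    have : (y (-j) : ℂ) = y j := by
      rw [← hy, ← hy]
      have e : eigProj ρ r (2 ^ (b + (k + 1))) ζ (-j) = ρ s * eigProj ρ r (2 ^ (b + (k + 1))) ζ j * ρ s := by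
        rw [hconj, mul_assoc, hss, mul_one]
      rw [e, mul_assoc, LinearMap.trace_mul_comm, mul_assoc, hss, mul_one]
    exact_mod_cast this
  · intro i
    have := eig_trace_sum ρ hpos hr1 hζ 1 i
    simp only [mul_one, hy] at this
    exact this
  · intro i
    have h1 : ρ.character (s * r ^ i) = LinearMap.trace ℂ V (ρ (r ^ i) * ρ s) := by
      rw [LinearMap.trace_mul_comm, ← map_mul]; rfl
    rw [h1, eig_trace_sum ρ hpos hr1 hζ (ρ s) i]
    have hcm : ∀ j, LinearMap.trace ℂ V (eigProj ρ r (2 ^ (b + (k + 1))) ζ j * ρ s) = LinearMap.trace ℂ V (ρ s * eigProj ρ r (2 ^ (b + (k + 1))) ζ j) :=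
      fun j => LinearMap.trace_mul_comm _ _ _
    simp only [hcm]
    obtain ⟨F, hF⟩ : ∃ F : ℤ → ℂ, ∀ j, F j = ζ ^ (i * j) * LinearMap.trace ℂ V (ρ s * eigProj ρ r (2 ^ (b + (k + 1))) ζ j) := ⟨_, fun _ => rfl⟩
    simp only [← hF]
    have hF0 : ∀ j, ¬ ((2 ^ (b + (k + 1)) : ℕ) : ℤ) ∣ 2 * j → F j = 0 := by
      intro j hj
      rw [hF, ← hEE j, ← mul_assoc, hconj, mul_assoc, LinearMap.trace_mul_comm, mul_assoc, eig_mul_eig ρ hpos hr1 hζ, if_neg, mul_zero, map_zero, mul_zero]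
      rw [show -j - j = -(2 * j) by ring, dvd_neg]; exact hj
    have hFp : ∀ j, F (j + (2 * 2 ^ (b + k) : ℕ)) = F j := by
      intro j
      rw [← hm2, hF, hF, eig_per ρ hpos hr1 hζ _ j (by simp)]
      congr 1
      rw [show i * (j + (2 ^ (b + (k + 1)) : ℕ)) = i * j + ((2 ^ (b + (k + 1)) : ℕ) : ℤ) * i by ring,
        zpow_add₀ hz0, zpow_mul _ ((2 ^ (b + (k + 1)) : ℕ) : ℤ), zpow_natCast, hζ.pow_eq_one, one_zpow, mul_one]
    rw [hm2, sum_range_pair F _ (by positivity) hFp, Finset.sum_eq_zero, add_zero, hF, hF, hA, hB]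
    · rw [mul_zero, zpow_zero, one_mul, mul_comm i, zpow_mul, zpow_natCast, hζ2]
      split_ifs with h2
      · rw [(even_iff_two_dvd.mpr h2).neg_one_zpow]; push_cast; ring
      · rw [Odd.neg_one_zpow (by rw [← Int.not_even_iff_odd, even_iff_two_dvd]; exact h2)]; push_cast; ring
    · intro c hc
      have hlt := Finset.mem_range.mp hc
      have hn : ¬ ((2 ^ (b + (k + 1)) : ℕ) : ℤ) ∣ 2 * ((c : ℤ) + 1) := by
        intro hd
        rw [hm2] at hd
        have h3 : 2 * 2 ^ (b + k) ∣ 2 * (c + 1) := by exact_mod_cast hd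
        have := Nat.le_of_dvd (by omega) h3
        omega
      rw [hF0 _ hn, hF0, add_zero]
      rw [mul_neg, dvd_neg]; exact hn

end

end PartM11

section PartM12

section
variable {G : Type} [Group G] [Fintype G]
variable {V : Type} [AddCommGroup V] [Module ℂ V] [FiniteDimensional ℂ V] [Nontrivial V]

theorem sum_two_period {R : Type*} [AddCommMonoid R] (f : ℤ → R) (N q : ℕ) (hf : ∀ i, f (i + N) = f i) :
    ∑ j ∈ Finset.range (N * q), f j = q • ∑ c ∈ Finset.range N, f c := by
  rw [sum_range_block]
  have : ∀ i ∈ Finset.range q, ∑ c ∈ Finset.range N, f (c + N * i) = ∑ c ∈ Finset.range N, f c := by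
    intro i _
    apply Finset.sum_congr rfl
    intro c _
    exact periodic_congr f hf ⟨i, by ring⟩
  rw [Finset.sum_congr rfl this, Finset.sum_const, Finset.card_range]

theorem neg_one_zpow_per (j : ℤ) : (-1 : ℂ) ^ (j + (2 : ℕ)) = (-1) ^ j := by
  rw [zpow_add₀ (by norm_num)]; norm_num

theorem GSetup.k1 {b : ℕ} {ρ : Representation ℂ G V} (hS : SchurRep ρ)
    (H : Subgroup G) (e : DihedralGroup (2 ^ (b + (0 + 1))) ≃* H)
    (c : ℕ) (hc : Nat.card G = c * Module.finrank ℂ V)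
    (hk1 : 2 ^ (0 + 1) ∣ c) (hk : ¬ 2 ^ (0 + 1 + 1) ∣ c) {ζ : ℂ} (hζ : IsPrimitiveRoot ζ (2 ^ (b + (0 + 1))))
    (y : ℤ → ℕ) (hyp : ∀ j, y (j + (2 ^ (0 + 1) : ℕ)) = y j)
    (hX : ∀ i : ℤ, ρ.character ((e (DihedralGroup.r 1) : G) ^ i) = ∑ j ∈ Finset.range (2 ^ (b + (0 + 1))), ζ ^ (i * j) * y j)
    (j : ℤ) (η : ℂ) (hη : η * η = 1) (hj : ζ ^ (-j) = η) (a : ℤ)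
    (ha : LinearMap.trace ℂ V (ρ (e (DihedralGroup.sr 0) : G) * eigProj ρ (e (DihedralGroup.r 1) : G) (2 ^ (b + (0 + 1))) ζ j) = a)
    (j' : ℤ) (hj' : η ^ (2 ^ b) = (-1) ^ (j' + 1)) : |a| ≤ y j' := by
  have hpos : 0 < 2 ^ (b + (0 + 1)) := by positivity
  have hm2 : 2 ^ (b + (0 + 1)) = 2 * 2 ^ b := by rw [← pow_succ']
  have hζ2 : ζ ^ (2 ^ b) = -1 :=
    IsPrimitiveRoot.eq_neg_one_of_two_right (IsPrimitiveRoot.pow hpos hζ (by rw [hm2, mul_comm]))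
  obtain ⟨c', rfl⟩ := hk1
  obtain ⟨a', h1, D, h2, h3⟩ := k1_bound ρ hS c' (by rw [hc]; norm_num) (by
    intro hd; apply hk; obtain ⟨w, rfl⟩ := hd; exact ⟨w, by ring⟩) b _ hm2 H e η hη
  have haa : a' = a := by
    have : (a' : ℂ) = a := by
      rw [← h1, ← ha, LinearMap.trace_mul_comm, eig_trace]
      congr 1
      apply Finset.sum_congr rfl
      intro i _
      rw [← map_mul, zpow_natCast]
      congr 1
      rw [← hj, ← zpow_natCast, ← zpow_mul]; congr 1; ring
    exact_mod_cast this
  subst haa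
  have hyp2 : ∀ j, y (j + (2 : ℕ)) = y j := hyp
  have hf0 : (Module.finrank ℂ V : ℂ) = 2 ^ b * ((y 0 : ℂ) + y 1) := by
    have h4 := hX 0
    simp only [zpow_zero, zero_mul, one_mul, Representation.char_one] at h4
    rw [h4, hm2, sum_two_period (fun j => (y j : ℂ)) 2 _ (by intro i; simp only [hyp2])]
    simp [Finset.sum_range_succ]; ring
  have hf1 : ρ.character ((e (DihedralGroup.r 1) : G) ^ (2 ^ b)) = 2 ^ b * ((y 0 : ℂ) - y 1) := by
    have h4 := hX ((2 ^ b : ℕ) : ℤ)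
    rw [zpow_natCast] at h4
    simp only [zpow_mul, zpow_natCast ζ, hζ2] at h4
    rw [h4, hm2, sum_two_period (fun j => (-1 : ℂ) ^ j * (y j : ℂ)) 2 _ (by intro i; simp only [hyp2, neg_one_zpow_per])]
    simp [Finset.sum_range_succ]; ring
  have hD : D = 2 ^ b * y j' := by
    have : (D : ℂ) = ((2 ^ b * y j' : ℕ) : ℂ) := by
      rw [← h2, hj', hf0, hf1]
      rcases Int.even_or_odd' j' with ⟨u, hu | hu⟩
      · rw [periodic_congr y hyp2 (a := j') (b := 0) ⟨u, by rw [hu]; push_cast; ring⟩, Odd.neg_one_zpow ⟨u, by rw [hu]⟩]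
        push_cast; ring
      · rw [periodic_congr y hyp2 (a := j') (b := 1) ⟨u, by rw [hu]; push_cast; ring⟩, Even.neg_one_zpow ⟨u + 1, by rw [hu]; ring⟩]
        push_cast; ring
    exact_mod_cast this
  rw [hD] at h3
  push_cast at h3
  exact le_of_mul_le_mul_left h3 (by positivity)

theorem mid {b k : ℕ} {ρ : Representation ℂ G V} (hS : SchurRep ρ)
    (hχ : IsIrreducibleCharacter ρ.character)
    (H : Subgroup G) (e : DihedralGroup (2 ^ (b + (k + 1))) ≃* H)
    (h : GSetup (e (DihedralGroup.r 1) : G) (e (DihedralGroup.sr 0) : G) (b + (k + 1)))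
    (c : ℕ) (hc : Nat.card G = c * Module.finrank ℂ V)
    (hk1 : 2 ^ (k + 1) ∣ c) (hk : ¬ 2 ^ (k + 1 + 1) ∣ c) (hG : 2 ^ (b + (k + 1) + 1) ∣ Nat.card G) :
    (fun x => ρ.character (e x : G)) ∈ AddSubmonoid.closure (GenSet (P := DihedralGroup (2 ^ (b + (k + 1)))) (2 ^ (b + 1))) := by
  have : NeZero (2 ^ (b + (k + 1))) := ⟨by positivity⟩
  have hζ := psi_prim (m := 2 ^ (b + (k + 1)))
  obtain ⟨ζ, hζe⟩ : ∃ ζ : ℂ, ζ = ZMod.stdAddChar (1 : ZMod (2 ^ (b + (k + 1)))) := ⟨_, rfl⟩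
  rw [← hζe] at hζ
  have hpos : 0 < 2 ^ (b + (k + 1)) := by positivity
  have hm2 : 2 ^ (b + (k + 1)) = 2 * 2 ^ (b + k) := by rw [← pow_succ']; congr 1
  have hζ2 : ζ ^ (2 ^ (b + k)) = -1 :=
    IsPrimitiveRoot.eq_neg_one_of_two_right (IsPrimitiveRoot.pow hpos hζ (by rw [hm2, mul_comm]))
  obtain ⟨y, A, B, hy, hyp, hyn, hX, hA, hB, hs, hAb, hBb, hAp, hBp⟩ := h.data ρ hS hχ c hc hk hζ
  -- parity
  have hpar : (2 : ℤ) ∣ y 0 - y (2 ^ k : ℕ) := by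
    have h4 := hX 0
    simp only [zpow_zero, zero_mul, one_mul, Representation.char_one] at h4
    have e1 : 2 ^ (b + (k + 1)) = 2 ^ (k + 1) * 2 ^ b := by rw [← pow_add]; congr 1; omega
    rw [e1, sum_two_period (fun j => (y j : ℂ)) (2 ^ (k + 1)) _ (by intro i; simp only [hyp])] at h4
    have h5 : Module.finrank ℂ V = 2 ^ b * ∑ c ∈ Finset.range (2 ^ (k + 1)), y c := by
      rw [nsmul_eq_mul] at h4
      exact_mod_cast h4
    have h6 := two_pow_dvd_of (d := b + (k + 1) + 1) (D := (Module.finrank ℂ V : ℤ)) hk (by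
      rw [hc] at hG; exact_mod_cast hG)
    rw [show b + (k + 1) + 1 - (k + 1) = b + 1 by omega, h5, pow_succ] at h6
    push_cast at h6
    have h7 := Int.dvd_of_mul_dvd_mul_left (by positivity) h6
    rw [pow_succ', sum_range_pair (fun j => (y j : ℤ)) (2 ^ k) (by positivity) (by intro i; rw [← pow_succ']; simp only [hyp])] at h7
    have h8 : ∑ c ∈ Finset.range (2 ^ k - 1), ((y ((c : ℤ) + 1) : ℤ) + y (-((c : ℤ) + 1))) =
        2 * ∑ c ∈ Finset.range (2 ^ k - 1), (y ((c : ℤ) + 1) : ℤ) := by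
      rw [Finset.mul_sum]; apply Finset.sum_congr rfl; intro j _; rw [hyn]; ring
    rw [h8] at h7
    omega
  have hA2B2 : |A| ≤ y (2 ^ k : ℕ) ∧ |B| ≤ y ((2 ^ (b + k) : ℕ) + (2 ^ k : ℕ)) := by
    rcases Nat.eq_zero_or_pos k with rfl | hkp
    · constructor
      · apply GSetup.k1 hS H e c hc hk1 hk hζ y hyp hX 0 1 (by norm_num) (by simp) A hA
        norm_num
      · apply GSetup.k1 hS H e c hc hk1 hk hζ y hyp hX (2 ^ (b + 0) : ℕ) (-1) (by norm_num) (by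
          rw [zpow_neg, zpow_natCast, hζ2]; norm_num) B hB
        rw [zpow_add₀ (by norm_num), zpow_add₀ (by norm_num), zpow_natCast]
        norm_num
    · obtain ⟨C, N, Ch, hCS⟩ := csetup _ _ (b + (k + 1)) (k + 1) h.hr h.hsr h.hG (by omega) (by omega)
      constructor
      · obtain ⟨a', b', h1, h2, h3⟩ := hCS.trace_bound h ρ hS hχ c hc hk hζ 0 (by simp)
        rw [hA] at h1
        rw [hy, zero_add] at h2
        have e1 : A = a' := by exact_mod_cast h1
        have e2 : y (2 ^ k : ℕ) = b' := by exact_mod_cast h2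
        rw [e1, e2]; exact h3
      · obtain ⟨a', b', h1, h2, h3⟩ := hCS.trace_bound h ρ hS hχ c hc hk hζ (2 ^ (b + k) : ℕ) (by
          rw [hm2]; push_cast; rfl)
        rw [hB] at h1
        rw [hy] at h2
        have e1 : B = a' := by exact_mod_cast h1
        have e2 : y ((2 ^ (b + k) : ℕ) + (2 ^ k : ℕ)) = b' := by exact_mod_cast h2
        rw [e1, e2]; exact h3
  obtain ⟨hA2, hB2⟩ := hA2B2
  have hr : ∀ i : ℤ, (e (DihedralGroup.r (i : ZMod (2 ^ (b + (k + 1))))) : G) = (e (DihedralGroup.r 1) : G) ^ i := by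
    intro i
    rw [← Subgroup.coe_zpow, ← map_zpow, DihedralGroup.r_one_zpow]
  have hcase : (y (2 ^ (b + k) : ℕ) = y 0 ∧ y ((2 ^ (b + k) : ℕ) + (2 ^ k : ℕ)) = y (2 ^ k : ℕ)) ∨
      (y (2 ^ (b + k) : ℕ) = y (2 ^ k : ℕ) ∧ y ((2 ^ (b + k) : ℕ) + (2 ^ k : ℕ)) = y 0) := by
    rcases Nat.eq_zero_or_pos b with rfl | hb
    · right
      rw [Nat.zero_add]
      refine ⟨rfl, periodic_congr y hyp ⟨1, ?_⟩⟩
      push_cast; ring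
    · left
      obtain ⟨b', rfl⟩ : ∃ b', b = b' + 1 := ⟨b - 1, by omega⟩
      constructor
      · exact periodic_congr y hyp ⟨2 ^ b', by push_cast; ring⟩
      · exact periodic_congr y hyp ⟨2 ^ b', by push_cast; ring⟩
  apply assembly _ ζ hζ y hyp hyn hζe (A := A) (B := B)
  · intro i
    simp only [hr]
    exact hX i
  · intro i
    have e1 : (DihedralGroup.sr (i : ZMod (2 ^ (b + (k + 1))))) = DihedralGroup.sr 0 * DihedralGroup.r (i : ZMod (2 ^ (b + (k + 1)))) := by
      rw [DihedralGroup.sr_mul_r, zero_add]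
    simp only [e1, map_mul, Subgroup.coe_mul, hr]
    exact hs i
  · exact hAb
  · exact hA2
  · rcases hcase with ⟨h1, h2⟩ | ⟨h1, h2⟩
    · rw [← h1]; exact hBb
    · rw [← h2]; exact hB2
  · rcases hcase with ⟨h1, h2⟩ | ⟨h1, h2⟩
    · rw [← h2]; exact hB2
    · rw [← h1]; exact hBb
  · exact hAp
  · rcases hcase with ⟨h1, h2⟩ | ⟨h1, h2⟩
    · rw [← h1]; exact hBp
    · rw [h1] at hBp; omega
  · exact hpar

end

end PartM12

section PartM13

section
variable {G : Type} [Group G] [Fintype G]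

theorem sylow_gsetup (P : Sylow 2 G) {v : ℕ} (e : DihedralGroup (2 ^ v) ≃* ↥(P : Subgroup G))
    (hG : ¬ 2 ^ (v + 2) ∣ Nat.card G) :
    GSetup (e (DihedralGroup.r 1) : G) (e (DihedralGroup.sr 0) : G) v := by
  have : Fact (Nat.Prime 2) := ⟨Nat.prime_two⟩
  have ho : ∀ x, orderOf (e x : G) = orderOf x := by
    intro x
    rw [Subgroup.orderOf_coe, MulEquiv.orderOf_eq]
  refine ⟨?_, ?_, ?_, hG, ?_⟩
  · rw [ho, DihedralGroup.orderOf_r_one]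
  · rw [← Subgroup.coe_inv, ← Subgroup.coe_inv, ← Subgroup.coe_mul, ← Subgroup.coe_mul, ← map_inv, ← map_inv, ← map_mul, ← map_mul]
    simp
  · rw [← Subgroup.coe_mul, ← map_mul]
    simp
  · intro u l hl hu
    have hp : IsPGroup 2 (Subgroup.zpowers u) := IsPGroup.of_card (n := l) (by rw [Nat.card_zpowers, hu])
    obtain ⟨Q, hQ⟩ := hp.exists_le_sylow
    obtain ⟨t, ht⟩ := MulAction.exists_smul_eq G Q P
    have hm : t * u * t⁻¹ ∈ P := by
      rw [← ht]
      have := Subgroup.smul_mem_pointwise_smul u (MulAut.conj t) (Q : Subgroup G) (hQ (Subgroup.mem_zpowers u))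
      rw [MulAut.smul_def, MulAut.conj_apply] at this
      exact this
    obtain ⟨x, hx⟩ := e.surjective ⟨_, hm⟩
    have hx' : (e x : G) = t * u * t⁻¹ := by rw [hx]
    refine ⟨t, ?_⟩
    rcases x with i | i
    · obtain ⟨i, rfl⟩ := ZMod.intCast_surjective i
      refine ⟨i, ?_⟩
      rw [← hx', ← Subgroup.coe_zpow, ← map_zpow, DihedralGroup.r_one_zpow]
    · exfalso
      have h1 := ho (DihedralGroup.sr i)
      rw [hx', DihedralGroup.orderOf_sr] at h1
      have h2 : orderOf (t * u * t⁻¹) = orderOf u :=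
        orderOf_injective (MulAut.conj t).toMonoidHom (MulAut.conj t).injective u
      rw [h2, hu] at h1
      have : 2 ^ 2 ≤ 2 ^ l := Nat.pow_le_pow_right (by norm_num) hl
      omega

theorem genSet_top {φ : G → ℂ} (hφ : IsIrreducibleCharacter φ) : φ ∈ GenSet (P := G) 1 := by
  refine ⟨⊤, fun q => φ q, irr_comp (Subgroup.topEquiv) hφ, by simp, ?_⟩
  funext g
  rw [inducedChar]
  have h1 : ∀ x : G, (if h : x * g * x⁻¹ ∈ (⊤ : Subgroup G) then φ (⟨x * g * x⁻¹, h⟩ : (⊤ : Subgroup G)) else 0) = φ g := by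
    intro x
    rw [dif_pos (Subgroup.mem_top _)]
    exact irr_conj hφ _ _
  rw [Finset.sum_congr rfl (fun x _ => h1 x), Finset.sum_const, nsmul_eq_mul, ← mul_assoc]
  have h2 : Fintype.card (⊤ : Subgroup G) = Fintype.card G := Fintype.card_congr (Subgroup.topEquiv).toEquiv
  rw [h2, Finset.card_univ, inv_mul_cancel₀ (by exact_mod_cast Fintype.card_ne_zero), one_mul]

theorem genSet_bot : (fun g : G => if g = 1 then (Nat.card G : ℂ) else 0) ∈ GenSet (P := G) (Nat.card G) := by
  refine ⟨⊥, fun _ => 1, ?_, by simp, ?_⟩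
  · have := irr_of_linear (1 : (⊥ : Subgroup G) →* ℂˣ)
    simpa using this
  · funext g
    rw [inducedChar]
    have h1 : ∀ x : G, (if h : x * g * x⁻¹ ∈ (⊥ : Subgroup G) then (1 : ℂ) else 0) = if g = 1 then 1 else 0 := by
      intro x
      simp
    rw [Finset.sum_congr rfl (fun x _ => h1 x), Finset.sum_const]
    by_cases hg : g = 1 <;> simp [hg]

theorem main_aux {V : Type} [AddCommGroup V] [Module ℂ V] [FiniteDimensional ℂ V] [Nontrivial V]
    (P : Sylow 2 G) {v : ℕ} (e : DihedralGroup (2 ^ v) ≃* ↥(P : Subgroup G))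
    (ρ : Representation ℂ G V) (hS : SchurRep ρ) (hχ : IsIrreducibleCharacter ρ.character) :
    SumInducedProperty 2 (P : Subgroup G) ρ.character (Module.finrank ℂ V) := by
  have : Fact (Nat.Prime 2) := ⟨Nat.prime_two⟩
  have hcard : Nat.card (P : Subgroup G) = 2 ^ (v + 1) := by
    rw [← Nat.card_congr e.toEquiv, DihedralGroup.nat_card, pow_succ']
  have hfac : (Nat.card G).factorization 2 = v + 1 := by
    have := P.card_eq_multiplicity
    change Nat.card (P : Subgroup G) = _ at this
    rw [hcard] at this
    exact (Nat.pow_right_injective le_rfl this).symm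
  have hG0 : Nat.card G ≠ 0 := Nat.card_pos.ne'
  have hG1 : 2 ^ (v + 1) ∣ Nat.card G := by rw [← hfac]; exact Nat.ordProj_dvd _ _
  have hG2 : ¬ 2 ^ (v + 2) ∣ Nat.card G := by
    rw [show v + 2 = (Nat.card G).factorization 2 + 1 by omega]
    exact Nat.pow_succ_factorization_not_dvd hG0 Nat.prime_two
  have hGS := sylow_gsetup P e hG2
  have hf0 : Module.finrank ℂ V ≠ 0 := (Module.finrank_pos (R := ℂ) (M := V)).ne'
  obtain ⟨c, hc⟩ := schur_dvd ρ hS (irr_norm hχ)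
  rw [mul_comm] at hc
  have hc0 : c ≠ 0 := by rintro rfl; simp at hc
  have hsum : c.factorization 2 + (Module.finrank ℂ V).factorization 2 = v + 1 := by
    rw [← hfac, hc, Nat.factorization_mul hc0 hf0]; rfl
  suffices hX : (fun x : (P : Subgroup G) => ρ.character (x : G)) ∈ AddSubmonoid.closure (GenSet (P := ↥(P : Subgroup G)) (2 ^ ((Module.finrank ℂ V).factorization 2))) by
    exact genSet_closure hX
  have hcn : ¬ 2 ^ (c.factorization 2 + 1) ∣ c := Nat.pow_succ_factorization_not_dvd hc0 Nat.prime_two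
  have hcd : 2 ^ (c.factorization 2) ∣ c := Nat.ordProj_dvd _ _
  have hfd : 2 ^ ((Module.finrank ℂ V).factorization 2) ∣ Module.finrank ℂ V := Nat.ordProj_dvd _ _
  obtain ⟨K, hK⟩ : ∃ K, K = c.factorization 2 := ⟨_, rfl⟩
  obtain ⟨a, ha⟩ : ∃ a, a = (Module.finrank ℂ V).factorization 2 := ⟨_, rfl⟩
  rw [← hK, ← ha] at hsum
  rw [← hK] at hcn hcd
  rw [← ha] at hfd ⊢
  rcases Nat.eq_zero_or_pos a with rfl | hap
  · rw [pow_zero]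
    obtain ⟨m, hm1, hm2⟩ := char_decomp _ (ρ.comp (P : Subgroup G).subtype) le_rfl
    have : (fun x : (P : Subgroup G) => ρ.character (x : G)) = m.sum := by rw [hm2]; rfl
    rw [this]
    exact AddSubmonoid.multiset_sum_mem _ _ fun f hf => AddSubmonoid.subset_closure (genSet_top (hm1 f hf))
  rcases Nat.eq_zero_or_pos K with rfl | hKp
  · obtain ⟨m, hm⟩ := hfd
    have ha1 : a = v + 1 := by omega
    subst ha1
    have hb := genSet_bot (G := ↥(P : Subgroup G))
    rw [hcard] at hb
    have : (fun x : (P : Subgroup G) => ρ.character (x : G)) = m • (fun g : (P : Subgroup G) => if g = 1 then ((2 ^ (v + 1) : ℕ) : ℂ) else 0) := by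
      funext x
      rw [Pi.smul_apply, nsmul_eq_mul]
      by_cases hx : x = 1
      · subst hx
        rw [if_pos rfl, Subgroup.coe_one, Representation.char_one, hm]; push_cast; ring
      · rw [if_neg hx, mul_zero]
        have hod : orderOf (x : G) ∣ 2 ^ (v + 1) := by
          rw [Subgroup.orderOf_coe, ← hcard]; exact orderOf_dvd_natCard x
        obtain ⟨j, hj, hjo⟩ := (Nat.dvd_prime_pow Nat.prime_two).mp hod
        have hj0 : j ≠ 0 := by
          rintro rfl
          rw [pow_zero, orderOf_eq_one_iff] at hjo
          exact hx (Subtype.ext hjo)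
        by_cases hj1 : j = 1
        · subst hj1
          exact k0_zero ρ hS c hc (by simpa using hcn) _ (by simpa using hjo)
        · apply hGS.vanish ρ hS hχ c 0 hc hcn
          · rw [hjo]; exact pow_dvd_pow 2 (by omega)
          · rw [hjo]; exact pow_dvd_pow 2 (by omega : 2 ≤ j)
    rw [this]
    convert AddSubmonoid.nsmul_mem _ (AddSubmonoid.subset_closure hb) m
  · obtain ⟨k, rfl⟩ : ∃ k, K = k + 1 := ⟨K - 1, by omega⟩
    obtain ⟨b, rfl⟩ : ∃ b, a = b + 1 := ⟨a - 1, by omega⟩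
    have hv : v = b + (k + 1) := by omega
    subst hv
    have := genSet_comp e.symm (mid hS hχ (P : Subgroup G) e hGS c hc hcd hcn hG1)
    simpa using this

end

end PartM13

theorem strong_form_of_dihedral_sylow
    (G : Type) [Group G] [Fintype G]
    (P : Sylow 2 G)
    (hdihedral : ∃ n : ℕ, 2 ≤ n ∧
      Nonempty (↥(P : Subgroup G) ≃* DihedralGroup (2 ^ (n - 1)))) :
    ∀ (V : FDRep ℂ G), CategoryTheory.Simple V →
      SumInducedProperty 2 (P : Subgroup G) V.character (Module.finrank ℂ V) := by
  intro V hV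
  obtain ⟨n, -, ⟨e⟩⟩ := hdihedral
  have hirr : IsIrreducibleCharacter V.character := ⟨V, hV, rfl⟩
  obtain ⟨W, _, _, _, _, ρ, hS, hρ⟩ := irr_unpack hirr
  have hd : Module.finrank ℂ V = Module.finrank ℂ W := by
    have h1 := congrFun hρ 1
    rw [Representation.char_one, FDRep.char_one] at h1
    exact_mod_cast h1
  rw [hd, hρ]
  exact main_aux P e.symm ρ hS (hρ ▸ hirr)
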